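/- Let u be a solution of the KdV equation ∂ₜu + ∂ₓ(∂ₓ²u + u²) = 0, sufficiently regular (C¹ in t, C⁴ in x, with u(t,·), ∂ₓu(t,·), ∂ₓ²u(t,·) ∈ L² and the decay in x needed for the virial identities), such that sup over t of ∫_ℝ |u(t,x)| dx < ∞ and sup over t of ‖u(t,·)‖_{H¹} < ε for some sufficiently small ε > 0. Then for any constant C > 0, with I(t) = (−C|t|^{1/2}/log|t|, C|t|^{1/2}/log|t|) for |t| ≥ 2, one has ∫_{I(t)} ( u² + (∂ₓu)² )(t,x) dx → 0 as t → ±∞; moreover, for any c₀ > 0 the Kato-smoothing estimate ∫₂^∞ ∫_ℝ e^{−c₀|x|} ( u² + (∂ₓu)² + (∂ₓ²u)² )(t,x) dx dt < +∞ holds. -/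

import Mathlib

open MeasureTheory Filter Topology

/-- The scaling function λ(t) = |t|^{1/2}/log |t|. -/
noncomputable def lam (t : ℝ) : ℝ := Real.sqrt |t| / Real.log |t|

/-! ### Algebraic weights -/

/-- The weight `(1 + y²)⁻ⁿ`. -/
noncomputable def wt (n : ℕ) (y : ℝ) : ℝ := ((1 + y ^ 2)⁻¹) ^ n

/-- The odd primitive of `wt n`. -/
noncomputable def wtInt (n : ℕ) (y : ℝ) : ℝ := ∫ x in (0 : ℝ)..y, wt n x

lemma wt_pos (n : ℕ) (y : ℝ) : 0 < wt n y := by unfold wt; positivity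

lemma inv_one_add_sq_le_one (y : ℝ) : (1 + y ^ 2)⁻¹ ≤ 1 :=
  inv_le_one_of_one_le₀ (by nlinarith)

lemma wt_le_one (n : ℕ) (y : ℝ) : wt n y ≤ 1 :=
  pow_le_one₀ (by positivity) (inv_one_add_sq_le_one y)

lemma wt_anti {m n : ℕ} (h : m ≤ n) (y : ℝ) : wt n y ≤ wt m y :=
  pow_le_pow_of_le_one (by positivity) (inv_one_add_sq_le_one y) h

lemma contDiff_wt (n : ℕ) {k : WithTop ℕ∞} : ContDiff ℝ k (wt n) := by
  unfold wt
  exact (ContDiff.inv (by fun_prop) (fun x => by positivity)).pow n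

lemma continuous_wt (n : ℕ) : Continuous (wt n) := (contDiff_wt n (k := 0)).continuous

lemma abs_mul_inv_le (y : ℝ) : |y * (1 + y ^ 2)⁻¹| ≤ 1 := by
  rw [abs_mul, abs_of_pos (by positivity : (0:ℝ) < (1 + y ^ 2)⁻¹), ← div_eq_mul_inv,
    div_le_one (by positivity)]
  nlinarith [sq_nonneg (|y| - 1), sq_abs y]

lemma abs_mul_wt_succ_le (n : ℕ) (y : ℝ) : |y| * wt (n + 1) y ≤ wt n y := by
  have h := abs_mul_inv_le y
  rw [abs_mul, abs_of_pos (by positivity : (0:ℝ) < (1 + y ^ 2)⁻¹)] at h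
  have : |y| * wt (n + 1) y = (|y| * (1 + y ^ 2)⁻¹) * wt n y := by unfold wt; ring
  rw [this]
  exact mul_le_of_le_one_left (wt_pos n y).le h

lemma sq_mul_wt_succ_le (n : ℕ) (y : ℝ) : y ^ 2 * wt (n + 1) y ≤ wt n y := by
  have : y ^ 2 * wt (n + 1) y = (y ^ 2 * (1 + y ^ 2)⁻¹) * wt n y := by unfold wt; ring
  rw [this]
  refine mul_le_of_le_one_left (wt_pos n y).le ?_
  rw [← div_eq_mul_inv, div_le_one (by positivity)]
  linarith

lemma hasDerivAt_inv_one_add_sq (y : ℝ) : HasDerivAt (fun y : ℝ => (1 + y ^ 2)⁻¹)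
    (-2 * (y * (1 + y ^ 2)⁻¹) * (1 + y ^ 2)⁻¹) y := by
  have h := ((hasDerivAt_pow 2 y).const_add 1).inv (by positivity : (1 + y ^ 2) ≠ 0)
  refine h.congr_deriv ?_
  field_simp
  simp [mul_comm]

lemma hasDerivAt_mul_inv_one_add_sq (y : ℝ) : HasDerivAt (fun y : ℝ => y * (1 + y ^ 2)⁻¹)
    ((1 + y ^ 2)⁻¹ - 2 * (y * (1 + y ^ 2)⁻¹) ^ 2) y := by
  have h := (hasDerivAt_id y).mul (hasDerivAt_inv_one_add_sq y)
  refine h.congr_deriv ?_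
  simp; ring

lemma hasDerivAt_wt (n : ℕ) (y : ℝ) :
    HasDerivAt (wt n) (wt n y * (-(2 * n) * (y * (1 + y ^ 2)⁻¹))) y := by
  have h := (hasDerivAt_inv_one_add_sq y).pow n
  refine h.congr_deriv ?_
  unfold wt
  rcases n with _ | n
  · simp
  · push_cast; ring

lemma deriv_wt (n : ℕ) : deriv (wt n) =
    fun y => wt n y * (-(2 * n) * (y * (1 + y ^ 2)⁻¹)) :=
  funext fun y => (hasDerivAt_wt n y).deriv

lemma deriv2_wt (n : ℕ) : deriv (deriv (wt n)) =
    fun y => wt n y * (-(2 * n) * (1 + y ^ 2)⁻¹ +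
      (4 * n ^ 2 + 4 * n) * (y * (1 + y ^ 2)⁻¹) ^ 2) := by
  rw [deriv_wt]
  funext y
  refine HasDerivAt.deriv ?_
  have h := (hasDerivAt_wt n y).mul ((hasDerivAt_mul_inv_one_add_sq y).const_mul (-(2 * n : ℝ)))
  refine h.congr_deriv ?_
  ring

lemma deriv3_wt (n : ℕ) : deriv (deriv (deriv (wt n))) =
    fun y => wt n y * ((-(2 * n) * (y * (1 + y ^ 2)⁻¹)) * (-(2 * n) * (1 + y ^ 2)⁻¹ +
      (4 * n ^ 2 + 4 * n) * (y * (1 + y ^ 2)⁻¹) ^ 2) +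
      (4 * n * ((y * (1 + y ^ 2)⁻¹) * (1 + y ^ 2)⁻¹) + (8 * n ^ 2 + 8 * n) *
        (y * (1 + y ^ 2)⁻¹) * ((1 + y ^ 2)⁻¹ - 2 * (y * (1 + y ^ 2)⁻¹) ^ 2))) := by
  rw [deriv2_wt]
  funext y
  refine HasDerivAt.deriv ?_
  have h := (hasDerivAt_wt n y).mul
    (((hasDerivAt_inv_one_add_sq y).const_mul (-(2 * n : ℝ))).add
      (((hasDerivAt_mul_inv_one_add_sq y).pow 2).const_mul (4 * n ^ 2 + 4 * n : ℝ)))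
  refine h.congr_deriv ?_
  simp only [Nat.cast_ofNat, Nat.add_one_sub_one, pow_one, Pi.add_apply, Pi.pow_apply]
  ring

/-- A constant dominating the first three logarithmic derivatives of `wt n`. -/
noncomputable def wtC (n : ℕ) : ℝ := 100 * (n + 1) ^ 3

lemma one_le_wtC (n : ℕ) : 1 ≤ wtC n := by
  unfold wtC
  have : (1:ℝ) ≤ ((n:ℝ) + 1) ^ 3 := one_le_pow₀ (by linarith [n.cast_nonneg (α := ℝ)])
  linarith

lemma wtC_pos (n : ℕ) : 0 < wtC n := by linarith [one_le_wtC n]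

lemma abs_wt_mul_le {n : ℕ} {y r c : ℝ} (h : |r| ≤ c) : |wt n y * r| ≤ c * wt n y := by
  rw [abs_mul, abs_of_pos (wt_pos n y), mul_comm]
  exact mul_le_mul_of_nonneg_right h (wt_pos n y).le

lemma abs_deriv_wt_le (n : ℕ) (y : ℝ) : |deriv (wt n) y| ≤ wtC n * wt n y := by
  rw [deriv_wt]
  refine abs_wt_mul_le ?_
  have h1 := abs_mul_inv_le y
  have h0 : (0:ℝ) ≤ n := n.cast_nonneg
  rw [abs_mul, abs_neg, abs_of_nonneg (by positivity)]
  unfold wtC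
  have h2 : 2 * (n:ℝ) * |y * (1 + y ^ 2)⁻¹| ≤ 2 * n * 1 := by gcongr
  nlinarith [sq_nonneg (n:ℝ), pow_nonneg h0 3]

lemma abs_deriv2_wt_le (n : ℕ) (y : ℝ) : |deriv (deriv (wt n)) y| ≤ wtC n * wt n y := by
  rw [deriv2_wt]
  refine abs_wt_mul_le ?_
  have h1 := abs_mul_inv_le y
  have h2 := inv_one_add_sq_le_one y
  have h3 : 0 < (1 + y ^ 2)⁻¹ := by positivity
  have h0 : (0:ℝ) ≤ n := n.cast_nonneg
  set z := y * (1 + y ^ 2)⁻¹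
  set p := (1 + y ^ 2)⁻¹
  have hz : z ^ 2 ≤ 1 := by rw [← sq_abs]; exact pow_le_one₀ (abs_nonneg z) h1
  have a1 : (n:ℝ) * p ≤ n * 1 := by gcongr
  have a2 : (4 * (n:ℝ) ^ 2 + 4 * n) * z ^ 2 ≤ (4 * n ^ 2 + 4 * n) * 1 := by gcongr
  have a3 : 0 ≤ (4 * (n:ℝ) ^ 2 + 4 * n) * z ^ 2 := by positivity
  have a4 : 0 ≤ (n:ℝ) * p := by positivity
  unfold wtC
  rw [abs_le]
  constructor <;> nlinarith [sq_nonneg (n:ℝ), pow_nonneg h0 3]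

lemma abs_deriv3_wt_le (n : ℕ) (y : ℝ) :
    |deriv (deriv (deriv (wt n))) y| ≤ wtC n * wt n y := by
  rw [deriv3_wt]
  refine abs_wt_mul_le ?_
  have h1 := abs_mul_inv_le y
  have h2 := inv_one_add_sq_le_one y
  have h3 : 0 < (1 + y ^ 2)⁻¹ := by positivity
  have h0 : (0:ℝ) ≤ n := n.cast_nonneg
  set z := y * (1 + y ^ 2)⁻¹
  set p := (1 + y ^ 2)⁻¹
  have hz : z ^ 2 ≤ 1 := by rw [← sq_abs]; exact pow_le_one₀ (abs_nonneg z) h1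
  have e : -(2 * (n:ℝ)) * z * (-(2 * n) * p + (4 * n ^ 2 + 4 * n) * z ^ 2) +
      (4 * n * (z * p) + (8 * n ^ 2 + 8 * n) * z * (p - 2 * z ^ 2))
      = z * ((12 * n ^ 2 + 12 * n) * p - (8 * n ^ 3 + 24 * n ^ 2 + 16 * n) * z ^ 2) := by ring
  rw [e, abs_mul]
  have a1 : (12 * (n:ℝ) ^ 2 + 12 * n) * p ≤ (12 * n ^ 2 + 12 * n) * 1 := by gcongr
  have a2 : (8 * (n:ℝ) ^ 3 + 24 * n ^ 2 + 16 * n) * z ^ 2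
    ≤ (8 * (n:ℝ) ^ 3 + 24 * n ^ 2 + 16 * n) * 1 := by gcongr
  have a3 : 0 ≤ (12 * (n:ℝ) ^ 2 + 12 * n) * p := by positivity
  have a4 : 0 ≤ (8 * (n:ℝ) ^ 3 + 24 * n ^ 2 + 16 * n) * z ^ 2 := by positivity
  have a5 : |(12 * (n:ℝ) ^ 2 + 12 * n) * p - (8 * n ^ 3 + 24 * n ^ 2 + 16 * n) * z ^ 2|
      ≤ wtC n := by
    unfold wtC
    rw [abs_le]
    constructor <;> nlinarith [sq_nonneg (n:ℝ), pow_nonneg h0 3]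
  calc |z| * _ ≤ 1 * wtC n := by gcongr
    _ = _ := one_mul _

lemma abs_mul_deriv_wt_le (n : ℕ) (y : ℝ) : |y * deriv (wt n) y| ≤ wtC n * wt n y := by
  rw [deriv_wt]
  have e : y * (wt n y * (-(2 * n) * (y * (1 + y ^ 2)⁻¹)))
    = wt n y * (-(2 * n) * (y ^ 2 * (1 + y ^ 2)⁻¹)) := by ring
  simp only [e]
  refine abs_wt_mul_le ?_
  have h0 : (0:ℝ) ≤ n := n.cast_nonneg
  have h1 : y ^ 2 * (1 + y ^ 2)⁻¹ ≤ 1 := by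
    rw [← div_eq_mul_inv, div_le_one (by positivity)]
    linarith
  rw [abs_mul, abs_neg, abs_of_nonneg (by positivity),
    abs_of_nonneg (by positivity : (0:ℝ) ≤ y ^ 2 * (1 + y ^ 2)⁻¹)]
  unfold wtC
  have h2 : 2 * (n:ℝ) * (y ^ 2 * (1 + y ^ 2)⁻¹) ≤ 2 * n * 1 := by gcongr
  nlinarith [sq_nonneg (n:ℝ), pow_nonneg h0 3]

lemma hasDerivAt_wtInt (n : ℕ) (y : ℝ) : HasDerivAt (wtInt n) (wt n y) y :=
  intervalIntegral.integral_hasDerivAt_right ((continuous_wt n).intervalIntegrable _ _)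
    (continuous_wt n).stronglyMeasurable.stronglyMeasurableAtFilter
    (continuous_wt n).continuousAt

lemma deriv_wtInt (n : ℕ) : deriv (wtInt n) = wt n :=
  funext fun y => (hasDerivAt_wtInt n y).deriv

lemma contDiff_wtInt (n : ℕ) (k : ℕ) : ContDiff ℝ k (wtInt n) := by
  have : ContDiff ℝ (k + 1) (wtInt n) := by
    rw [contDiff_succ_iff_deriv]
    refine ⟨fun y => (hasDerivAt_wtInt n y).differentiableAt, by simp, ?_⟩
    rw [deriv_wtInt]
    exact contDiff_wt n
  exact this.of_le (by norm_num)

lemma integrable_wt_one : Integrable (wt 1) := by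
  have : wt 1 = fun y : ℝ => (1 + y ^ 2)⁻¹ := by funext y; simp [wt]
  rw [this]; exact integrable_inv_one_add_sq

lemma integrable_wt {n : ℕ} (hn : 1 ≤ n) : Integrable (wt n) :=
  integrable_wt_one.mono (continuous_wt n).aestronglyMeasurable
    (Eventually.of_forall fun y => by
      rw [Real.norm_of_nonneg (wt_pos n y).le, Real.norm_of_nonneg (wt_pos 1 y).le]
      exact wt_anti hn y)

lemma abs_wtInt_le {n : ℕ} (hn : 1 ≤ n) (y : ℝ) : |wtInt n y| ≤ Real.pi := by
  have h1 : |wtInt n y| ≤ ∫ x, wt 1 x := by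
    have := intervalIntegral.norm_integral_le_integral_norm_uIoc (f := wt n) (a := 0) (b := y)
      (μ := volume)
    refine this.trans ?_
    have h2 : ∫ x in Set.uIoc 0 y, ‖wt n x‖ ≤ ∫ x, ‖wt n x‖ :=
      setIntegral_le_integral (integrable_wt hn).norm (Eventually.of_forall fun _ => norm_nonneg _)
    refine h2.trans (integral_mono (integrable_wt hn).norm integrable_wt_one fun x => ?_)
    simp only [Real.norm_of_nonneg (wt_pos n x).le]
    exact wt_anti hn x
  have h2 : ∫ x, wt 1 x = Real.pi := by
    have : wt 1 = fun y : ℝ => (1 + y ^ 2)⁻¹ := by funext y; simp [wt]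
    rw [this]; exact integral_univ_inv_one_add_sq
  linarith

/-- `ψ` is thrice continuously differentiable with bounded derivatives up to order three. -/
def Adm (ψ : ℝ → ℝ) : Prop :=
  ContDiff ℝ 3 ψ ∧ ∃ M : ℝ, ∀ n ≤ 3, ∀ x, |iteratedDeriv n ψ x| ≤ M

lemma iteratedDeriv_three {ψ : ℝ → ℝ} : iteratedDeriv 3 ψ = deriv (deriv (deriv ψ)) := by
  rw [iteratedDeriv_succ, iteratedDeriv_succ, iteratedDeriv_one]

lemma iteratedDeriv_two' {ψ : ℝ → ℝ} : iteratedDeriv 2 ψ = deriv (deriv ψ) := by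
  rw [iteratedDeriv_succ, iteratedDeriv_one]

lemma adm_of_bounds {ψ : ℝ → ℝ} (h : ContDiff ℝ 3 ψ) {B : ℝ} (h0 : ∀ x, |ψ x| ≤ B)
    (h1 : ∀ x, |deriv ψ x| ≤ B) (h2 : ∀ x, |deriv (deriv ψ) x| ≤ B)
    (h3 : ∀ x, |deriv (deriv (deriv ψ)) x| ≤ B) : Adm ψ := by
  refine ⟨h, B, fun n hn x => ?_⟩
  interval_cases n
  · simpa using h0 x
  · simpa [iteratedDeriv_one] using h1 x
  · rw [iteratedDeriv_two']; exact h2 x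
  · rw [iteratedDeriv_three]; exact h3 x

lemma Adm.bounds {ψ : ℝ → ℝ} (h : Adm ψ) : ∃ B, 0 ≤ B ∧ (∀ x, |ψ x| ≤ B) ∧
    (∀ x, |deriv ψ x| ≤ B) ∧ (∀ x, |deriv (deriv ψ) x| ≤ B) ∧
    ∀ x, |deriv (deriv (deriv ψ)) x| ≤ B := by
  obtain ⟨_, B, hB⟩ := h
  refine ⟨B, (abs_nonneg _).trans (hB 0 (by norm_num) 0), fun x => ?_, fun x => ?_, fun x => ?_,
    fun x => ?_⟩
  · simpa using hB 0 (by norm_num) x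
  · simpa [iteratedDeriv_one] using hB 1 (by norm_num) x
  · rw [← iteratedDeriv_two']; exact hB 2 (by norm_num) x
  · rw [← iteratedDeriv_three]; exact hB 3 (by norm_num) x

lemma wtC_mul_wt_le (n : ℕ) (x : ℝ) : wtC n * wt n x ≤ wtC n :=
  mul_le_of_le_one_right (wtC_pos n).le (wt_le_one n x)

lemma adm_wt (n : ℕ) : Adm (wt n) :=
  adm_of_bounds (contDiff_wt n) (B := wtC n)
    (fun x => by rw [abs_of_pos (wt_pos n x)]; linarith [wt_le_one n x, one_le_wtC n])
    (fun x => (abs_deriv_wt_le n x).trans (wtC_mul_wt_le n x))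
    (fun x => (abs_deriv2_wt_le n x).trans (wtC_mul_wt_le n x))
    (fun x => (abs_deriv3_wt_le n x).trans (wtC_mul_wt_le n x))

lemma adm_wtInt {n : ℕ} (hn : 1 ≤ n) : Adm (wtInt n) :=
  adm_of_bounds (contDiff_wtInt n 3) (B := Real.pi + wtC n)
    (fun x => (abs_wtInt_le hn x).trans (by linarith [wtC_pos n]))
    (fun x => by
      rw [deriv_wtInt, abs_of_pos (wt_pos n x)]
      linarith [wt_le_one n x, one_le_wtC n, Real.pi_pos])
    (fun x => by
      rw [deriv_wtInt]
      linarith [abs_deriv_wt_le n x, wtC_mul_wt_le n x, Real.pi_pos])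
    (fun x => by
      rw [deriv_wtInt]
      linarith [abs_deriv2_wt_le n x, wtC_mul_wt_le n x, Real.pi_pos])

/-! ### Functions dominated by the derivative of a bounded function -/

/-- `a` is bounded above on `(2, ∞)` by the derivative of a bounded function. -/
def Tame (a : ℝ → ℝ) : Prop :=
  ∃ (F F' : ℝ → ℝ) (K : ℝ), (∀ t, 2 < t → HasDerivAt F (F' t) t) ∧
    (∀ t, 2 < t → |F t| ≤ K) ∧ ∀ t, 2 < t → a t ≤ F' t

lemma Tame.mono {a b : ℝ → ℝ} (h : Tame b) (hab : ∀ t, 2 < t → a t ≤ b t) : Tame a := by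
  obtain ⟨F, F', K, h1, h2, h3⟩ := h
  exact ⟨F, F', K, h1, h2, fun t ht => (hab t ht).trans (h3 t ht)⟩

lemma Tame.add {a b : ℝ → ℝ} (ha : Tame a) (hb : Tame b) : Tame (fun t => a t + b t) := by
  obtain ⟨F, F', K, h1, h2, h3⟩ := ha
  obtain ⟨G, G', L, g1, g2, g3⟩ := hb
  exact ⟨fun t => F t + G t, fun t => F' t + G' t, K + L, fun t ht => (h1 t ht).add (g1 t ht),
    fun t ht => (abs_add_le _ _).trans (add_le_add (h2 t ht) (g2 t ht)),
    fun t ht => add_le_add (h3 t ht) (g3 t ht)⟩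

lemma Tame.const_mul {a : ℝ → ℝ} (ha : Tame a) {c : ℝ} (hc : 0 ≤ c) :
    Tame (fun t => c * a t) := by
  obtain ⟨F, F', K, h1, h2, h3⟩ := ha
  exact ⟨fun t => c * F t, fun t => c * F' t, c * K, fun t ht => (h1 t ht).const_mul c,
    fun t ht => by
      rw [abs_mul, abs_of_nonneg hc]; exact mul_le_mul_of_nonneg_left (h2 t ht) hc,
    fun t ht => mul_le_mul_of_nonneg_left (h3 t ht) hc⟩

lemma Tame.of_hasDerivAt {F F' : ℝ → ℝ} {K : ℝ} (h1 : ∀ t, 2 < t → HasDerivAt F (F' t) t)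
    (h2 : ∀ t, 2 < t → |F t| ≤ K) : Tame F' :=
  ⟨F, F', K, h1, h2, fun _ _ => le_rfl⟩

/-! ### Virial functionals at a fixed time -/

/-- Right-hand side of the linear virial identity at scale `l`. -/
noncomputable def virLin (l l' : ℝ) (v ψ : ℝ → ℝ) : ℝ :=
  -(l' / l) * (∫ x, (x / l) * deriv ψ (x / l) * v x)
    + (1 / l ^ 3) * (∫ x, deriv (deriv (deriv ψ)) (x / l) * v x)
    + (1 / l) * ∫ x, deriv ψ (x / l) * (v x) ^ 2

/-- Right-hand side of the mass virial identity at scale `l`. -/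
noncomputable def virMass (l l' : ℝ) (v φ : ℝ → ℝ) : ℝ :=
  -(l' / (2 * l)) * (∫ x, (x / l) * deriv φ (x / l) * (v x) ^ 2)
    - (3 / (2 * l)) * (∫ x, deriv φ (x / l) * (deriv v x) ^ 2)
    + (1 / (2 * l ^ 3)) * (∫ x, deriv (deriv (deriv φ)) (x / l) * (v x) ^ 2)
    + (1 / l) * ∫ x, deriv φ (x / l) * (2/3) * (v x) ^ 3

/-- Right-hand side of the energy virial identity at scale `l`. -/
noncomputable def virEnergy (l l' : ℝ) (v φ : ℝ → ℝ) : ℝ :=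
  -(l' / (2 * l)) * (∫ x, (x / l) * deriv φ (x / l) * ((deriv v x) ^ 2 - (2/3) * (v x) ^ 3))
    - (3 / (2 * l)) * (∫ x, deriv φ (x / l) * (deriv (deriv v) x) ^ 2)
    + (1 / (2 * l ^ 3)) * (∫ x, deriv (deriv (deriv φ)) (x / l) * (deriv v x) ^ 2)
    + (1 / (3 * l ^ 3)) * (∫ x, deriv (deriv (deriv φ)) (x / l) * (v x) ^ 3)
    + (2 / l) * (∫ x, deriv φ (x / l) * deriv (fun y => (v y) ^ 2) x * deriv v x)
    + (2 / l ^ 2) * (∫ x, deriv (deriv φ) (x / l) * (v x) ^ 2 * deriv v x)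
    - (1 / (2 * l)) * ∫ x, deriv φ (x / l) * (v x) ^ 4

/-- Regularity and size of a solution at a fixed time. -/
structure Slice (M : ℝ) (v : ℝ → ℝ) : Prop where
  smooth : ContDiff ℝ 4 v
  int : Integrable v
  int_sq : Integrable (fun x => (v x) ^ 2)
  int_deriv_sq : Integrable (fun x => (deriv v x) ^ 2)
  int_deriv2_sq : Integrable (fun x => (deriv (deriv v) x) ^ 2)
  l1_le : (∫ x, |v x|) ≤ M
  h1_le : (∫ x, ((v x) ^ 2 + (deriv v x) ^ 2)) ≤ 1

section
variable {M : ℝ} {v : ℝ → ℝ}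

lemma Slice.hasDerivAt (h : Slice M v) (x : ℝ) : HasDerivAt v (deriv v x) x :=
  ((h.smooth.differentiable (by norm_num)) x).hasDerivAt

lemma Slice.continuous (h : Slice M v) : Continuous v := h.smooth.continuous

lemma Slice.continuous_deriv (h : Slice M v) : Continuous (deriv v) :=
  h.smooth.continuous_deriv (by norm_num)

lemma Slice.sq_le_one (h : Slice M v) (x : ℝ) : (v x) ^ 2 ≤ 1 := by
  have hd : ∀ y, HasDerivAt (fun y => (v y) ^ 2) (2 * v y * deriv v y) y := fun y => by
    refine ((h.hasDerivAt y).pow 2).congr_deriv ?_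
    norm_num
  have hL1 : Integrable (fun x => (v x) ^ 2 + (deriv v x) ^ 2) := h.int_sq.add h.int_deriv_sq
  have hle : ∀ y, ‖2 * v y * deriv v y‖ ≤ (v y) ^ 2 + (deriv v y) ^ 2 := fun y => by
    rw [Real.norm_eq_abs, abs_le]
    constructor <;> nlinarith [sq_nonneg (v y - deriv v y), sq_nonneg (v y + deriv v y)]
  have hi : Integrable (fun y => 2 * v y * deriv v y) :=
    hL1.mono' ((continuous_const.mul h.continuous).mul
      h.continuous_deriv).aestronglyMeasurable (Eventually.of_forall hle)
  have ht : Tendsto (fun y => (v y) ^ 2) atBot (𝓝 0) :=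
    tendsto_zero_of_hasDerivAt_of_integrableOn_Iic (a := x) (fun y _ => hd y)
      hi.integrableOn h.int_sq.integrableOn
  have h1 := integral_Iic_of_hasDerivAt_of_tendsto' (a := x) (fun y _ => hd y)
    hi.integrableOn ht
  rw [sub_zero] at h1
  rw [← h1]
  calc _ ≤ ‖∫ y in Set.Iic x, 2 * v y * deriv v y‖ := le_abs_self _
    _ ≤ ∫ y in Set.Iic x, ((v y) ^ 2 + (deriv v y) ^ 2) :=
        norm_integral_le_of_norm_le hL1.integrableOn (Eventually.of_forall hle)
    _ ≤ ∫ y, ((v y) ^ 2 + (deriv v y) ^ 2) :=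
        setIntegral_le_integral hL1 (Eventually.of_forall fun y => by positivity)
    _ ≤ 1 := h.h1_le

lemma Slice.abs_le_one (h : Slice M v) (x : ℝ) : |v x| ≤ 1 := by
  rw [← sq_le_one_iff_abs_le_one]; exact h.sq_le_one x

lemma Slice.cube_le (h : Slice M v) (x : ℝ) : |(v x) ^ 3| ≤ (v x) ^ 2 := by
  have : |(v x) ^ 3| = |v x| * (v x) ^ 2 := by rw [abs_pow, pow_succ', sq_abs]
  rw [this]
  exact mul_le_of_le_one_left (sq_nonneg _) (h.abs_le_one x)

lemma Slice.four_le (h : Slice M v) (x : ℝ) : |(v x) ^ 4| ≤ (v x) ^ 2 := by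
  rw [abs_of_nonneg (by positivity)]
  nlinarith [h.sq_le_one x, sq_nonneg (v x)]

lemma Slice.M_nonneg (h : Slice M v) : 0 ≤ M :=
  (integral_nonneg fun _ => abs_nonneg _).trans h.l1_le

end

lemma abs_integral_le_integral {f g : ℝ → ℝ} (hg : Integrable g) (h : ∀ x, |f x| ≤ g x) :
    |∫ x, f x| ≤ ∫ x, g x :=
  by rw [← Real.norm_eq_abs]; exact norm_integral_le_of_norm_le hg (Eventually.of_forall h)

lemma integrable_mul_bdd {f g : ℝ → ℝ} {B : ℝ} (hg : Integrable g) (hf : Continuous f)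
    (hB : ∀ x, |f x| ≤ B) : Integrable (fun x => f x * g x) :=
  hg.bdd_mul hf.aestronglyMeasurable (Eventually.of_forall hB)

lemma integrable_wt_mul {g : ℝ → ℝ} (hg : Integrable g) (n : ℕ) (l : ℝ) :
    Integrable (fun x => wt n (x / l) * g x) :=
  integrable_mul_bdd (B := 1) hg ((continuous_wt n).comp (by fun_prop))
    (fun x => by rw [abs_of_pos (wt_pos n _)]; exact wt_le_one n _)

lemma abs_integral_le_wt {f g : ℝ → ℝ} {n : ℕ} {l C : ℝ} (hg : Integrable g)
    (h : ∀ x, |f x| ≤ C * (wt n (x / l) * g x)) :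
    |∫ x, f x| ≤ C * ∫ x, wt n (x / l) * g x := by
  rw [← integral_const_mul]
  exact abs_integral_le_integral ((integrable_wt_mul hg n l).const_mul C) h

lemma integral_wt_mono {g : ℝ → ℝ} (hg : Integrable g) (h0 : ∀ x, 0 ≤ g x) {m n : ℕ}
    (h : m ≤ n) (l : ℝ) : (∫ x, wt n (x / l) * g x) ≤ ∫ x, wt m (x / l) * g x :=
  integral_mono (integrable_wt_mul hg n l) (integrable_wt_mul hg m l)
    fun x => mul_le_mul_of_nonneg_right (wt_anti h _) (h0 x)

lemma integral_wt_nonneg {g : ℝ → ℝ} (h0 : ∀ x, 0 ≤ g x) (n : ℕ) (l : ℝ) :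
    0 ≤ ∫ x, wt n (x / l) * g x :=
  integral_nonneg fun x => mul_nonneg (wt_pos n _).le (h0 x)

section estimates
variable {M l l' c : ℝ} {v : ℝ → ℝ}

lemma virLin_lower (hv : Slice M v) (hl : 0 < l) :
    (1 / (2 * l)) * (∫ x, wt 2 (x / l) * (v x) ^ 2) ≤
      virLin l l' v (wtInt 2) + (Real.pi * l' ^ 2 + wtC 2 * M / l ^ 3) := by
  unfold virLin
  rw [deriv_wtInt]
  set A := ∫ x, wt 2 (x / l) * (v x) ^ 2
  set X := ∫ x, (x / l) * wt 2 (x / l) * v x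
  set Y := ∫ x, deriv (deriv (wt 2)) (x / l) * v x
  have hY : |Y| ≤ wtC 2 * M := by
    have : |Y| ≤ ∫ x, wtC 2 * |v x| := abs_integral_le_integral
      (hv.int.abs.const_mul _) fun x => by
        rw [abs_mul]
        exact mul_le_mul_of_nonneg_right ((abs_deriv2_wt_le 2 _).trans (wtC_mul_wt_le 2 _))
          (abs_nonneg _)
    rw [integral_const_mul] at this
    exact this.trans (mul_le_mul_of_nonneg_left hv.l1_le (wtC_pos 2).le)
  have hint1 : Integrable (fun x : ℝ => wt 1 (x / l)) :=
    integrable_wt_one.comp_div hl.ne'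
  have hI1 : ∫ x : ℝ, wt 1 (x / l) = l * Real.pi := by
    rw [Measure.integral_comp_div]
    have : wt 1 = fun y : ℝ => (1 + y ^ 2)⁻¹ := by funext y; simp [wt]
    rw [this, integral_univ_inv_one_add_sq, abs_of_pos hl, smul_eq_mul]
  -- Young's inequality with parameter `l'`
  have hX : |l'| * |X| ≤ 1 / 2 * A + 1 / 2 * l' ^ 2 * (l * Real.pi) := by
    have e : |l'| * |X| = |∫ x, l' * ((x / l) * wt 2 (x / l) * v x)| := by
      rw [integral_const_mul, abs_mul]
    rw [e, ← hI1, ← integral_const_mul, ← integral_const_mul, ← integral_add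
      ((integrable_wt_mul hv.int_sq 2 l).const_mul _) (hint1.const_mul _)]
    refine abs_integral_le_integral (((integrable_wt_mul hv.int_sq 2 l).const_mul _).add
      (hint1.const_mul _)) fun x => ?_
    have h1 := sq_mul_wt_succ_le 1 (x / l)
    have h2 := wt_pos 2 (x / l)
    have h3 : l' ^ 2 * ((x / l) ^ 2 * wt 2 (x / l)) ≤ l' ^ 2 * wt 1 (x / l) :=
      mul_le_mul_of_nonneg_left h1 (sq_nonneg _)
    rw [abs_le]
    constructor
    · nlinarith [mul_nonneg h2.le (sq_nonneg (v x + l' * (x / l)))]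
    · nlinarith [mul_nonneg h2.le (sq_nonneg (v x - l' * (x / l)))]
  have hX' : |(l' / l) * X| ≤ 1 / (2 * l) * A + Real.pi * l' ^ 2 := by
    rw [abs_mul, abs_div, abs_of_pos hl]
    have : |l'| / l * |X| = (|l'| * |X|) / l := by ring
    rw [this, div_le_iff₀ hl]
    have h2 : (1 / (2 * l) * A + Real.pi * l' ^ 2) * l = 1 / 2 * A + Real.pi * l' ^ 2 * l := by
      field_simp
    rw [h2]
    nlinarith [mul_nonneg (mul_nonneg (sq_nonneg l') hl.le) Real.pi_pos.le]
  have hY' : |1 / l ^ 3 * Y| ≤ wtC 2 * M / l ^ 3 := by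
    rw [abs_mul, abs_of_pos (by positivity), one_div, inv_mul_eq_div]
    gcongr
  have e2 : 1 / l * A = 1 / (2 * l) * A + 1 / (2 * l) * A := by field_simp; ring
  have h1 := abs_le.1 hX'
  have h2 := abs_le.1 hY'
  rw [e2, neg_mul]
  linarith [h1.2, h2.1]


lemma one_div_cube_le (hc : 0 < c) (hl : c ≤ l) : 1 / l ^ 3 ≤ 1 / c ^ 2 * (1 / l) := by
  have hl0 : 0 < l := hc.trans_le hl
  rw [div_mul_div_comm, one_mul]
  apply one_div_le_one_div_of_le (by positivity)
  have : c ^ 2 ≤ l ^ 2 := by gcongr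
  nlinarith

lemma one_div_sq_le (hc : 0 < c) (hl : c ≤ l) : 1 / l ^ 2 ≤ 1 / c * (1 / l) := by
  have hl0 : 0 < l := hc.trans_le hl
  rw [div_mul_div_comm, one_mul]
  apply one_div_le_one_div_of_le (by positivity)
  nlinarith

lemma abs_coef_mul_le {a b A B : ℝ} (ha : |a| ≤ A) (hb : |b| ≤ B) : |a * b| ≤ A * B := by
  rw [abs_mul]
  exact mul_le_mul ha hb (abs_nonneg _) ((abs_nonneg _).trans ha)

lemma abs_wt_coef_le {n : ℕ} {y a b g r : ℝ} (ha : |a| ≤ r * wt n y) (hb : |b| ≤ g) :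
    |a * b| ≤ r * (wt n y * g) := by
  rw [← mul_assoc]; exact abs_coef_mul_le ha hb

lemma abs_y_wt_succ_le (n : ℕ) (y : ℝ) : |y * wt (n + 1) y| ≤ 1 * wt n y := by
  rw [abs_mul, abs_of_pos (wt_pos _ _), one_mul]
  exact abs_mul_wt_succ_le n y

lemma virMass_approx {K r : ℝ} {φ : ℝ → ℝ} (hv : Slice M v) (hc : 0 < c) (hl : c ≤ l)
    (hK : |l'| ≤ K) (hφ : ∀ y, |y * deriv φ y| ≤ r * wt 2 y)
    (hφ1 : ∀ y, |deriv φ y| ≤ r * wt 3 y)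
    (hφ3 : ∀ y, |deriv (deriv (deriv φ)) y| ≤ r * wt 3 y) :
    |virMass l l' v φ + 3 / 2 * ((1 / l) * ∫ x, deriv φ (x / l) * (deriv v x) ^ 2)| ≤
      ((K + 1 / c ^ 2 + 1) * r) * ((1 / l) * ∫ x, wt 2 (x / l) * (v x) ^ 2) := by
  have hl0 : 0 < l := hc.trans_le hl
  have hr : 0 ≤ r := by
    have := (abs_nonneg _).trans (hφ1 0)
    exact nonneg_of_mul_nonneg_left this (wt_pos 3 0)
  unfold virMass
  set A := ∫ x, wt 2 (x / l) * (v x) ^ 2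
  have hA : 0 ≤ A := integral_wt_nonneg (fun x => sq_nonneg _) 2 l
  have h32 := integral_wt_mono hv.int_sq (fun x => sq_nonneg (v x)) (by norm_num : 2 ≤ 3) l
  set B := ∫ x, deriv φ (x / l) * (deriv v x) ^ 2
  have h1 : |∫ x, (x / l) * deriv φ (x / l) * (v x) ^ 2| ≤ r * A :=
    abs_integral_le_wt hv.int_sq fun x => abs_wt_coef_le (hφ _)
      (abs_of_nonneg (sq_nonneg _)).le
  have h2 : |∫ x, deriv (deriv (deriv φ)) (x / l) * (v x) ^ 2| ≤
      r * ∫ x, wt 3 (x / l) * (v x) ^ 2 :=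
    abs_integral_le_wt hv.int_sq fun x => abs_wt_coef_le (hφ3 _)
      (abs_of_nonneg (sq_nonneg _)).le
  have h3 : |∫ x, deriv φ (x / l) * (2/3) * (v x) ^ 3| ≤ r * ∫ x, wt 3 (x / l) * (v x) ^ 2 :=
    abs_integral_le_wt hv.int_sq fun x => by
      rw [mul_assoc]
      refine abs_wt_coef_le (hφ1 _) ?_
      rw [abs_mul, abs_of_pos (by norm_num : (0:ℝ) < 2/3)]
      nlinarith [hv.cube_le x, abs_nonneg ((v x) ^ 3)]
  have h2' := h2.trans (mul_le_mul_of_nonneg_left h32 hr)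
  have h3' := h3.trans (mul_le_mul_of_nonneg_left h32 hr)
  have hK0 : 0 ≤ K := (abs_nonneg _).trans hK
  have c1 : |-(l' / (2 * l))| ≤ K * (1 / l) := by
    rw [abs_neg, abs_div, abs_of_pos (by positivity : 0 < 2 * l), mul_one_div]
    gcongr
    linarith
  have c2 : |1 / (2 * l ^ 3)| ≤ 1 / c ^ 2 * (1 / l) := by
    rw [abs_of_pos (by positivity)]
    refine le_trans ?_ (one_div_cube_le hc hl)
    apply one_div_le_one_div_of_le (by positivity)
    nlinarith [pow_pos hl0 3]
  have c3 : |1 / l| ≤ 1 / l := (abs_of_pos (by positivity)).le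
  have k1 := abs_le.1 (abs_coef_mul_le c1 h1)
  have k2 := abs_le.1 (abs_coef_mul_le c2 h2')
  have k3 := abs_le.1 (abs_coef_mul_le c3 h3')
  have e : 3 / (2 * l) * B = 3 / 2 * (1 / l * B) := by field_simp
  have e' : (K + 1 / c ^ 2 + 1) * r * (1 / l * A) = K * (1 / l) * (r * A) +
    1 / c ^ 2 * (1 / l) * (r * A) + 1 / l * (r * A) := by ring
  rw [e, e', abs_le]
  constructor
  · linarith [k1.1, k2.1, k3.1]
  · linarith [k1.2, k2.2, k3.2]

lemma virEnergy_approx {K r : ℝ} {φ : ℝ → ℝ} (hv : Slice M v) (hc : 0 < c) (hl : c ≤ l)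
    (hK : |l'| ≤ K) (hφ : ∀ y, |y * deriv φ y| ≤ r * wt 3 y)
    (hφ1 : ∀ y, |deriv φ y| ≤ r * wt 4 y) (hφ2 : ∀ y, |deriv (deriv φ) y| ≤ r * wt 4 y)
    (hφ3 : ∀ y, |deriv (deriv (deriv φ)) y| ≤ r * wt 4 y) :
    |virEnergy l l' v φ + 3 / 2 * ((1 / l) * ∫ x, deriv φ (x / l) * (deriv (deriv v) x) ^ 2)| ≤
      ((K + 2 * (1 / c ^ 2) + 2 * (1 / c) + 5) * r) *
        ((1 / l) * ((∫ x, wt 2 (x / l) * (v x) ^ 2) +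
          ∫ x, wt 3 (x / l) * (deriv v x) ^ 2)) := by
  have hl0 : 0 < l := hc.trans_le hl
  have hC : 0 ≤ r := by
    have := (abs_nonneg _).trans (hφ1 0)
    exact nonneg_of_mul_nonneg_left this (wt_pos 4 0)
  unfold virEnergy
  set A := ∫ x, wt 2 (x / l) * (v x) ^ 2
  set A' := ∫ x, wt 3 (x / l) * (deriv v x) ^ 2
  have hA : 0 ≤ A := integral_wt_nonneg (fun x => sq_nonneg _) 2 l
  have hA' : 0 ≤ A' := integral_wt_nonneg (fun x => sq_nonneg _) 3 l
  have hg : Integrable (fun x => (v x) ^ 2 + (deriv v x) ^ 2) := hv.int_sq.add hv.int_deriv_sq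
  have hg0 : ∀ x, 0 ≤ (v x) ^ 2 + (deriv v x) ^ 2 := fun x => by positivity
  set S := ∫ x, wt 4 (x / l) * ((v x) ^ 2 + (deriv v x) ^ 2)
  have hS3 : (∫ x, wt 3 (x / l) * ((v x) ^ 2 + (deriv v x) ^ 2)) ≤ A + A' := by
    have : (∫ x, wt 3 (x / l) * ((v x) ^ 2 + (deriv v x) ^ 2)) =
        (∫ x, wt 3 (x / l) * (v x) ^ 2) + A' := by
      rw [← integral_add (integrable_wt_mul hv.int_sq 3 l) (integrable_wt_mul hv.int_deriv_sq 3 l)]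
      simp only [mul_add]
    rw [this]
    linarith [integral_wt_mono hv.int_sq (fun x => sq_nonneg (v x)) (by norm_num : 2 ≤ 3) l]
  have hS : S ≤ A + A' := (integral_wt_mono hg hg0 (by norm_num : 3 ≤ 4) l).trans hS3
  set B := ∫ x, deriv φ (x / l) * (deriv (deriv v) x) ^ 2
  have h1 : |∫ x, (x / l) * deriv φ (x / l) * ((deriv v x) ^ 2 - (2/3) * (v x) ^ 3)| ≤
      r * (A + A') :=
    (abs_integral_le_wt hg fun x => abs_wt_coef_le (hφ _) (by
      have := abs_le.1 (hv.cube_le x)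
      rw [abs_le]; constructor <;> nlinarith [sq_nonneg (v x), sq_nonneg (deriv v x)])).trans
      (mul_le_mul_of_nonneg_left hS3 hC)
  have h2 : |∫ x, deriv (deriv (deriv φ)) (x / l) * (deriv v x) ^ 2| ≤ r * (A + A') :=
    (abs_integral_le_wt hg fun x => abs_wt_coef_le (hφ3 _) (by
      rw [abs_of_nonneg (sq_nonneg _)]; nlinarith [sq_nonneg (v x)])).trans
      (mul_le_mul_of_nonneg_left hS hC)
  have h3 : |∫ x, deriv (deriv (deriv φ)) (x / l) * (v x) ^ 3| ≤ r * (A + A') :=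
    (abs_integral_le_wt hg fun x => abs_wt_coef_le (hφ3 _)
      ((hv.cube_le x).trans (by nlinarith [sq_nonneg (deriv v x)]))).trans
      (mul_le_mul_of_nonneg_left hS hC)
  have h4 : |∫ x, deriv φ (x / l) * deriv (fun y => (v y) ^ 2) x * deriv v x| ≤ 2 * r * (A + A') :=
    (abs_integral_le_wt (C := 2 * r) hg fun x => by
      have hd : deriv (fun y => (v y) ^ 2) x = 2 * v x * deriv v x := by
        refine HasDerivAt.deriv (((hv.hasDerivAt x).pow 2).congr_deriv ?_)
        norm_num
      have e : deriv φ (x / l) * deriv (fun y => (v y) ^ 2) x * deriv v x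
        = deriv φ (x / l) * (2 * (v x * (deriv v x) ^ 2)) := by rw [hd]; ring
      have := abs_wt_coef_le (hφ1 (x / l)) (b := 2 * (v x * (deriv v x) ^ 2))
        (g := 2 * ((v x) ^ 2 + (deriv v x) ^ 2)) (by
          rw [abs_mul, abs_mul, abs_of_nonneg (sq_nonneg (deriv v x)),
            abs_of_pos (by norm_num : (0:ℝ) < 2)]
          nlinarith [hv.abs_le_one x, sq_nonneg (v x), sq_nonneg (deriv v x)])
      rw [e]; linarith).trans
      (mul_le_mul_of_nonneg_left hS (by positivity))
  have h5 : |∫ x, deriv (deriv φ) (x / l) * (v x) ^ 2 * deriv v x| ≤ r * (A + A') :=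
    (abs_integral_le_wt hg fun x => by
      rw [mul_assoc]
      refine abs_wt_coef_le (hφ2 _) ?_
      have h1 := hv.abs_le_one x
      have e : (v x) ^ 2 * deriv v x = v x * (v x * deriv v x) := by ring
      have h2 : |v x * deriv v x| ≤ (v x) ^ 2 + (deriv v x) ^ 2 := by
        rw [abs_le]
        constructor <;> nlinarith [sq_nonneg (v x - deriv v x), sq_nonneg (v x + deriv v x)]
      rw [e, abs_mul]
      nlinarith [abs_nonneg (v x * deriv v x)]).trans
      (mul_le_mul_of_nonneg_left hS hC)
  have h6 : |∫ x, deriv φ (x / l) * (v x) ^ 4| ≤ r * (A + A') :=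
    (abs_integral_le_wt hg fun x => abs_wt_coef_le (hφ1 _)
      ((hv.four_le x).trans (by nlinarith [sq_nonneg (deriv v x)]))).trans
      (mul_le_mul_of_nonneg_left hS hC)
  have hK0 : 0 ≤ K := (abs_nonneg _).trans hK
  have c1 : |-(l' / (2 * l))| ≤ K * (1 / l) := by
    rw [abs_neg, abs_div, abs_of_pos (by positivity : 0 < 2 * l), mul_one_div]
    gcongr
    linarith
  have c2 : |1 / (2 * l ^ 3)| ≤ 1 / c ^ 2 * (1 / l) := by
    rw [abs_of_pos (by positivity)]
    refine le_trans ?_ (one_div_cube_le hc hl)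
    apply one_div_le_one_div_of_le (by positivity)
    nlinarith [pow_pos hl0 3]
  have c3 : |1 / (3 * l ^ 3)| ≤ 1 / c ^ 2 * (1 / l) := by
    rw [abs_of_pos (by positivity)]
    refine le_trans ?_ (one_div_cube_le hc hl)
    apply one_div_le_one_div_of_le (by positivity)
    nlinarith [pow_pos hl0 3]
  have c4 : |2 / l| ≤ 2 * (1 / l) := by rw [abs_of_pos (by positivity), mul_one_div]
  have c5 : |2 / l ^ 2| ≤ 2 * (1 / c) * (1 / l) := by
    rw [abs_of_pos (by positivity)]
    have := one_div_sq_le hc hl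
    have e : 2 / l ^ 2 = 2 * (1 / l ^ 2) := by ring
    rw [e]; linarith
  have c6 : |1 / (2 * l)| ≤ 1 / l := by
    rw [abs_of_pos (by positivity)]
    apply one_div_le_one_div_of_le (by positivity)
    linarith
  have k1 := abs_le.1 (abs_coef_mul_le c1 h1)
  have k2 := abs_le.1 (abs_coef_mul_le c2 h2)
  have k3 := abs_le.1 (abs_coef_mul_le c3 h3)
  have k4 := abs_le.1 (abs_coef_mul_le c4 h4)
  have k5 := abs_le.1 (abs_coef_mul_le c5 h5)
  have k6 := abs_le.1 (abs_coef_mul_le c6 h6)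
  have e : 3 / (2 * l) * B = 3 / 2 * (1 / l * B) := by field_simp
  have e' : (K + 2 * (1 / c ^ 2) + 2 * (1 / c) + 5) * r * (1 / l * (A + A')) =
    K * (1 / l) * (r * (A + A')) + 1 / c ^ 2 * (1 / l) * (r * (A + A')) +
    1 / c ^ 2 * (1 / l) * (r * (A + A')) + 2 * (1 / l) * (2 * r * (A + A')) +
    2 * (1 / c) * (1 / l) * (r * (A + A')) + 1 / l * (r * (A + A')) := by ring
  rw [e, e', abs_le]
  constructor
  · linarith [k1.1, k2.1, k3.1, k4.1, k5.1, k6.2]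
  · linarith [k1.2, k2.2, k3.2, k4.2, k5.2, k6.1]

end estimates

lemma abs_mul_deriv_wtInt_le (n : ℕ) (y : ℝ) :
    |y * deriv (wtInt (n + 1)) y| ≤ wtC (n + 1) * wt n y := by
  rw [deriv_wtInt]
  exact (abs_y_wt_succ_le n y).trans
    (mul_le_mul_of_nonneg_right (one_le_wtC _) (wt_pos n y).le)

lemma abs_deriv_wtInt_le (n : ℕ) (y : ℝ) : |deriv (wtInt n) y| ≤ wtC n * wt n y := by
  rw [deriv_wtInt, abs_of_pos (wt_pos n y)]
  nlinarith [one_le_wtC n, wt_pos n y]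

lemma abs_deriv2_wtInt_le (n : ℕ) (y : ℝ) :
    |deriv (deriv (wtInt n)) y| ≤ wtC n * wt n y := by
  rw [deriv_wtInt]; exact abs_deriv_wt_le n y

lemma abs_deriv3_wtInt_le (n : ℕ) (y : ℝ) :
    |deriv (deriv (deriv (wtInt n))) y| ≤ wtC n * wt n y := by
  rw [deriv_wtInt]; exact abs_deriv2_wt_le n y

/-- Mass estimate: control of `u` at scale `l` gives control of `uₓ`. -/
lemma tame_deriv_sq {M K c : ℝ} {v : ℝ → ℝ → ℝ} {l l' : ℝ → ℝ}
    (hv : ∀ t, 2 < t → Slice M (v t)) (hc : 0 < c) (hl : ∀ t, 2 < t → c ≤ l t)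
    (hK : ∀ t, 2 < t → |l' t| ≤ K)
    (hV : Tame fun t => -virMass (l t) (l' t) (v t) (wtInt 3))
    (h0 : Tame fun t => (1 / l t) * ∫ x, wt 2 (x / l t) * (v t x) ^ 2) :
    Tame fun t => (1 / l t) * ∫ x, wt 3 (x / l t) * (deriv (v t) x) ^ 2 := by
  have hK0 : 0 ≤ K := (abs_nonneg _).trans (hK 3 (by norm_num))
  refine ((hV.add (h0.const_mul (c := (K + 1 / c ^ 2 + 1) * wtC 3) ?_)).const_mul
    (c := 2 / 3) (by norm_num)).mono fun t ht => ?_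
  · have := wtC_pos 3
    positivity
  · have := (abs_le.1 (virMass_approx (φ := wtInt 3) (r := wtC 3) (hv t ht) hc (hl t ht) (hK t ht)
      (abs_mul_deriv_wtInt_le 2) (abs_deriv_wtInt_le 3) (abs_deriv3_wtInt_le 3))).2
    rw [deriv_wtInt] at this
    linarith

/-- Energy estimate: control of `u` and `uₓ` at scale `l` gives control of `uₓₓ`. -/
lemma tame_deriv2_sq {M K c : ℝ} {v : ℝ → ℝ → ℝ} {l l' : ℝ → ℝ}
    (hv : ∀ t, 2 < t → Slice M (v t)) (hc : 0 < c) (hl : ∀ t, 2 < t → c ≤ l t)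
    (hK : ∀ t, 2 < t → |l' t| ≤ K)
    (hV : Tame fun t => -virEnergy (l t) (l' t) (v t) (wtInt 4))
    (h0 : Tame fun t => (1 / l t) * ∫ x, wt 2 (x / l t) * (v t x) ^ 2)
    (h1 : Tame fun t => (1 / l t) * ∫ x, wt 3 (x / l t) * (deriv (v t) x) ^ 2) :
    Tame fun t => (1 / l t) * ∫ x, wt 4 (x / l t) * (deriv (deriv (v t)) x) ^ 2 := by
  have hK0 : 0 ≤ K := (abs_nonneg _).trans (hK 3 (by norm_num))
  refine ((hV.add ((h0.add h1).const_mul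
    (c := (K + 2 * (1 / c ^ 2) + 2 * (1 / c) + 5) * wtC 4) ?_)).const_mul
    (c := 2 / 3) (by norm_num)).mono fun t ht => ?_
  · have := wtC_pos 4
    positivity
  · have := (abs_le.1 (virEnergy_approx (φ := wtInt 4) (r := wtC 4) (hv t ht) hc (hl t ht) (hK t ht)
      (abs_mul_deriv_wtInt_le 3) (abs_deriv_wtInt_le 4) (abs_deriv2_wtInt_le 4)
      (abs_deriv3_wtInt_le 4))).2
    rw [mul_add (1 / l t), deriv_wtInt] at this
    linarith

/-! ### The scaling function -/

lemma lam_neg (t : ℝ) : lam (-t) = lam t := by simp [lam]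

lemma half_le_log {t : ℝ} (ht : 2 < t) : 1 / 2 ≤ Real.log t := by
  have := Real.log_two_gt_d9
  have := Real.log_le_log (by norm_num) ht.le
  linarith

lemma hasDerivAt_lam {t : ℝ} (ht : 2 < t) :
    HasDerivAt lam (1 / (Real.sqrt t * Real.log t) * (1 / 2 - 1 / Real.log t)) t := by
  have h0 : 0 < t := by linarith
  have hl : 0 < Real.log t := by linarith [half_le_log ht]
  have h1 : HasDerivAt (fun t => Real.sqrt t / Real.log t) _ t :=
    (Real.hasDerivAt_sqrt h0.ne').div (Real.hasDerivAt_log h0.ne') hl.ne'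
  have h2 : lam =ᶠ[𝓝 t] fun t => Real.sqrt t / Real.log t := by
    filter_upwards [lt_mem_nhds h0] with s hs
    simp [lam, abs_of_pos hs]
  refine (h1.congr_of_eventuallyEq h2).congr_deriv ?_
  have hs : 0 < Real.sqrt t := Real.sqrt_pos.2 h0
  have e : t⁻¹ = 1 / (Real.sqrt t) ^ 2 := by rw [Real.sq_sqrt h0.le, one_div]
  rw [e]
  field_simp

lemma deriv_lam_sq_le {t : ℝ} (ht : 2 < t) :
    (deriv lam t) ^ 2 ≤ 4 * (1 / (t * (Real.log t) ^ 2)) := by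
  have h0 : 0 < t := by linarith
  have hl : 1 / 2 ≤ Real.log t := half_le_log ht
  rw [(hasDerivAt_lam ht).deriv, mul_pow, div_pow, mul_pow, Real.sq_sqrt h0.le, one_pow, mul_comm]
  refine mul_le_mul_of_nonneg_right ?_ (by positivity)
  have h1 : 1 / Real.log t ≤ 2 := by
    rw [div_le_iff₀ (by linarith)]; linarith
  have h2 : 0 ≤ 1 / Real.log t := by positivity
  nlinarith

lemma abs_deriv_lam_le {t : ℝ} (ht : 2 < t) : |deriv lam t| ≤ 4 := by
  have h := deriv_lam_sq_le ht
  have hl : 1 / 2 ≤ Real.log t := half_le_log ht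
  have h1 : 1 / (t * (Real.log t) ^ 2) ≤ 4 := by
    rw [div_le_iff₀ (by positivity)]
    nlinarith [mul_le_mul hl hl (by norm_num) (by linarith)]
  rw [← sq_le_sq₀ (abs_nonneg _) (by norm_num), sq_abs]
  linarith

lemma deriv_lam_neg (t : ℝ) : deriv lam (-t) = -deriv lam t := by
  have h : (fun x => lam (-x)) = lam := funext lam_neg
  have := deriv_comp_neg (f := lam) t
  rw [h] at this
  linarith

lemma log_le_sqrt {t : ℝ} (ht : 2 < t) : Real.log t ≤ 2 * Real.sqrt t := by
  have h0 : 0 < t := by linarith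
  have hs : 0 < Real.sqrt t := Real.sqrt_pos.2 h0
  have h1 : Real.log t = 2 * Real.log (Real.sqrt t) := by
    rw [Real.log_sqrt h0.le]; ring
  have := Real.log_le_sub_one_of_pos hs
  linarith

lemma half_le_lam {t : ℝ} (ht : 2 < t) : 1 / 2 ≤ lam t := by
  have hl : 1 / 2 ≤ Real.log t := half_le_log ht
  unfold lam
  rw [abs_of_pos (by linarith), le_div_iff₀ (by linarith)]
  linarith [log_le_sqrt ht]

lemma lam_le {t : ℝ} (ht : 2 < t) : lam t ≤ 2 * t := by
  have hl : 1 / 2 ≤ Real.log t := half_le_log ht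
  unfold lam
  rw [abs_of_pos (by linarith), div_le_iff₀ (by linarith)]
  have : Real.sqrt t ≤ t := by
    rw [Real.sqrt_le_left (by linarith)]; nlinarith
  nlinarith

lemma tame_deriv_lam_sq : Tame fun t => (deriv lam t) ^ 2 := by
  have : Tame fun t => 1 / (t * (Real.log t) ^ 2) := by
    refine Tame.of_hasDerivAt (F := fun t => -(Real.log t)⁻¹) (K := 2) (fun t ht => ?_)
      fun t ht => ?_
    · have hl : 1 / 2 ≤ Real.log t := half_le_log ht
      refine (((Real.hasDerivAt_log (by linarith : t ≠ 0)).inv (by linarith)).neg).congr_deriv ?_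
      field_simp
    · have hl : 1 / 2 ≤ Real.log t := half_le_log ht
      rw [abs_neg, abs_of_nonneg (by positivity)]
      exact inv_le_of_inv_le₀ (by norm_num) (by linarith)
  exact (this.const_mul (c := 4) (by norm_num)).mono fun t ht => deriv_lam_sq_le ht

lemma tame_inv_lam_cube : Tame fun t => 1 / (lam t) ^ 3 := by
  have h : Tame fun t : ℝ => t ^ (-(5/4) : ℝ) := by
    refine (Tame.of_hasDerivAt (F := fun t : ℝ => -4 * t ^ (-(1/4) : ℝ))
      (F' := fun t => -4 * (-(1/4) * t ^ (-(1/4) - 1 : ℝ))) (K := 4) (fun t ht => ?_)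
      fun t ht => ?_).mono fun t ht => ?_
    · exact (Real.hasDerivAt_rpow_const (Or.inl (by linarith))).const_mul _
    · have h1 : t ^ (-(1/4) : ℝ) ≤ 1 :=
        Real.rpow_le_one_of_one_le_of_nonpos (by linarith) (by norm_num)
      have h2 : 0 ≤ t ^ (-(1/4) : ℝ) := Real.rpow_nonneg (by linarith) _
      rw [abs_mul, abs_of_nonneg h2]
      norm_num; linarith
    · norm_num; linarith
  refine (h.const_mul (c := 12 ^ 3) (by norm_num)).mono fun t ht => ?_
  have h0 : 0 < t := by linarith
  have hl : 1 / 2 ≤ Real.log t := half_le_log ht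
  have h1 : Real.log t ≤ 12 * t ^ (1/12 : ℝ) := by
    have := Real.log_le_rpow_div h0.le (by norm_num : (0:ℝ) < 1/12)
    linarith
  have h2 : (Real.log t) ^ 3 ≤ (12 * t ^ (1/12 : ℝ)) ^ 3 := by gcongr
  have h3 : (t ^ (1/12 : ℝ)) ^ 3 = t ^ (1/4 : ℝ) := by
    rw [← Real.rpow_natCast, ← Real.rpow_mul h0.le]; norm_num
  have h4 : (Real.sqrt t) ^ 3 = t ^ (3/2 : ℝ) := by
    rw [Real.sqrt_eq_rpow, ← Real.rpow_natCast, ← Real.rpow_mul h0.le]; norm_num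
  unfold lam
  rw [abs_of_pos h0, div_pow, one_div_div, h4, div_le_iff₀ (by positivity), mul_assoc,
    ← Real.rpow_add h0]
  norm_num
  rw [mul_pow, h3] at h2
  norm_num at h2
  exact h2

/-! ### Convergence of functions with tame derivative -/

lemma exists_tendsto_of_monotone_bdd {F F' : ℝ → ℝ} {K : ℝ}
    (h1 : ∀ t, 2 < t → HasDerivAt F (F' t) t) (h2 : ∀ t, 2 < t → |F t| ≤ K)
    (h3 : ∀ t, 2 < t → 0 ≤ F' t) : ∃ L, Tendsto F atTop (𝓝 L) := by
  have hm : MonotoneOn F (Set.Ici 3) := by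
    refine monotoneOn_of_deriv_nonneg (convex_Ici 3)
      (fun t ht => (h1 t (by linarith [Set.mem_Ici.1 ht])).continuousAt.continuousWithinAt)
      (fun t ht => ?_) fun t ht => ?_
    · rw [interior_Ici] at ht
      exact (h1 t (by linarith [Set.mem_Ioi.1 ht])).differentiableAt.differentiableWithinAt
    · rw [interior_Ici] at ht
      have : 2 < t := by linarith [Set.mem_Ioi.1 ht]
      rw [(h1 t this).deriv]; exact h3 t this
  have hm' : Monotone fun t => F (max t 3) := fun a b hab =>
    hm (Set.mem_Ici.2 (le_max_right _ _)) (Set.mem_Ici.2 (le_max_right _ _))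
      (max_le_max_right 3 hab)
  have hb : BddAbove (Set.range fun t => F (max t 3)) := ⟨K, by
    rintro _ ⟨t, rfl⟩
    exact (abs_le.1 (h2 _ (by linarith [le_max_right t 3]))).2⟩
  refine ⟨_, (tendsto_atTop_ciSup hm' hb).congr' ?_⟩
  filter_upwards [eventually_ge_atTop 3] with t ht
  rw [max_eq_left ht]

lemma tendsto_zero_of_tame {G D b : ℝ → ℝ} {c : ℝ} (hG : ∀ t, 2 < t → HasDerivAt G (D t) t)
    {K : ℝ} (hK : ∀ t, 2 < t → |G t| ≤ K) (hD : ∀ t, 2 < t → |D t| ≤ b t) (hb : Tame b)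
    (h0 : ∀ t, 2 < t → 0 ≤ G t) (hc : 0 < c) (hT : Tame fun t => c / t * G t) :
    Tendsto G atTop (𝓝 0) := by
  obtain ⟨F, F', K', f1, f2, f3⟩ := hb
  obtain ⟨L1, hL1⟩ := exists_tendsto_of_monotone_bdd (F := fun t => F t + G t) (K := K' + K)
    (fun t ht => (f1 t ht).add (hG t ht))
    (fun t ht => (abs_add_le _ _).trans (add_le_add (f2 t ht) (hK t ht)))
    (fun t ht => by linarith [(abs_le.1 (hD t ht)).1, f3 t ht])
  obtain ⟨L2, hL2⟩ := exists_tendsto_of_monotone_bdd (F := fun t => F t - G t) (K := K' + K)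
    (fun t ht => (f1 t ht).sub (hG t ht))
    (fun t ht => (abs_sub _ _).trans (add_le_add (f2 t ht) (hK t ht)))
    (fun t ht => by linarith [(abs_le.1 (hD t ht)).2, f3 t ht])
  have hL : Tendsto G atTop (𝓝 ((L1 - L2) / 2)) := by
    refine ((hL1.sub hL2).div_const 2).congr fun t => ?_
    ring
  set g := (L1 - L2) / 2
  have hg : 0 ≤ g := ge_of_tendsto hL (by
    filter_upwards [eventually_gt_atTop 2] with t ht using h0 t ht)
  rcases hg.eq_or_lt with h | hpos
  · rwa [← h] at hL
  exfalso
  obtain ⟨H, H', B, k1, k2, k3⟩ := hT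
  obtain ⟨N, hN⟩ := eventually_atTop.1 (hL.eventually (lt_mem_nhds (half_lt_self hpos)))
  set N' := max N 3
  have hm : MonotoneOn (fun t => H t - c * (g / 2) * Real.log t) (Set.Ici N') := by
    have hd : ∀ t, N' ≤ t → HasDerivAt (fun t => H t - c * (g / 2) * Real.log t)
        (H' t - c * (g / 2) * t⁻¹) t := fun t ht => by
      have : 3 ≤ t := (le_max_right _ _).trans ht
      exact (k1 t (by linarith)).sub ((Real.hasDerivAt_log (by linarith)).const_mul _)
    refine monotoneOn_of_deriv_nonneg (convex_Ici N')
      (fun t ht => (hd t ht).continuousAt.continuousWithinAt)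
      (fun t ht => ?_) fun t ht => ?_
    · rw [interior_Ici] at ht
      exact (hd t (Set.mem_Ioi.1 ht).le).differentiableAt.differentiableWithinAt
    · rw [interior_Ici] at ht
      have h3 : 3 ≤ t := (le_max_right _ _).trans (Set.mem_Ioi.1 ht).le
      have h4 := hN t ((le_max_left _ _).trans (Set.mem_Ioi.1 ht).le)
      rw [(hd t (Set.mem_Ioi.1 ht).le).deriv]
      have h5 := k3 t (by linarith)
      have h6 : c / t * (g / 2) ≤ c / t * G t :=
        mul_le_mul_of_nonneg_left h4.le (by positivity)
      have e : c * (g / 2) * t⁻¹ = c / t * (g / 2) := by ring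
      linarith
  have hlog : Tendsto (fun t => c * (g / 2) * Real.log t) atTop atTop :=
    Real.tendsto_log_atTop.const_mul_atTop (by positivity)
  obtain ⟨t, ht1, ht2⟩ := ((hlog.eventually_gt_atTop
    (B - (H N' - c * (g / 2) * Real.log N'))).and (eventually_ge_atTop N')).exists
  have h1 := hm (Set.mem_Ici.2 le_rfl) (Set.mem_Ici.2 ht2) ht2
  have h2 := (abs_le.1 (k2 t (by linarith [le_max_right N 3]))).2
  simp only at h1
  linarith

/-! ### Decay in the parabolic region -/

/-- A family of slices satisfying the virial identities at scale `l`, for the test functions in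
the class `P`, up to the time direction `σ`. -/
structure VirialFlow (M σ : ℝ) (v : ℝ → ℝ → ℝ) (l l' : ℝ → ℝ) (P : (ℝ → ℝ) → Prop) : Prop where
  slice : ∀ t, 2 < t → Slice M (v t)
  lin : ∀ ψ, P ψ → ∀ t, 2 < t → HasDerivAt (fun s => ∫ x, ψ (x / l s) * v s x)
    (σ * virLin (l t) (l' t) (v t) ψ) t
  mass : ∀ φ, P φ → ∀ t, 2 < t → HasDerivAt (fun s => (1 / 2) * ∫ x, φ (x / l s) * (v s x) ^ 2)
    (σ * virMass (l t) (l' t) (v t) φ) t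
  energy : ∀ φ, P φ → ∀ t, 2 < t → HasDerivAt (fun s => (1 / 2) * ∫ x, φ (x / l s) *
    ((deriv (v s) x) ^ 2 - (2 / 3) * (v s x) ^ 3)) (σ * virEnergy (l t) (l' t) (v t) φ) t

section
variable {M : ℝ} {v : ℝ → ℝ}

lemma Slice.integral_sq_le (h : Slice M v) : (∫ x, (v x) ^ 2) ≤ 1 :=
  (integral_mono h.int_sq (h.int_sq.add h.int_deriv_sq) fun x => by
    simp only [Pi.add_apply]; nlinarith [sq_nonneg (deriv v x)]).trans h.h1_le

lemma Slice.abs_integral_mul_le (h : Slice M v) {ψ : ℝ → ℝ} {B : ℝ} (hψ : ∀ x, |ψ x| ≤ B) :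
    |∫ x, ψ x * v x| ≤ B * M := by
  have hB : 0 ≤ B := (abs_nonneg _).trans (hψ 0)
  refine (abs_integral_le_integral (h.int.abs.const_mul B) fun x => ?_).trans ?_
  · exact abs_coef_mul_le (hψ x) le_rfl
  · rw [integral_const_mul]; exact mul_le_mul_of_nonneg_left h.l1_le hB

lemma Slice.abs_integral_mul_sq_le (h : Slice M v) {ψ : ℝ → ℝ} {B : ℝ} (hψ : ∀ x, |ψ x| ≤ B) :
    |(1 / 2) * ∫ x, ψ x * (v x) ^ 2| ≤ B := by
  have hB : 0 ≤ B := (abs_nonneg _).trans (hψ 0)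
  have : |∫ x, ψ x * (v x) ^ 2| ≤ B := by
    refine (abs_integral_le_integral (h.int_sq.const_mul B) fun x => ?_).trans ?_
    · exact abs_coef_mul_le (hψ x) (abs_of_nonneg (sq_nonneg _)).le
    · rw [integral_const_mul]; exact mul_le_of_le_one_right hB h.integral_sq_le
  rw [abs_mul, abs_of_pos (by norm_num)]
  linarith

lemma Slice.abs_energy_density_le (h : Slice M v) (x : ℝ) :
    |(deriv v x) ^ 2 - (2 / 3) * (v x) ^ 3| ≤ (v x) ^ 2 + (deriv v x) ^ 2 := by
  have := abs_le.1 (h.cube_le x)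
  rw [abs_le]
  constructor <;> nlinarith [sq_nonneg (v x), sq_nonneg (deriv v x)]

lemma Slice.abs_integral_mul_energy_le (h : Slice M v) {ψ : ℝ → ℝ} {B : ℝ}
    (hψ : ∀ x, |ψ x| ≤ B) :
    |(1 / 2) * ∫ x, ψ x * ((deriv v x) ^ 2 - (2 / 3) * (v x) ^ 3)| ≤ B := by
  have hB : 0 ≤ B := (abs_nonneg _).trans (hψ 0)
  have : |∫ x, ψ x * ((deriv v x) ^ 2 - (2 / 3) * (v x) ^ 3)| ≤ B := by
    refine (abs_integral_le_integral ((h.int_sq.add h.int_deriv_sq).const_mul B)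
      fun x => ?_).trans ?_
    · exact abs_coef_mul_le (hψ x) (h.abs_energy_density_le x)
    · rw [integral_const_mul]; exact mul_le_of_le_one_right hB h.h1_le
  rw [abs_mul, abs_of_pos (by norm_num)]
  linarith

end

section flow
variable {M σ c K : ℝ} {v : ℝ → ℝ → ℝ} {l l' : ℝ → ℝ} {P : (ℝ → ℝ) → Prop}

lemma VirialFlow.tame_virLin (h : VirialFlow M σ v l l' P) (hσ : σ ^ 2 = 1) {ψ : ℝ → ℝ} (hψ : P ψ) {B : ℝ}
    (hB : ∀ x, |ψ x| ≤ B) : Tame fun t => virLin (l t) (l' t) (v t) ψ := by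
  refine Tame.of_hasDerivAt (F := fun s => σ * ∫ x, ψ (x / l s) * v s x) (K := B * M)
    (fun t ht => ?_) fun t ht => ?_
  · refine ((h.lin ψ hψ t ht).const_mul σ).congr_deriv ?_
    rw [← mul_assoc, ← sq, hσ, one_mul]
  · rw [abs_mul, show |σ| = 1 by rw [← sq_eq_sq₀ (abs_nonneg _) (by norm_num), sq_abs, hσ]; norm_num,
      one_mul]
    exact (h.slice t ht).abs_integral_mul_le fun x => hB _

lemma VirialFlow.tame_neg_virMass (h : VirialFlow M σ v l l' P) (hσ : σ ^ 2 = 1) {ψ : ℝ → ℝ} (hψ : P ψ)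
    {B : ℝ} (hB : ∀ x, |ψ x| ≤ B) : Tame fun t => -virMass (l t) (l' t) (v t) ψ := by
  refine Tame.of_hasDerivAt (F := fun s => -(σ * ((1 / 2) * ∫ x, ψ (x / l s) * (v s x) ^ 2)))
    (K := B) (fun t ht => ?_) fun t ht => ?_
  · refine ((h.mass ψ hψ t ht).const_mul σ).neg.congr_deriv ?_
    rw [← mul_assoc, ← sq, hσ, one_mul]
  · rw [abs_neg, abs_mul,
      show |σ| = 1 by rw [← sq_eq_sq₀ (abs_nonneg _) (by norm_num), sq_abs, hσ]; norm_num, one_mul]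
    exact (h.slice t ht).abs_integral_mul_sq_le fun x => hB _

lemma VirialFlow.tame_neg_virEnergy (h : VirialFlow M σ v l l' P) (hσ : σ ^ 2 = 1) {ψ : ℝ → ℝ} (hψ : P ψ)
    {B : ℝ} (hB : ∀ x, |ψ x| ≤ B) : Tame fun t => -virEnergy (l t) (l' t) (v t) ψ := by
  refine Tame.of_hasDerivAt (F := fun s => -(σ * ((1 / 2) * ∫ x, ψ (x / l s) *
    ((deriv (v s) x) ^ 2 - (2 / 3) * (v s x) ^ 3))))
    (K := B) (fun t ht => ?_) fun t ht => ?_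
  · refine ((h.energy ψ hψ t ht).const_mul σ).neg.congr_deriv ?_
    rw [← mul_assoc, ← sq, hσ, one_mul]
  · rw [abs_neg, abs_mul,
      show |σ| = 1 by rw [← sq_eq_sq₀ (abs_nonneg _) (by norm_num), sq_abs, hσ]; norm_num, one_mul]
    exact (h.slice t ht).abs_integral_mul_energy_le fun x => hB _

lemma VirialFlow.tame_deriv_sq (h : VirialFlow M σ v l l' P) (hσ : σ ^ 2 = 1) (hP : P (wtInt 3))
    (hc : 0 < c) (hl : ∀ t, 2 < t → c ≤ l t) (hK : ∀ t, 2 < t → |l' t| ≤ K)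
    (h0 : Tame fun t => (1 / l t) * ∫ x, wt 2 (x / l t) * (v t x) ^ 2) :
    Tame fun t => (1 / l t) * ∫ x, wt 3 (x / l t) * (deriv (v t) x) ^ 2 :=
  _root_.tame_deriv_sq h.slice hc hl hK
    (h.tame_neg_virMass hσ hP (abs_wtInt_le (by norm_num))) h0

lemma VirialFlow.tame_deriv2_sq (h : VirialFlow M σ v l l' P) (hσ : σ ^ 2 = 1) (hP : P (wtInt 3))
    (hP' : P (wtInt 4)) (hc : 0 < c) (hl : ∀ t, 2 < t → c ≤ l t)
    (hK : ∀ t, 2 < t → |l' t| ≤ K)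
    (h0 : Tame fun t => (1 / l t) * ∫ x, wt 2 (x / l t) * (v t x) ^ 2) :
    Tame fun t => (1 / l t) * ∫ x, wt 4 (x / l t) * (deriv (deriv (v t)) x) ^ 2 :=
  _root_.tame_deriv2_sq h.slice hc hl hK
    (h.tame_neg_virEnergy hσ hP' (abs_wtInt_le (by norm_num))) h0
    (h.tame_deriv_sq hσ hP hc hl hK h0)

/-- If `l⁻¹ w(x/l) v²` is integrable in space-time and `l` grows at most linearly, the `H¹` norm
at scale `l` tends to zero. -/
lemma VirialFlow.tendsto_zero (h : VirialFlow M σ v l l' P) (hσ : σ ^ 2 = 1) (hP : P (wtInt 3))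
    (hP' : P (wtInt 4)) (hP'' : P (wt 4)) (hc : 0 < c) (hl : ∀ t, 2 < t → c ≤ l t)
    (hl2 : ∀ t, 2 < t → l t ≤ 2 * t) (hK : ∀ t, 2 < t → |l' t| ≤ K)
    (h0 : Tame fun t => (1 / l t) * ∫ x, wt 2 (x / l t) * (v t x) ^ 2) (C : ℝ) :
    Tendsto (fun t => ∫ x in Set.Ioo (-(C * l t)) (C * l t),
      ((v t x) ^ 2 + (deriv (v t) x) ^ 2)) atTop (𝓝 0) := by
  have h1 := h.tame_deriv_sq hσ hP hc hl hK h0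
  have h2 := h.tame_deriv2_sq hσ hP hP' hc hl hK h0
  have hσ' : |σ| = 1 := by
    rw [← sq_eq_sq₀ (abs_nonneg _) (by norm_num), sq_abs, hσ]; norm_num
  have hK0 : 0 ≤ K := (abs_nonneg _).trans (hK 3 (by norm_num))
  have hw := wtC_pos 4
  set G : ℝ → ℝ := fun s => (1 / 2) * (∫ x, wt 4 (x / l s) *
    ((deriv (v s) x) ^ 2 - (2 / 3) * (v s x) ^ 3)) +
    2 * ((1 / 2) * ∫ x, wt 4 (x / l s) * (v s x) ^ 2) with hGdef
  have hw1 : ∀ y, |wt 4 y| ≤ 1 := fun y => by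
    rw [abs_of_pos (wt_pos _ _)]; exact wt_le_one _ _
  have hint3 : ∀ t, 2 < t → Integrable fun x => (deriv (v t) x) ^ 2 - (2 / 3) * (v t x) ^ 3 :=
    fun t ht => by
      have := h.slice t ht
      refine Integrable.mono' (this.int_sq.add this.int_deriv_sq) ?_
        (Eventually.of_forall this.abs_energy_density_le)
      have := this.continuous
      have := (h.slice t ht).continuous_deriv
      exact (by fun_prop : Continuous _).aestronglyMeasurable
  have hlow : ∀ t, 2 < t →
      (1 / 2) * ∫ x, wt 4 (x / l t) * ((v t x) ^ 2 + (deriv (v t) x) ^ 2) ≤ G t := fun t ht => by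
    have hs := h.slice t ht
    simp only [hGdef]
    rw [← integral_const_mul, ← integral_const_mul, ← integral_const_mul, ← integral_const_mul,
      ← integral_add]
    · refine integral_mono ?_ ?_ fun x => ?_
      · exact (integrable_wt_mul (hs.int_sq.add hs.int_deriv_sq) 4 (l t)).const_mul _
      · exact ((integrable_wt_mul (hint3 t ht) 4 (l t)).const_mul _).add
          (((integrable_wt_mul hs.int_sq 4 (l t)).const_mul _).const_mul _)
      · have := (abs_le.1 (hs.cube_le x)).2
        have hp := wt_pos 4 (x / l t)
        simp only
        nlinarith [mul_le_mul_of_nonneg_left this hp.le, mul_nonneg hp.le (sq_nonneg (v t x))]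
    · exact (integrable_wt_mul (hint3 t ht) 4 (l t)).const_mul _
    · exact ((integrable_wt_mul hs.int_sq 4 (l t)).const_mul _).const_mul _
  have hG0 : ∀ t, 2 < t → 0 ≤ G t := fun t ht => le_trans
    (mul_nonneg (by norm_num) (integral_wt_nonneg (fun x => by positivity) _ _)) (hlow t ht)
  have hGle : ∀ t, 2 < t → G t ≤ 2 * ((∫ x, wt 2 (x / l t) * (v t x) ^ 2) +
      ∫ x, wt 3 (x / l t) * (deriv (v t) x) ^ 2) := fun t ht => by
    have hs := h.slice t ht
    have e1 : |∫ x, wt 4 (x / l t) * ((deriv (v t) x) ^ 2 - (2 / 3) * (v t x) ^ 3)| ≤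
        1 * ∫ x, wt 4 (x / l t) * ((v t x) ^ 2 + (deriv (v t) x) ^ 2) :=
      abs_integral_le_wt (hs.int_sq.add hs.int_deriv_sq) fun x => by
        rw [one_mul]
        exact abs_coef_mul_le (abs_of_pos (wt_pos _ _)).le (hs.abs_energy_density_le x)
    have e2 : ∫ x, wt 4 (x / l t) * ((v t x) ^ 2 + (deriv (v t) x) ^ 2) =
        (∫ x, wt 4 (x / l t) * (v t x) ^ 2) + ∫ x, wt 4 (x / l t) * (deriv (v t) x) ^ 2 := by
      rw [← integral_add (integrable_wt_mul hs.int_sq 4 _) (integrable_wt_mul hs.int_deriv_sq 4 _)]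
      exact integral_congr_ae (Eventually.of_forall fun x => by simp only; ring)
    have e3 := integral_wt_mono hs.int_sq (fun x => sq_nonneg _) (by norm_num : 2 ≤ 4) (l t)
    have e4 := integral_wt_mono hs.int_deriv_sq (fun x => sq_nonneg _) (by norm_num : 3 ≤ 4) (l t)
    have e5 := (abs_le.1 e1).2
    have e6 : 0 ≤ ∫ x, wt 4 (x / l t) * (v t x) ^ 2 :=
      integral_wt_nonneg (fun x => sq_nonneg _) _ _
    have e7 : 0 ≤ ∫ x, wt 4 (x / l t) * (deriv (v t) x) ^ 2 :=
      integral_wt_nonneg (fun x => sq_nonneg _) _ _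
    simp only [hGdef]
    linarith
  have hD : ∀ t, 2 < t → HasDerivAt G (σ * virEnergy (l t) (l' t) (v t) (wt 4) +
      2 * (σ * virMass (l t) (l' t) (v t) (wt 4))) t := fun t ht =>
    (h.energy _ hP'' t ht).add ((h.mass _ hP'' t ht).const_mul 2)
  have hw2 : ∀ y, wt 4 y ≤ wt 2 y := wt_anti (by norm_num)
  have hw3 : ∀ y, wt 4 y ≤ wt 3 y := wt_anti (by norm_num)
  set k1 := (K + 1 / c ^ 2 + 1) * wtC 4
  set k2 := (K + 2 * (1 / c ^ 2) + 2 * (1 / c) + 5) * wtC 4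
  have hk1 : 0 ≤ k1 := by positivity
  have hk2 : 0 ≤ k2 := by positivity
  have hDle : ∀ t, 2 < t → |σ * virEnergy (l t) (l' t) (v t) (wt 4) +
      2 * (σ * virMass (l t) (l' t) (v t) (wt 4))| ≤
      (2 * k1 + k2 + 3 * wtC 4) * (((1 / l t) * ∫ x, wt 2 (x / l t) * (v t x) ^ 2) +
        ((1 / l t) * ∫ x, wt 3 (x / l t) * (deriv (v t) x) ^ 2) +
        (1 / l t) * ∫ x, wt 4 (x / l t) * (deriv (deriv (v t)) x) ^ 2) := fun t ht => by
    have hs := h.slice t ht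
    have hl0 : 0 < l t := hc.trans_le (hl t ht)
    have b1 := virMass_approx (φ := wt 4) (r := wtC 4) hs hc (hl t ht) (hK t ht)
      (fun y => (abs_mul_deriv_wt_le 4 y).trans (mul_le_mul_of_nonneg_left (hw2 y) hw.le))
      (fun y => (abs_deriv_wt_le 4 y).trans (mul_le_mul_of_nonneg_left (hw3 y) hw.le))
      (fun y => (abs_deriv3_wt_le 4 y).trans (mul_le_mul_of_nonneg_left (hw3 y) hw.le))
    have b2 := virEnergy_approx (φ := wt 4) (r := wtC 4) hs hc (hl t ht) (hK t ht)
      (fun y => (abs_mul_deriv_wt_le 4 y).trans (mul_le_mul_of_nonneg_left (hw3 y) hw.le))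
      (abs_deriv_wt_le 4) (abs_deriv2_wt_le 4) (abs_deriv3_wt_le 4)
    have b3 : |∫ x, deriv (wt 4) (x / l t) * (deriv (v t) x) ^ 2| ≤
        wtC 4 * ∫ x, wt 3 (x / l t) * (deriv (v t) x) ^ 2 :=
      abs_integral_le_wt hs.int_deriv_sq fun x => abs_wt_coef_le
        ((abs_deriv_wt_le 4 _).trans (mul_le_mul_of_nonneg_left (hw3 _) hw.le))
        (abs_of_nonneg (sq_nonneg _)).le
    have b4 : |∫ x, deriv (wt 4) (x / l t) * (deriv (deriv (v t)) x) ^ 2| ≤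
        wtC 4 * ∫ x, wt 4 (x / l t) * (deriv (deriv (v t)) x) ^ 2 :=
      abs_integral_le_wt hs.int_deriv2_sq fun x => abs_wt_coef_le (abs_deriv_wt_le 4 _)
        (abs_of_nonneg (sq_nonneg _)).le
    have hli : 0 ≤ 1 / l t := by positivity
    have n0 : 0 ≤ (1 / l t) * ∫ x, wt 2 (x / l t) * (v t x) ^ 2 :=
      mul_nonneg hli (integral_wt_nonneg (fun x => sq_nonneg _) _ _)
    have n1 : 0 ≤ (1 / l t) * ∫ x, wt 3 (x / l t) * (deriv (v t) x) ^ 2 :=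
      mul_nonneg hli (integral_wt_nonneg (fun x => sq_nonneg _) _ _)
    have n2 : 0 ≤ (1 / l t) * ∫ x, wt 4 (x / l t) * (deriv (deriv (v t)) x) ^ 2 :=
      mul_nonneg hli (integral_wt_nonneg (fun x => sq_nonneg _) _ _)
    have b3' := mul_le_mul_of_nonneg_left b3 hli
    have b4' := mul_le_mul_of_nonneg_left b4 hli
    rw [← abs_of_nonneg hli, ← abs_mul, abs_of_nonneg hli] at b3' b4'
    rw [mul_add (1 / l t)] at b2
    set a0 := (1 / l t) * ∫ x, wt 2 (x / l t) * (v t x) ^ 2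
    set a1 := (1 / l t) * ∫ x, wt 3 (x / l t) * (deriv (v t) x) ^ 2
    set a2 := (1 / l t) * ∫ x, wt 4 (x / l t) * (deriv (deriv (v t)) x) ^ 2
    set d1 := (1 / l t) * ∫ x, deriv (wt 4) (x / l t) * (deriv (v t) x) ^ 2
    set d2 := (1 / l t) * ∫ x, deriv (wt 4) (x / l t) * (deriv (deriv (v t)) x) ^ 2
    have b3'' : |d1| ≤ wtC 4 * a1 := b3'.trans (le_of_eq (by simp only [a1]; ring))
    have b4'' : |d2| ≤ wtC 4 * a2 := b4'.trans (le_of_eq (by simp only [a2]; ring))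
    have e : σ * virEnergy (l t) (l' t) (v t) (wt 4) +
        2 * (σ * virMass (l t) (l' t) (v t) (wt 4)) = σ * (virEnergy (l t) (l' t) (v t) (wt 4) +
        2 * virMass (l t) (l' t) (v t) (wt 4)) := by ring
    rw [e, abs_mul, hσ', one_mul]
    have p1 : 0 ≤ k1 * a0 := by positivity
    have p2 : 0 ≤ k1 * a1 := by positivity
    have p3 : 0 ≤ k1 * a2 := by positivity
    have p4 : 0 ≤ k2 * a2 := by positivity
    have p5 : 0 ≤ wtC 4 * a0 := by positivity
    have p6 : 0 ≤ wtC 4 * a1 := by positivity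
    have p7 : 0 ≤ wtC 4 * a2 := by positivity
    rw [abs_le] at b1 b2 b3'' b4'' ⊢
    constructor <;> linarith [b1.1, b2.1, b3''.1, b4''.1, b1.2, b2.2, b3''.2, b4''.2]
  have hGB : ∀ t, 2 < t → |G t| ≤ 3 := fun t ht => by
    have c1 := (h.slice t ht).abs_integral_mul_energy_le fun x => hw1 (x / l t)
    have c2 := (h.slice t ht).abs_integral_mul_sq_le fun x => hw1 (x / l t)
    simp only [hGdef]
    rw [abs_le] at *
    constructor <;> linarith [c1.1, c1.2, c2.1, c2.2]
  have hG : Tendsto G atTop (𝓝 0) := by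
    refine tendsto_zero_of_tame (c := 1 / 2) hD hGB hDle
      (((h0.add h1).add h2).const_mul (by positivity)) hG0 (by norm_num) ?_
    refine ((h0.add h1).const_mul (c := 2) (by norm_num)).mono fun t ht => ?_
    have hl0 : 0 < l t := hc.trans_le (hl t ht)
    have : 1 / 2 / t ≤ 1 / l t := by
      rw [div_div]; exact one_div_le_one_div_of_le hl0 (hl2 t ht)
    have h3 := mul_le_mul_of_nonneg_right this (hG0 t ht)
    have h4 := mul_le_mul_of_nonneg_left (hGle t ht) (by positivity : 0 ≤ 1 / l t)
    linarith
  have hwC := wt_pos 4 C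
  have hlim : Tendsto (fun t => 2 / wt 4 C * G t) atTop (𝓝 0) := by
    simpa using hG.const_mul (2 / wt 4 C)
  refine squeeze_zero' (Eventually.of_forall fun t => ?_) ?_ hlim
  · exact integral_nonneg fun x => by positivity
  · filter_upwards [eventually_gt_atTop 2] with t ht
    have hs := h.slice t ht
    have hl0 : 0 < l t := hc.trans_le (hl t ht)
    have hi : Integrable fun x => (v t x) ^ 2 + (deriv (v t) x) ^ 2 := hs.int_sq.add hs.int_deriv_sq
    have hi2 : Integrable fun x =>
        1 / wt 4 C * (wt 4 (x / l t) * ((v t x) ^ 2 + (deriv (v t) x) ^ 2)) :=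
      (integrable_wt_mul hi 4 (l t)).const_mul _
    have : ∫ x in Set.Ioo (-(C * l t)) (C * l t), ((v t x) ^ 2 + (deriv (v t) x) ^ 2) ≤
        ∫ x, 1 / wt 4 C * (wt 4 (x / l t) * ((v t x) ^ 2 + (deriv (v t) x) ^ 2)) := by
      refine (setIntegral_mono_on hi.integrableOn hi2.integrableOn measurableSet_Ioo
        fun x hx => ?_).trans (setIntegral_le_integral hi2 (Eventually.of_forall fun x => ?_))
      · rw [← mul_assoc, one_div, ← div_eq_inv_mul]
        refine le_mul_of_one_le_left (by positivity) ((one_le_div hwC).2 ?_)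
        unfold wt
        have : (x / l t) ^ 2 ≤ C ^ 2 := by
          rw [div_pow, div_le_iff₀ (by positivity), ← mul_pow]
          exact sq_le_sq.2 ((abs_lt.2 hx).le.trans (le_abs_self _))
        gcongr
      · have := wt_pos 4 (x / l t)
        simp only [Pi.zero_apply]
        positivity
    rw [integral_const_mul] at this
    refine this.trans ?_
    have h5 := mul_le_mul_of_nonneg_left (hlow t ht) (by positivity : 0 ≤ 2 / wt 4 C)
    refine le_trans (le_of_eq ?_) h5
    ring

lemma VirialFlow.tame_sq_lam (h : VirialFlow M σ v lam l' P) (hσ : σ ^ 2 = 1)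
    (hl' : ∀ t, (l' t) ^ 2 = (deriv lam t) ^ 2) (hP : P (wtInt 2)) :
    Tame fun t => (1 / lam t) * ∫ x, wt 2 (x / lam t) * (v t x) ^ 2 := by
  have hM : 0 ≤ M := (h.slice 3 (by norm_num)).M_nonneg
  have hw := wtC_pos 2
  refine (((h.tame_virLin hσ hP (abs_wtInt_le (by norm_num))).add
    ((tame_deriv_lam_sq.const_mul Real.pi_pos.le).add
    (tame_inv_lam_cube.const_mul (c := wtC 2 * M) (by positivity)))).const_mul
    (c := 2) (by norm_num)).mono fun t ht => ?_
  have hl := half_le_lam ht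
  have := virLin_lower (l' := l' t) (h.slice t ht) (by linarith : 0 < lam t)
  rw [hl'] at this
  have e : (1 / (2 * lam t)) * (∫ x, wt 2 (x / lam t) * (v t x) ^ 2) =
      (1 / 2) * ((1 / lam t) * ∫ x, wt 2 (x / lam t) * (v t x) ^ 2) := by
    rw [one_div, mul_inv]; ring
  rw [e] at this
  have e2 : wtC 2 * M * (1 / lam t ^ 3) = wtC 2 * M / lam t ^ 3 := by ring
  rw [e2]
  linarith

end flow

/-- The standing assumptions on the solution. -/
structure Sol (M : ℝ) (u : ℝ → ℝ → ℝ) : Prop where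
  slice : ∀ t, Slice M (u t)
  lin : ∀ ψ, Adm ψ → ∀ t : ℝ, 2 < |t| → HasDerivAt (fun s => ∫ x, ψ (x / lam s) * u s x)
    (virLin (lam t) (deriv lam t) (u t) ψ) t
  mass : ∀ φ, Adm φ → ∀ t : ℝ, 2 < |t| →
    HasDerivAt (fun s => (1 / 2) * ∫ x, φ (x / lam s) * (u s x) ^ 2)
    (virMass (lam t) (deriv lam t) (u t) φ) t
  energy : ∀ φ, Adm φ → ∀ t : ℝ, 2 < |t| → HasDerivAt (fun s => (1 / 2) * ∫ x, φ (x / lam s) *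
    ((deriv (u s) x) ^ 2 - (2 / 3) * (u s x) ^ 3)) (virEnergy (lam t) (deriv lam t) (u t) φ) t

lemma Sol.flow {M : ℝ} {u : ℝ → ℝ → ℝ} (h : Sol M u) : VirialFlow M 1 u lam (deriv lam) Adm where
  slice t _ := h.slice t
  lin ψ hψ t ht := by
    rw [one_mul]; exact h.lin ψ hψ t (by rwa [abs_of_pos (by linarith)])
  mass ψ hψ t ht := by
    rw [one_mul]; exact h.mass ψ hψ t (by rwa [abs_of_pos (by linarith)])
  energy ψ hψ t ht := by
    rw [one_mul]; exact h.energy ψ hψ t (by rwa [abs_of_pos (by linarith)])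

lemma Sol.flow_neg {M : ℝ} {u : ℝ → ℝ → ℝ} (h : Sol M u) :
    VirialFlow M (-1) (fun t => u (-t)) lam (fun t => deriv lam (-t)) Adm where
  slice t _ := h.slice (-t)
  lin ψ hψ t ht := by
    have := (h.lin ψ hψ (-t) (by rwa [abs_neg, abs_of_pos (by linarith)])).scomp t (hasDerivAt_neg t)
    simpa only [Function.comp_def, lam_neg, smul_eq_mul] using this
  mass ψ hψ t ht := by
    have := (h.mass ψ hψ (-t) (by rwa [abs_neg, abs_of_pos (by linarith)])).scomp t (hasDerivAt_neg t)
    simpa only [Function.comp_def, lam_neg, smul_eq_mul] using this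
  energy ψ hψ t ht := by
    have := (h.energy ψ hψ (-t) (by rwa [abs_neg, abs_of_pos (by linarith)])).scomp t
      (hasDerivAt_neg t)
    simpa only [Function.comp_def, lam_neg, smul_eq_mul] using this

lemma Sol.decay {M : ℝ} {u : ℝ → ℝ → ℝ} (h : Sol M u) (C : ℝ) :
    Tendsto (fun t => ∫ x in Set.Ioo (-(C * lam t)) (C * lam t),
      ((u t x) ^ 2 + (deriv (u t) x) ^ 2)) atTop (𝓝 0) ∧
    Tendsto (fun t => ∫ x in Set.Ioo (-(C * lam t)) (C * lam t),
      ((u t x) ^ 2 + (deriv (u t) x) ^ 2)) atBot (𝓝 0) := by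
  constructor
  · exact h.flow.tendsto_zero (c := 1 / 2) (K := 4) (by norm_num) (adm_wtInt (by norm_num))
      (adm_wtInt (by norm_num)) (adm_wt 4) (by norm_num) (fun t => half_le_lam) (fun t => lam_le)
      (fun t => abs_deriv_lam_le)
      (h.flow.tame_sq_lam (by norm_num) (fun _ => rfl) (adm_wtInt (by norm_num))) C
  · have := h.flow_neg.tendsto_zero (c := 1 / 2) (K := 4) (by norm_num) (adm_wtInt (by norm_num))
      (adm_wtInt (by norm_num)) (adm_wt 4) (by norm_num) (fun t => half_le_lam) (fun t => lam_le)
      (fun t ht => by rw [deriv_lam_neg, abs_neg]; exact abs_deriv_lam_le ht)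
      (h.flow_neg.tame_sq_lam (by norm_num) (fun t => by rw [deriv_lam_neg, neg_sq])
        (adm_wtInt (by norm_num))) C
    refine (this.comp tendsto_neg_atBot_atTop).congr fun t => ?_
    simp only [Function.comp_def, lam_neg, neg_neg]

/-! ### Virial identities at a fixed scale -/

/-- Test functions whose derivatives decay. -/
def Loc (ψ : ℝ → ℝ) : Prop :=
  ContDiff ℝ 4 ψ ∧ ∃ B : ℝ, (∀ x, |ψ x| ≤ B) ∧ (∀ x, |deriv ψ x| ≤ B * wt 1 x) ∧
    (∀ x, |deriv (deriv ψ) x| ≤ B * wt 1 x) ∧ (∀ x, |deriv (deriv (deriv ψ)) x| ≤ B * wt 1 x) ∧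
    ∀ x, |deriv (deriv (deriv (deriv ψ))) x| ≤ B * wt 1 x

lemma loc_wtInt {n : ℕ} (hn : 1 ≤ n) : Loc (wtInt n) := by
  have hw : ∀ x, wtC n * wt n x ≤ (Real.pi + wtC n) * wt 1 x := fun x => by
    have h1 := wt_anti hn x
    have := wt_pos 1 x
    nlinarith [wtC_pos n, Real.pi_pos, mul_pos Real.pi_pos this]
  refine ⟨contDiff_wtInt n 4, Real.pi + wtC n, fun x => ?_, ?_⟩
  · linarith [abs_wtInt_le hn x, wtC_pos n]
  · simp only [deriv_wtInt]
    refine ⟨fun x => ?_, fun x => (abs_deriv_wt_le n x).trans (hw x),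
      fun x => (abs_deriv2_wt_le n x).trans (hw x), fun x => (abs_deriv3_wt_le n x).trans (hw x)⟩
    rw [abs_of_pos (wt_pos n x)]
    refine le_trans ?_ (hw x)
    nlinarith [one_le_wtC n, wt_pos n x]

lemma deriv_comp_const_mul (l : ℝ) (f : ℝ → ℝ) :
    deriv (fun y => f (l * y)) = fun y => l * deriv f (l * y) :=
  funext fun y => by simpa using deriv_comp_mul_left l f y

lemma deriv_const_mul_comp (a l : ℝ) {f : ℝ → ℝ} :
    deriv (fun y => a * f (l * y)) = fun y => a * l * deriv f (l * y) := by
  ext y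
  rw [deriv_const_mul_field, deriv_comp_const_mul, mul_assoc]

lemma abs_mul_wt_one_le (x : ℝ) : |x| * wt 1 x ≤ 1 := by
  have := abs_mul_wt_succ_le 0 x
  simpa [wt] using this

lemma Loc.adm_comp {ψ : ℝ → ℝ} (h : Loc ψ) (l : ℝ) : Adm fun y => ψ (l * y) := by
  obtain ⟨hc, B, h0, h1, h2, h3, h4⟩ := h
  have hB : 0 ≤ B := (abs_nonneg _).trans (h0 0)
  have hw : ∀ x, B * wt 1 x ≤ B := fun x => mul_le_of_le_one_right hB (wt_le_one 1 x)
  refine adm_of_bounds ((hc.of_le (by norm_num)).comp (contDiff_const.mul contDiff_id))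
    (B := B * (1 + |l|) ^ 3) (fun x => ?_) (fun x => ?_) (fun x => ?_) fun x => ?_
  · have h5 : 1 ≤ (1 + |l|) ^ 3 := one_le_pow₀ (by linarith [abs_nonneg l])
    exact (h0 _).trans (le_mul_of_one_le_right hB h5)
  all_goals simp only [deriv_comp_const_mul, deriv_const_mul_comp]
  all_goals rw [abs_mul, mul_comm B]
  all_goals refine mul_le_mul ?_ (le_trans (by apply_assumption) (hw _)) (abs_nonneg _) (by positivity)
  all_goals try simp only [abs_mul]
  all_goals have := abs_nonneg l
  all_goals nlinarith [pow_nonneg this 2, pow_nonneg this 3]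

lemma Loc.adm_mul {ψ : ℝ → ℝ} (h : Loc ψ) {l : ℝ} (hl : 0 < l) :
    Adm fun y => y * deriv ψ (l * y) := by
  obtain ⟨hc, B, h0, h1, h2, h3, h4⟩ := h
  have hB : 0 ≤ B := (abs_nonneg _).trans (h0 0)
  have hw : ∀ x, B * wt 1 x ≤ B := fun x => mul_le_of_le_one_right hB (wt_le_one 1 x)
  have c1 : ContDiff ℝ 3 (deriv ψ) := ContDiff.deriv' (n := 3) hc
  have c2 : ContDiff ℝ 2 (deriv (deriv ψ)) := ContDiff.deriv' (n := 2) c1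
  have c3 : ContDiff ℝ 1 (deriv (deriv (deriv ψ))) := ContDiff.deriv' (n := 1) c2
  have hd : ∀ {f : ℝ → ℝ}, ContDiff ℝ 1 f → ∀ y, HasDerivAt (fun y => f (l * y))
      (l * deriv f (l * y)) y := fun {f} hf y => by
    have := (((hf.differentiable (by norm_num)) (l * y)).hasDerivAt).comp y
      ((hasDerivAt_id y).const_mul l)
    refine this.congr_deriv ?_
    simp [mul_comm]
  have e1 : deriv (fun y => y * deriv ψ (l * y)) = fun y => deriv ψ (l * y) +
      y * (l * deriv (deriv ψ) (l * y)) := funext fun y => by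
    rw [((hasDerivAt_id' y).fun_mul (hd (c1.of_le (by norm_num)) y)).deriv, one_mul]
  have e2 : deriv (fun y => deriv ψ (l * y) + y * (l * deriv (deriv ψ) (l * y))) = fun y =>
      2 * l * deriv (deriv ψ) (l * y) + y * (l * (l * deriv (deriv (deriv ψ)) (l * y))) :=
    funext fun y => by
    rw [((hd (c1.of_le (by norm_num)) y).fun_add ((hasDerivAt_id' y).fun_mul
      ((hd (c2.of_le (by norm_num)) y).const_mul l))).deriv]
    ring
  have e3 : deriv (fun y => 2 * l * deriv (deriv ψ) (l * y) +
      y * (l * (l * deriv (deriv (deriv ψ)) (l * y)))) = fun y =>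
      3 * l ^ 2 * deriv (deriv (deriv ψ)) (l * y) +
        l ^ 2 * ((l * y) * deriv (deriv (deriv (deriv ψ))) (l * y)) :=
    funext fun y => by
    rw [(((hd (c2.of_le (by norm_num)) y).const_mul (2 * l)).fun_add ((hasDerivAt_id' y).fun_mul
      (((hd c3 y).const_mul l).const_mul l))).deriv]
    ring
  have hx : ∀ {f : ℝ → ℝ}, (∀ x, |f x| ≤ B * wt 1 x) → ∀ x, |x * f x| ≤ B := fun {f} hf x => by
    rw [abs_mul]
    calc |x| * |f x| ≤ |x| * (B * wt 1 x) := mul_le_mul_of_nonneg_left (hf x) (abs_nonneg x)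
      _ = B * (|x| * wt 1 x) := by ring
      _ ≤ B := mul_le_of_le_one_right hB (abs_mul_wt_one_le x)
  refine adm_of_bounds (contDiff_id.mul (c1.comp (contDiff_const.mul contDiff_id)))
    (B := B * (1 / l + 2 + 3 * l + 4 * l ^ 2)) (fun y => ?_) (fun y => ?_) (fun y => ?_)
    fun y => ?_
  · have e : y * deriv ψ (l * y) = (1 / l) * ((l * y) * deriv ψ (l * y)) := by field_simp
    rw [e, abs_mul, abs_of_pos (by positivity : 0 < 1 / l)]
    have := hx h1 (l * y)
    have h6 : 0 ≤ B * (2 + 3 * l + 4 * l ^ 2) := by positivity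
    have := mul_le_mul_of_nonneg_left this (by positivity : 0 ≤ 1 / l)
    linarith
  · rw [e1]
    simp only
    have e : y * (l * deriv (deriv ψ) (l * y)) = (l * y) * deriv (deriv ψ) (l * y) := by ring
    rw [e]
    have := (abs_add_le _ _).trans (add_le_add ((h1 (l * y)).trans (hw _)) (hx h2 (l * y)))
    have h6 : 0 ≤ B * (1 / l + 3 * l + 4 * l ^ 2) := by positivity
    linarith
  · rw [e1, e2]
    simp only
    have e : 2 * l * deriv (deriv ψ) (l * y) + y * (l * (l * deriv (deriv (deriv ψ)) (l * y))) =
      l * (2 * deriv (deriv ψ) (l * y) + (l * y) * deriv (deriv (deriv ψ)) (l * y)) := by ring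
    rw [e, abs_mul, abs_of_pos hl]
    have h7 : |2 * deriv (deriv ψ) (l * y)| ≤ 2 * B := by
      rw [abs_mul, abs_two]; linarith [(h2 (l * y)).trans (hw _)]
    have := (abs_add_le _ _).trans (add_le_add h7 (hx h3 (l * y)))
    have h6 : 0 ≤ B * (1 / l + 2 + 4 * l ^ 2) := by positivity
    have := mul_le_mul_of_nonneg_left this hl.le
    linarith
  · rw [e1, e2, e3]
    simp only
    have h7 : |3 * l ^ 2 * deriv (deriv (deriv ψ)) (l * y)| ≤ 3 * l ^ 2 * B := by
      rw [abs_mul, abs_of_nonneg (by positivity)]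
      exact mul_le_mul_of_nonneg_left ((h3 (l * y)).trans (hw _)) (by positivity)
    have h8 : |l ^ 2 * ((l * y) * deriv (deriv (deriv (deriv ψ))) (l * y))| ≤ l ^ 2 * B := by
      rw [abs_mul, abs_of_nonneg (by positivity)]
      exact mul_le_mul_of_nonneg_left (hx h4 (l * y)) (by positivity)
    have := (abs_add_le _ _).trans (add_le_add h7 h8)
    have h6 : 0 ≤ B * (1 / l + 2 + 3 * l) := by positivity
    linarith

lemma Loc.taylor {ψ : ℝ → ℝ} (h : Loc ψ) : ∃ B, 0 ≤ B ∧ ∀ r x : ℝ, 1 / 2 ≤ r →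
    |ψ x - ψ (r * x) - (1 - r) * (x * deriv ψ (r * x))| ≤ B * (1 - r) ^ 2 := by
  obtain ⟨hc, B, h0, h1, h2, h3, h4⟩ := h
  have hB : 0 ≤ B := (abs_nonneg _).trans (h0 0)
  have c1 : ContDiff ℝ 3 (deriv ψ) := ContDiff.deriv' (n := 3) hc
  refine ⟨4 * B, by positivity, fun r x hr => ?_⟩
  have hd : ∀ {f : ℝ → ℝ}, Differentiable ℝ f → ∀ y, HasDerivAt (fun y => f (y * x))
      (x * deriv f (y * x)) y := fun {f} hf y => by
    have := ((hf (y * x)).hasDerivAt).comp y ((hasDerivAt_id y).mul_const x)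
    refine this.congr_deriv ?_
    simp [mul_comm]
  have hmem : ∀ τ ∈ Set.uIcc r 1, 1 / 2 ≤ τ ∧ |τ - r| ≤ |1 - r| := fun τ hτ => by
    refine ⟨le_trans (le_min hr (by norm_num)) hτ.1, Set.abs_sub_left_of_mem_uIcc hτ⟩
  have hk : ∀ τ ∈ Set.uIcc r 1, |x * deriv ψ (τ * x) - x * deriv ψ (r * x)| ≤ 4 * B * |1 - r| :=
    fun τ hτ => by
    have := (convex_uIcc r 1).norm_image_sub_le_of_norm_hasDerivWithin_le
      (f := fun τ => x * deriv ψ (τ * x)) (f' := fun τ => x * (x * deriv (deriv ψ) (τ * x)))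
      (C := 4 * B) (x := r) (y := τ)
      (fun τ _ => ((hd (c1.differentiable (by norm_num)) τ).const_mul x).hasDerivWithinAt)
      (fun τ hτ => ?_) Set.left_mem_uIcc hτ
    · exact this.trans (mul_le_mul_of_nonneg_left (hmem τ hτ).2 (by positivity))
    · rw [Real.norm_eq_abs, ← mul_assoc, abs_mul, abs_of_nonneg (mul_self_nonneg x)]
      refine (mul_le_mul_of_nonneg_left (h2 _) (mul_self_nonneg x)).trans ?_
      have h5 := (hmem τ hτ).1
      have h6 : x * x * wt 1 (τ * x) ≤ 4 := by
        unfold wt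
        rw [pow_one, ← div_eq_mul_inv, div_le_iff₀ (by positivity)]
        nlinarith [mul_le_mul h5 h5 (by norm_num) (by linarith), mul_self_nonneg x]
      nlinarith
  have := (convex_uIcc r 1).norm_image_sub_le_of_norm_hasDerivWithin_le
      (f := fun τ => ψ (τ * x) - τ * (x * deriv ψ (r * x)))
      (f' := fun τ => x * deriv ψ (τ * x) - 1 * (x * deriv ψ (r * x)))
      (C := 4 * B * |1 - r|) (x := r) (y := 1)
      (fun τ _ => ((hd (hc.differentiable (by norm_num)) τ).sub
        ((hasDerivAt_id' τ).mul_const _)).hasDerivWithinAt)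
      (fun τ hτ => by rw [one_mul]; exact hk τ hτ) Set.left_mem_uIcc Set.right_mem_uIcc
  rw [Real.norm_eq_abs, Real.norm_eq_abs, mul_assoc, ← sq, sq_abs] at this
  refine le_trans (le_of_eq ?_) this
  congr 1
  rw [one_mul, one_mul]; ring

/-- Differentiation at a fixed scale from differentiation at a moving scale. -/
lemma hasDerivAt_integral_fixed_scale {W : ℝ → ℝ → ℝ} {l : ℝ → ℝ} {l' t K : ℝ}
    {D : (ℝ → ℝ) → ℝ} (hW : ∀ᶠ s in 𝓝 t, Integrable (W s) ∧ (∫ x, |W s x|) ≤ K)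
    (hl : HasDerivAt l l' t) (hl0 : 0 < l t)
    (hG : ∀ φ, Adm φ → HasDerivAt (fun s => ∫ x, φ (x / l s) * W s x) (D φ) t)
    {ψ : ℝ → ℝ} (hψ : Loc ψ) :
    HasDerivAt (fun s => ∫ x, ψ x * W s x)
      (D (fun y => ψ (l t * y)) + l' * ∫ x, x / l t * deriv ψ x * W t x) t := by
  have hφ := hψ.adm_comp (l t)
  have hχ := hψ.adm_mul hl0
  obtain ⟨B, hB, hT⟩ := hψ.taylor
  set φ : ℝ → ℝ := fun y => ψ (l t * y) with hφd
  set χ : ℝ → ℝ := fun y => y * deriv ψ (l t * y) with hχd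
  set R : ℝ → ℝ := fun s => (∫ x, ψ x * W s x) - (∫ x, φ (x / l s) * W s x) -
    (l s - l t) * ∫ x, χ (x / l s) * W s x with hR
  have hRO : R =O[𝓝 t] fun s => ‖l s - l t‖ ^ 2 := by
    refine Asymptotics.IsBigO.of_bound (B * K * (4 / (l t) ^ 2)) ?_
    filter_upwards [hW, hl.continuousAt.eventually (lt_mem_nhds (half_lt_self hl0)),
      hl.continuousAt.eventually (gt_mem_nhds (by linarith : l t < 2 * l t))] with s hs h1 h2
    obtain ⟨hs1, hs2⟩ := hs
    have hls : 0 < l s := by linarith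
    have hL1 : ∀ {f : ℝ → ℝ}, Adm f → ∀ c : ℝ, Integrable fun x => f (x / c) * W s x :=
      fun {f} hf c => by
      obtain ⟨B', _, hB', _⟩ := hf.bounds
      exact integrable_mul_bdd hs1 (hf.1.continuous.comp (by fun_prop)) fun x => hB' _
    have i0 : Integrable fun x => ψ x * W s x := by
      have := hL1 (hψ.adm_comp 1) 1
      simpa using this
    have i1 : Integrable fun x => ψ x * W s x - φ (x / l s) * W s x := i0.sub (hL1 hφ _)
    have e : R s = ∫ x, (ψ x - ψ (l t / l s * x) -
        (1 - l t / l s) * (x * deriv ψ (l t / l s * x))) * W s x := by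
      simp only [hR]
      rw [← integral_const_mul, ← integral_sub i0 (hL1 hφ _),
        ← integral_sub i1 ((hL1 hχ _).const_mul _)]
      refine integral_congr_ae (Eventually.of_forall fun x => ?_)
      simp only [hφd, hχd]
      have e1 : l t * (x / l s) = l t / l s * x := by ring
      rw [e1]
      field_simp
    have hr : 1 / 2 ≤ l t / l s := by
      rw [div_le_div_iff₀ (by norm_num) hls]; linarith
    have h3 : |R s| ≤ B * (1 - l t / l s) ^ 2 * K := by
      rw [e]
      refine (abs_integral_le_integral (hs1.abs.const_mul (B * (1 - l t / l s) ^ 2))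
        fun x => ?_).trans ?_
      · exact abs_coef_mul_le (hT _ x hr) le_rfl
      · rw [integral_const_mul]; exact mul_le_mul_of_nonneg_left hs2 (by positivity)
    rw [Real.norm_eq_abs]
    refine h3.trans ?_
    have hK : 0 ≤ K := (integral_nonneg fun x => abs_nonneg _).trans hs2
    have h4 : (1 - l t / l s) ^ 2 ≤ 4 / (l t) ^ 2 * (l s - l t) ^ 2 := by
      have : 1 - l t / l s = (l s - l t) / l s := by field_simp
      rw [this, div_pow, div_eq_mul_inv, mul_comm]
      refine mul_le_mul_of_nonneg_right ?_ (sq_nonneg _)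
      rw [inv_eq_one_div, div_le_div_iff₀ (by positivity) (by positivity)]
      nlinarith
    have e5 : ‖‖l s - l t‖ ^ 2‖ = (l s - l t) ^ 2 := by
      rw [norm_pow, norm_norm, Real.norm_eq_abs, sq_abs]
    rw [e5]
    have := mul_le_mul_of_nonneg_left h4 (mul_nonneg hB hK)
    linarith
  have hR0 : HasDerivAt R 0 t := by
    have h1 : (fun s => ‖l s - l t‖ ^ 2) =O[𝓝 t] fun s => ‖s - t‖ ^ 2 :=
      (hl.isBigO_sub.norm_norm).pow 2
    have := ((hRO.trans h1).hasFDerivAt (by norm_num)).hasDerivAt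
    simpa using this
  have hsum := ((hG φ hφ).add (((hl.sub_const (l t)).mul (hG χ hχ)))).add hR0
  have e : (fun s => ∫ x, ψ x * W s x) = fun s => (∫ x, φ (x / l s) * W s x) +
      (l s - l t) * (∫ x, χ (x / l s) * W s x) + R s := by
    ext s; simp only [hR]; ring
  rw [e]
  refine hsum.congr_deriv ?_
  have e2 : (∫ x, χ (x / l t) * W t x) = ∫ x, x / l t * deriv ψ x * W t x := by
    refine integral_congr_ae (Eventually.of_forall fun x => ?_)
    simp only [hχd]
    rw [mul_div_cancel₀ x hl0.ne']
  rw [e2]; ring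

lemma virLin_fixed {l : ℝ} (hl : 0 < l) (l' : ℝ) (v ψ : ℝ → ℝ) :
    virLin l l' v (fun y => ψ (l * y)) + l' * ∫ x, x / l * deriv ψ x * v x =
      virLin 1 0 v ψ := by
  have e : ∀ x, l * (x / l) = x := fun x => mul_div_cancel₀ x hl.ne'
  simp only [virLin, deriv_comp_const_mul, deriv_const_mul_comp, e, div_one, one_pow, neg_zero,
    zero_mul, zero_add, one_mul]
  have e1 : ∫ x, x / l * (l * deriv ψ x) * v x = l * ∫ x, x / l * deriv ψ x * v x := by
    rw [← integral_const_mul]; congr 1; ext x; ring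
  have e2 : ∫ x, l * l * l * deriv (deriv (deriv ψ)) x * v x =
      l ^ 3 * ∫ x, deriv (deriv (deriv ψ)) x * v x := by
    rw [← integral_const_mul]; congr 1; ext x; ring
  have e3 : ∫ x, l * deriv ψ x * v x ^ 2 = l * ∫ x, deriv ψ x * v x ^ 2 := by
    rw [← integral_const_mul]; congr 1; ext x; ring
  rw [e1, e2, e3]
  field_simp
  ring

lemma virMass_fixed {l : ℝ} (hl : 0 < l) (l' : ℝ) (v ψ : ℝ → ℝ) :
    virMass l l' v (fun y => ψ (l * y)) + (1 / 2) * (l' * ∫ x, x / l * deriv ψ x * (v x) ^ 2) =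
      virMass 1 0 v ψ := by
  have e : ∀ x, l * (x / l) = x := fun x => mul_div_cancel₀ x hl.ne'
  simp only [virMass, deriv_comp_const_mul, deriv_const_mul_comp, e, div_one, one_pow, neg_zero,
    zero_mul, one_mul, mul_one, zero_div, zero_sub]
  have e1 : ∫ x, x / l * (l * deriv ψ x) * (v x) ^ 2 = l * ∫ x, x / l * deriv ψ x * (v x) ^ 2 := by
    rw [← integral_const_mul]; congr 1; ext x; ring
  have e2 : ∫ x, l * l * l * deriv (deriv (deriv ψ)) x * (v x) ^ 2 =
      l ^ 3 * ∫ x, deriv (deriv (deriv ψ)) x * (v x) ^ 2 := by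
    rw [← integral_const_mul]; congr 1; ext x; ring
  have e3 : ∫ x, l * deriv ψ x * (deriv v x) ^ 2 = l * ∫ x, deriv ψ x * (deriv v x) ^ 2 := by
    rw [← integral_const_mul]; congr 1; ext x; ring
  have e4 : ∫ x, l * deriv ψ x * (2 / 3) * (v x) ^ 3 = l * ∫ x, deriv ψ x * (2 / 3) * (v x) ^ 3 := by
    rw [← integral_const_mul]; congr 1; ext x; ring
  rw [e1, e2, e3, e4]
  field_simp
  ring

lemma virEnergy_fixed {l : ℝ} (hl : 0 < l) (l' : ℝ) (v ψ : ℝ → ℝ) :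
    virEnergy l l' v (fun y => ψ (l * y)) + (1 / 2) * (l' * ∫ x, x / l * deriv ψ x *
      ((deriv v x) ^ 2 - (2 / 3) * (v x) ^ 3)) = virEnergy 1 0 v ψ := by
  have e : ∀ x, l * (x / l) = x := fun x => mul_div_cancel₀ x hl.ne'
  simp only [virEnergy, deriv_comp_const_mul, deriv_const_mul_comp, e, div_one, one_pow, neg_zero,
    zero_mul, mul_one, zero_div, zero_sub]
  have e1 : ∫ x, x / l * (l * deriv ψ x) * ((deriv v x) ^ 2 - (2 / 3) * (v x) ^ 3) =
      l * ∫ x, x / l * deriv ψ x * ((deriv v x) ^ 2 - (2 / 3) * (v x) ^ 3) := by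
    rw [← integral_const_mul]; congr 1; ext x; ring
  have e2 : ∫ x, l * l * l * deriv (deriv (deriv ψ)) x * (deriv v x) ^ 2 =
      l ^ 3 * ∫ x, deriv (deriv (deriv ψ)) x * (deriv v x) ^ 2 := by
    rw [← integral_const_mul]; congr 1; ext x; ring
  have e3 : ∫ x, l * deriv ψ x * (deriv (deriv v) x) ^ 2 =
      l * ∫ x, deriv ψ x * (deriv (deriv v) x) ^ 2 := by
    rw [← integral_const_mul]; congr 1; ext x; ring
  have e4 : ∫ x, l * l * l * deriv (deriv (deriv ψ)) x * (v x) ^ 3 =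
      l ^ 3 * ∫ x, deriv (deriv (deriv ψ)) x * (v x) ^ 3 := by
    rw [← integral_const_mul]; congr 1; ext x; ring
  have e5 : ∫ x, l * deriv ψ x * deriv (fun y => (v y) ^ 2) x * deriv v x =
      l * ∫ x, deriv ψ x * deriv (fun y => (v y) ^ 2) x * deriv v x := by
    rw [← integral_const_mul]; congr 1; ext x; ring
  have e6 : ∫ x, l * l * deriv (deriv ψ) x * (v x) ^ 2 * deriv v x =
      l ^ 2 * ∫ x, deriv (deriv ψ) x * (v x) ^ 2 * deriv v x := by
    rw [← integral_const_mul]; congr 1; ext x; ring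
  have e7 : ∫ x, l * deriv ψ x * (v x) ^ 4 = l * ∫ x, deriv ψ x * (v x) ^ 4 := by
    rw [← integral_const_mul]; congr 1; ext x; ring
  rw [e1, e2, e3, e4, e5, e6, e7]
  generalize (∫ x, x / l * deriv ψ x * ((deriv v x) ^ 2 - (2 / 3) * (v x) ^ 3)) = I
  field_simp
  ring

lemma hasDerivAt_lam' {t : ℝ} (ht : 2 < t) : HasDerivAt lam (deriv lam t) t :=
  (hasDerivAt_lam ht).differentiableAt.hasDerivAt

lemma Sol.flow_fixed {M : ℝ} {u : ℝ → ℝ → ℝ} (h : Sol M u) :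
    VirialFlow M 1 u (fun _ => 1) (fun _ => 0) Loc where
  slice t _ := h.slice t
  lin ψ hψ t ht := by
    have hl : 0 < lam t := by linarith [half_le_lam ht]
    simp only [div_one, one_mul]
    refine (hasDerivAt_integral_fixed_scale (W := u) (l := lam) (K := M)
      (D := fun φ => virLin (lam t) (deriv lam t) (u t) φ)
      (Eventually.of_forall fun s => ⟨(h.slice s).int, (h.slice s).l1_le⟩) (hasDerivAt_lam' ht) hl
      (fun φ hφ => h.lin φ hφ t (by rwa [abs_of_pos (by linarith)])) hψ).congr_deriv
      (virLin_fixed hl _ _ _)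
  mass ψ hψ t ht := by
    have hl : 0 < lam t := by linarith [half_le_lam ht]
    simp only [div_one, one_mul]
    refine ((hasDerivAt_integral_fixed_scale (W := fun s x => (u s x) ^ 2) (l := lam) (K := 1)
      (D := fun φ => 2 * virMass (lam t) (deriv lam t) (u t) φ)
      (Eventually.of_forall fun s => ⟨(h.slice s).int_sq, by
        simpa using (h.slice s).integral_sq_le⟩) (hasDerivAt_lam' ht) hl
      (fun φ hφ => ?_) hψ).const_mul (1 / 2)).congr_deriv ?_
    · have := (h.mass φ hφ t (by rwa [abs_of_pos (by linarith)])).const_mul 2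
      simpa only [← mul_assoc, show (2 : ℝ) * (1 / 2) = 1 by norm_num, one_mul] using this
    · rw [← virMass_fixed hl (deriv lam t)]; ring
  energy ψ hψ t ht := by
    have hl : 0 < lam t := by linarith [half_le_lam ht]
    simp only [div_one, one_mul]
    refine ((hasDerivAt_integral_fixed_scale
      (W := fun s x => (deriv (u s) x) ^ 2 - (2 / 3) * (u s x) ^ 3) (l := lam) (K := 1)
      (D := fun φ => 2 * virEnergy (lam t) (deriv lam t) (u t) φ)
      (Eventually.of_forall fun s => ⟨?_, ?_⟩) (hasDerivAt_lam' ht) hl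
      (fun φ hφ => ?_) hψ).const_mul (1 / 2)).congr_deriv ?_
    · have hs := h.slice s
      refine Integrable.mono' (hs.int_sq.add hs.int_deriv_sq) ?_
        (Eventually.of_forall hs.abs_energy_density_le)
      have := hs.continuous
      have := hs.continuous_deriv
      exact (by fun_prop : Continuous _).aestronglyMeasurable
    · have hs := h.slice s
      refine le_trans ?_ ((abs_integral_le_integral (hs.int_sq.add hs.int_deriv_sq)
        (f := fun x => |(deriv (u s) x) ^ 2 - (2 / 3) * (u s x) ^ 3|)
        fun x => by rw [abs_abs]; exact hs.abs_energy_density_le x).trans hs.h1_le)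
      exact le_abs_self _
    · have := (h.energy φ hφ t (by rwa [abs_of_pos (by linarith)])).const_mul 2
      simpa only [← mul_assoc, show (2 : ℝ) * (1 / 2) = 1 by norm_num, one_mul] using this
    · rw [← virEnergy_fixed hl (deriv lam t)]; ring

lemma tendsto_setIntegral_Ioi_atTop {E : Type*} [NormedAddCommGroup E] [NormedSpace ℝ E] {h : ℝ → E} (hi : Integrable h) :
    Tendsto (fun z => ∫ y in Set.Ioi z, h y) atTop (𝓝 0) := by
  have h1 := intervalIntegral_tendsto_integral_Ioi 0 hi.integrableOn tendsto_id
  have e : (fun z => ∫ y in Set.Ioi z, h y) =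
      fun z => (∫ y in Set.Ioi 0, h y) - ∫ y in (0 : ℝ)..id z, h y := by
    funext z
    rw [← intervalIntegral.integral_interval_add_Ioi (hi.integrableOn (s := Set.Ioi 0))
      (hi.integrableOn (s := Set.Ioi z)), id, add_sub_cancel_left]
  rw [e]
  simpa using h1.const_sub (∫ y in Set.Ioi (0 : ℝ), h y)

section Tail

variable {E : Type*} [NormedAddCommGroup E] [NormedSpace ℝ E] [CompleteSpace E]

lemma hasDerivAt_setIntegral_Ioi {h : ℝ → E} (hc : Continuous h)
    (hi : ∀ a, IntegrableOn h (Set.Ioi a)) (x : ℝ) :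
    HasDerivAt (fun z => ∫ y in Set.Ioi z, h y) (-h x) x := by
  have e : (fun z => ∫ y in Set.Ioi z, h y) = fun z => (∫ y in Set.Ioi x, h y) - ∫ y in x..z, h y := by
    funext z
    rw [← intervalIntegral.integral_interval_add_Ioi (hi x) (hi z), add_sub_cancel_left]
  rw [e]
  have := intervalIntegral.integral_hasDerivAt_right (hc.intervalIntegrable x x)
    hc.stronglyMeasurable.stronglyMeasurableAtFilter hc.continuousAt
  exact this.const_sub _

end Tail

/-- The exponentially weighted tail integral `∫_x^∞ e^{2ik(y-x)} h(y) dy`. -/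
noncomputable def jD (k : ℂ) (h : ℝ → ℂ) (x : ℝ) : ℂ :=
  Complex.exp (-(2 * Complex.I * k * x)) * ∫ y in Set.Ioi x, Complex.exp (2 * Complex.I * k * y) * h y

/-- The Volterra operator of the Jost equation. -/
noncomputable def jT (k : ℂ) (h : ℝ → ℂ) (x : ℝ) : ℂ :=
  ((∫ y in Set.Ioi x, h y) - jD k h x) / (2 * Complex.I * k)

/-- The absolute tail of a potential. -/
noncomputable def jtail (q : ℝ → ℝ) (x : ℝ) : ℝ := ∫ y in Set.Ioi x, |q y|

lemma norm_exp_two_mul_le {k : ℂ} (hk : 0 ≤ k.im) {z : ℝ} (hz : 0 ≤ z) :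
    ‖Complex.exp (2 * Complex.I * k * z)‖ ≤ 1 := by
  rw [Complex.norm_exp, Real.exp_le_one_iff]
  simp
  nlinarith [mul_nonneg hk hz]

lemma integrableOn_exp_mul {k : ℂ} (hk : 0 ≤ k.im) {h : ℝ → ℂ} (hi : Integrable h) (a : ℝ) :
    IntegrableOn (fun y : ℝ => Complex.exp (2 * Complex.I * k * y) * h y) (Set.Ioi a) := by
  refine Integrable.bdd_mul (c := Real.exp (-(2 * k.im * a))) hi.integrableOn
    (by fun_prop : Continuous _).aestronglyMeasurable ?_
  refine (ae_restrict_iff' measurableSet_Ioi).mpr (Eventually.of_forall fun y hy => ?_)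
  rw [Complex.norm_exp]
  refine Real.exp_le_exp.mpr ?_
  have : a < y := hy
  simp
  nlinarith [mul_le_mul_of_nonneg_left this.le hk]

lemma jD_eq (k : ℂ) (h : ℝ → ℂ) (x : ℝ) :
    jD k h x = ∫ y in Set.Ioi x, Complex.exp (2 * Complex.I * k * ((y - x : ℝ) : ℂ)) * h y := by
  rw [jD, ← integral_const_mul]
  congr 1
  ext y
  rw [← mul_assoc, ← Complex.exp_add]
  congr 2
  push_cast
  ring

lemma norm_jD_le {k : ℂ} (hk : 0 ≤ k.im) {h : ℝ → ℂ} (hi : Integrable h) (x : ℝ) :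
    ‖jD k h x‖ ≤ ∫ y in Set.Ioi x, ‖h y‖ := by
  rw [jD_eq]
  refine norm_integral_le_of_norm_le hi.norm.integrableOn ?_
  refine (ae_restrict_iff' measurableSet_Ioi).mpr (Eventually.of_forall fun y hy => ?_)
  rw [norm_mul]
  refine mul_le_of_le_one_left (norm_nonneg _) (norm_exp_two_mul_le hk ?_)
  exact sub_nonneg.mpr (le_of_lt hy)

lemma norm_jT_le {k : ℂ} (hk : 0 ≤ k.im) (h0 : k ≠ 0) {h : ℝ → ℂ} (hi : Integrable h) (x : ℝ) :
    ‖jT k h x‖ ≤ ‖k‖⁻¹ * ∫ y in Set.Ioi x, ‖h y‖ := by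
  have h1 := norm_jD_le hk hi x
  have h2 : ‖∫ y in Set.Ioi x, h y‖ ≤ ∫ y in Set.Ioi x, ‖h y‖ := norm_integral_le_integral_norm _
  have h3 := (norm_sub_le (∫ y in Set.Ioi x, h y) (jD k h x)).trans (add_le_add h2 h1)
  have hp : 0 < ‖k‖ := norm_pos_iff.mpr h0
  rw [jT, norm_div, norm_mul, norm_mul, Complex.norm_I, Complex.norm_two,
    div_le_iff₀ (by positivity)]
  refine h3.trans_eq ?_
  field_simp
  ring

lemma hasDerivAt_cexp_mul (c : ℂ) (x : ℝ) :
    HasDerivAt (fun z : ℝ => Complex.exp (c * z)) (c * Complex.exp (c * x)) x := by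
  have := ((Complex.ofRealCLM.hasDerivAt (x := x)).const_mul c).cexp
  simp only [Complex.ofRealCLM_apply, Complex.ofReal_one, mul_one] at this
  exact this.congr_deriv (mul_comm _ _)

lemma hasDerivAt_jD {k : ℂ} (hk : 0 ≤ k.im) {h : ℝ → ℂ} (hc : Continuous h) (hi : Integrable h)
    (x : ℝ) : HasDerivAt (jD k h) (-(2 * Complex.I * k) * jD k h x - h x) x := by
  have h1 := hasDerivAt_setIntegral_Ioi (h := fun y : ℝ => Complex.exp (2 * Complex.I * k * y) * h y)
    (by fun_prop) (integrableOn_exp_mul hk hi) x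
  have h2 := (hasDerivAt_cexp_mul (-(2 * Complex.I * k)) x).mul h1
  have e : jD k h = fun z : ℝ => Complex.exp (-(2 * Complex.I * k) * z) *
      ∫ y in Set.Ioi z, Complex.exp (2 * Complex.I * k * y) * h y := by
    funext z; simp only [jD, neg_mul]
  rw [e]
  refine h2.congr_deriv ?_
  have e2 : Complex.exp (-(2 * Complex.I * k) * x) * Complex.exp (2 * Complex.I * k * x) = 1 := by
    rw [← Complex.exp_add]; simp
  linear_combination -(h x) * e2

lemma hasDerivAt_jT {k : ℂ} (hk : 0 ≤ k.im) (h0 : k ≠ 0) {h : ℝ → ℂ} (hc : Continuous h)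
    (hi : Integrable h) (x : ℝ) : HasDerivAt (jT k h) (jD k h x) x := by
  have h1 := hasDerivAt_setIntegral_Ioi hc (fun a => hi.integrableOn) x
  have h2 := (h1.sub (hasDerivAt_jD hk hc hi x)).div_const (2 * Complex.I * k)
  refine h2.congr_deriv ?_
  have := Complex.I_ne_zero
  field_simp
  ring

lemma continuous_jT {k : ℂ} (hk : 0 ≤ k.im) (h0 : k ≠ 0) {h : ℝ → ℂ} (hc : Continuous h)
    (hi : Integrable h) : Continuous (jT k h) :=
  continuous_iff_continuousAt.mpr fun x => (hasDerivAt_jT hk h0 hc hi x).continuousAt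

lemma jD_sub {k : ℂ} (hk : 0 ≤ k.im) {h g : ℝ → ℂ} (hi : Integrable h) (gi : Integrable g) (x : ℝ) :
    jD k (fun y => h y - g y) x = jD k h x - jD k g x := by
  simp only [jD, mul_sub]
  rw [integral_sub (integrableOn_exp_mul hk hi x) (integrableOn_exp_mul hk gi x), mul_sub]

lemma jT_sub {k : ℂ} (hk : 0 ≤ k.im) {h g : ℝ → ℂ} (hi : Integrable h) (gi : Integrable g) (x : ℝ) :
    jT k (fun y => h y - g y) x = jT k h x - jT k g x := by
  simp only [jT, jD_sub hk hi gi]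
  rw [integral_sub hi.integrableOn gi.integrableOn]
  ring

lemma tendsto_jD {k : ℂ} (hk : 0 ≤ k.im) {h : ℝ → ℂ} (hi : Integrable h) :
    Tendsto (jD k h) atTop (𝓝 0) :=
  squeeze_zero_norm (norm_jD_le hk hi) (tendsto_setIntegral_Ioi_atTop hi.norm)

lemma tendsto_jT {k : ℂ} (hk : 0 ≤ k.im) (h0 : k ≠ 0) {h : ℝ → ℂ} (hi : Integrable h) :
    Tendsto (jT k h) atTop (𝓝 0) :=
  squeeze_zero_norm (norm_jT_le hk h0 hi)
    (by simpa using (tendsto_setIntegral_Ioi_atTop hi.norm).const_mul ‖k‖⁻¹)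

section Pot

variable {q : ℝ → ℝ}

lemma jtail_nonneg (q : ℝ → ℝ) (x : ℝ) : 0 ≤ jtail q x := integral_nonneg fun _ => abs_nonneg _

lemma jtail_le (hi : Integrable q) (x : ℝ) : jtail q x ≤ ∫ y, |q y| :=
  setIntegral_le_integral hi.abs (Eventually.of_forall fun _ => abs_nonneg _)

lemma hasDerivAt_jtail (hc : Continuous q) (hi : Integrable q) (x : ℝ) :
    HasDerivAt (jtail q) (-|q x|) x :=
  hasDerivAt_setIntegral_Ioi hc.abs (fun _ => hi.abs.integrableOn) x

lemma integrable_abs_mul_exp_jtail (hc : Continuous q) (hi : Integrable q) {c : ℝ} (h0 : 0 ≤ c) :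
    Integrable fun y => |q y| * Real.exp (c * jtail q y) := by
  have hct : Continuous (jtail q) :=
    continuous_iff_continuousAt.mpr fun x => (hasDerivAt_jtail hc hi x).continuousAt
  refine hi.abs.mul_bdd (c := Real.exp (c * ∫ y, |q y|))
    (by fun_prop : Continuous _).aestronglyMeasurable (Eventually.of_forall fun y => ?_)
  rw [Real.norm_eq_abs, Real.abs_exp]
  exact Real.exp_le_exp.mpr (mul_le_mul_of_nonneg_left (jtail_le hi y) h0)

lemma integral_abs_mul_exp_jtail (hc : Continuous q) (hi : Integrable q) {c : ℝ} (h0 : 0 < c)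
    (x : ℝ) : (∫ y in Set.Ioi x, |q y| * Real.exp (c * jtail q y)) ≤ Real.exp (c * jtail q x) / c := by
  have h1 : ∀ y, HasDerivAt (fun z => -(Real.exp (c * jtail q z) / c))
      (|q y| * Real.exp (c * jtail q y)) y := fun y => by
    refine ((((hasDerivAt_jtail hc hi y).const_mul c).exp).div_const c).neg.congr_deriv ?_
    field_simp
  have h2 : Tendsto (fun z => -(Real.exp (c * jtail q z) / c)) atTop
      (𝓝 (-(Real.exp (c * 0) / c))) := by
    have := (tendsto_setIntegral_Ioi_atTop hi.abs).const_mul c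
    exact (((Real.continuous_exp.tendsto _).comp this).div_const c).neg
  rw [integral_Ioi_of_hasDerivAt_of_tendsto' (fun y _ => h1 y)
    (integrable_abs_mul_exp_jtail hc hi h0.le).integrableOn h2]
  have : 0 ≤ Real.exp (c * 0) / c := by positivity
  linarith

lemma integrable_mul_of_bdd (hi : Integrable q) {h : ℝ → ℂ} (hc : Continuous h) {B : ℝ}
    (hB : ∀ x, ‖h x‖ ≤ B) : Integrable fun y => (q y : ℂ) * h y :=
  hi.ofReal.mul_bdd (c := B) hc.aestronglyMeasurable (Eventually.of_forall hB)

/-- A Gronwall inequality from the right. -/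
lemma le_of_le_add_integral_Ioi (hc : Continuous q) (hi : Integrable q) {c A B : ℝ} (h0 : 0 < c)
    {d : ℝ → ℝ} (hd : Continuous d) (hd0 : ∀ x, 0 ≤ d x) (hB : ∀ x, d x ≤ B) (hA : 0 ≤ A)
    (h : ∀ x, d x ≤ A + c * ∫ y in Set.Ioi x, |q y| * d y) (x : ℝ) :
    d x ≤ 2 * A * Real.exp (2 * c * jtail q x) := by
  set w : ℝ → ℝ := fun x => Real.exp (2 * c * jtail q x)
  have hw1 : ∀ x, 1 ≤ w x := fun x => Real.one_le_exp (by have := jtail_nonneg q x; positivity)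
  have key : ∀ S, 0 ≤ S → (∀ x, d x ≤ S * w x) → ∀ x, d x ≤ (A + S / 2) * w x := fun S hS hSw x => by
    have h1 : (∫ y in Set.Ioi x, |q y| * d y) ≤ ∫ y in Set.Ioi x, S * (|q y| * w y) := by
      refine integral_mono ?_ ?_ fun y => ?_
      · exact (hi.abs.mul_bdd (c := B) hd.aestronglyMeasurable (Eventually.of_forall fun y => by
          rw [Real.norm_eq_abs, abs_of_nonneg (hd0 y)]; exact hB y)).integrableOn
      · exact ((integrable_abs_mul_exp_jtail hc hi (by positivity)).const_mul S).integrableOn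
      · have := mul_le_mul_of_nonneg_left (hSw y) (abs_nonneg (q y))
        dsimp only
        linarith
    rw [integral_const_mul] at h1
    have h2 := integral_abs_mul_exp_jtail hc hi (c := 2 * c) (by positivity) x
    have h3 : c * (S * ∫ y in Set.Ioi x, |q y| * w y) ≤ S / 2 * w x := by
      calc c * (S * ∫ y in Set.Ioi x, |q y| * w y) ≤ c * (S * (w x / (2 * c))) := by gcongr
        _ = S / 2 * w x := by field_simp
    have h4 : A ≤ A * w x := le_mul_of_one_le_right hA (hw1 x)
    have h5 := mul_le_mul_of_nonneg_left h1 h0.le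
    linarith [h x]
  have hB0 : 0 ≤ B := (hd0 0).trans (hB 0)
  have it : ∀ n : ℕ, ∀ x, d x ≤ (2 * A + B / 2 ^ n) * w x := fun n => by
    induction n with
    | zero => exact fun x => (hB x).trans (by nlinarith [hw1 x])
    | succ n ih =>
      intro x
      refine (key _ (by positivity) ih x).trans_eq ?_
      rw [pow_succ]; field_simp; ring
  have lim : Tendsto (fun n : ℕ => (2 * A + B / 2 ^ n) * w x) atTop (𝓝 ((2 * A + 0) * w x)) := by
    refine (tendsto_const_nhds.add ?_).mul_const _
    have := (tendsto_pow_atTop_nhds_zero_of_lt_one (r := (1 / 2 : ℝ)) (by norm_num)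
      (by norm_num)).const_mul B
    simpa [div_eq_mul_inv] using this
  simpa using ge_of_tendsto' lim fun n => it n x

end Pot

/-- Terms of the Neumann series of the normalized Jost solution. -/
noncomputable def jM (q : ℝ → ℝ) (k : ℂ) : ℕ → ℝ → ℂ
  | 0 => fun _ => 1
  | n + 1 => jT k fun y => (q y : ℂ) * jM q k n y

/-- The normalized Jost solution `m`, with `m → 1` at `+∞`. -/
noncomputable def jm (q : ℝ → ℝ) (k : ℂ) (x : ℝ) : ℂ := ∑' n, jM q k n x

/-- Common bound for the normalized Jost solution. -/
noncomputable def jB (q : ℝ → ℝ) (k : ℂ) : ℝ := Real.exp (2 * ‖k‖⁻¹ * ∫ y, |q y|)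

section

variable {q : ℝ → ℝ} {k : ℂ}

lemma exp_jtail_le (hi : Integrable q) (k : ℂ) (x : ℝ) :
    Real.exp (2 * ‖k‖⁻¹ * jtail q x) ≤ jB q k :=
  Real.exp_le_exp.mpr (mul_le_mul_of_nonneg_left (jtail_le hi x) (by positivity))

lemma jM_aux (hc : Continuous q) (hi : Integrable q) (hk : 0 ≤ k.im) (h0 : k ≠ 0) (n : ℕ) :
    Continuous (jM q k n) ∧
      ∀ x, ‖jM q k n x‖ ≤ (1 / 2) ^ n * Real.exp (2 * ‖k‖⁻¹ * jtail q x) := by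
  induction n with
  | zero =>
    refine ⟨continuous_const, fun x => ?_⟩
    simp only [jM, norm_one, pow_zero, one_mul]
    exact Real.one_le_exp (by have := jtail_nonneg q x; positivity)
  | succ n ih =>
    obtain ⟨ih1, ih2⟩ := ih
    have hB : ∀ x, ‖jM q k n x‖ ≤ (1 / 2) ^ n * jB q k := fun x =>
      (ih2 x).trans (mul_le_mul_of_nonneg_left (exp_jtail_le hi k x) (by positivity))
    have hI := integrable_mul_of_bdd hi ih1 hB
    refine ⟨continuous_jT hk h0 ((Complex.continuous_ofReal.comp hc).mul ih1) hI, fun x => ?_⟩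
    have hp : 0 < ‖k‖ := norm_pos_iff.mpr h0
    refine (norm_jT_le hk h0 hI x).trans ?_
    have h1 : (∫ y in Set.Ioi x, ‖(q y : ℂ) * jM q k n y‖) ≤
        ∫ y in Set.Ioi x, (1 / 2) ^ n * (|q y| * Real.exp (2 * ‖k‖⁻¹ * jtail q y)) := by
      refine integral_mono hI.norm.integrableOn
        ((integrable_abs_mul_exp_jtail hc hi (by positivity)).const_mul _).integrableOn fun y => ?_
      have := mul_le_mul_of_nonneg_left (ih2 y) (abs_nonneg (q y))
      simp only [norm_mul, Complex.norm_real, Real.norm_eq_abs]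
      linarith
    rw [integral_const_mul] at h1
    have h2 := integral_abs_mul_exp_jtail hc hi (c := 2 * ‖k‖⁻¹) (by positivity) x
    calc ‖k‖⁻¹ * _ ≤ ‖k‖⁻¹ * ((1 / 2) ^ n * (Real.exp (2 * ‖k‖⁻¹ * jtail q x) / (2 * ‖k‖⁻¹))) := by
          refine mul_le_mul_of_nonneg_left (h1.trans ?_) (by positivity)
          exact mul_le_mul_of_nonneg_left h2 (by positivity)
      _ = _ := by rw [pow_succ]; field_simp

lemma continuous_jM (hc : Continuous q) (hi : Integrable q) (hk : 0 ≤ k.im) (h0 : k ≠ 0) (n : ℕ) :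
    Continuous (jM q k n) := (jM_aux hc hi hk h0 n).1

lemma norm_jM_le (hc : Continuous q) (hi : Integrable q) (hk : 0 ≤ k.im) (h0 : k ≠ 0) (n : ℕ)
    (x : ℝ) : ‖jM q k n x‖ ≤ (1 / 2) ^ n * jB q k :=
  ((jM_aux hc hi hk h0 n).2 x).trans
    (mul_le_mul_of_nonneg_left (exp_jtail_le hi k x) (by positivity))

lemma summable_half_mul (B : ℝ) : Summable fun n : ℕ => (1 / 2 : ℝ) ^ n * B :=
  summable_geometric_two.mul_right B

lemma tsum_half_mul (B : ℝ) : ∑' n : ℕ, (1 / 2 : ℝ) ^ n * B = 2 * B := by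
  rw [tsum_mul_right, tsum_geometric_two]

lemma summable_jM (hc : Continuous q) (hi : Integrable q) (hk : 0 ≤ k.im) (h0 : k ≠ 0) (x : ℝ) :
    Summable fun n => jM q k n x :=
  Summable.of_norm_bounded (summable_half_mul _) fun n => norm_jM_le hc hi hk h0 n x

lemma norm_jm_le (hc : Continuous q) (hi : Integrable q) (hk : 0 ≤ k.im) (h0 : k ≠ 0) (x : ℝ) :
    ‖jm q k x‖ ≤ 2 * jB q k := by
  rw [← tsum_half_mul]
  exact tsum_of_norm_bounded (summable_half_mul _).hasSum fun n => norm_jM_le hc hi hk h0 n x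

lemma continuous_jm (hc : Continuous q) (hi : Integrable q) (hk : 0 ≤ k.im) (h0 : k ≠ 0) :
    Continuous (jm q k) :=
  continuous_tsum (fun n => continuous_jM hc hi hk h0 n) (summable_half_mul (jB q k))
    fun n x => norm_jM_le hc hi hk h0 n x

lemma norm_jm_sub_sum_le (hc : Continuous q) (hi : Integrable q) (hk : 0 ≤ k.im) (h0 : k ≠ 0)
    (N : ℕ) (x : ℝ) :
    ‖jm q k x - ∑ n ∈ Finset.range N, jM q k n x‖ ≤ (1 / 2) ^ N * (2 * jB q k) := by
  rw [jm, ← (summable_jM hc hi hk h0 x).sum_add_tsum_nat_add N, add_sub_cancel_left]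
  refine tsum_of_norm_bounded (g := fun n => (1 / 2) ^ N * ((1 / 2) ^ n * jB q k)) ?_ fun n => ?_
  · rw [← tsum_half_mul]
    exact (summable_half_mul _).hasSum.mul_left _
  · refine (norm_jM_le hc hi hk h0 (n + N) x).trans_eq ?_
    rw [pow_add]; ring

lemma integrable_mul_jm (hc : Continuous q) (hi : Integrable q) (hk : 0 ≤ k.im) (h0 : k ≠ 0) :
    Integrable fun y => (q y : ℂ) * jm q k y :=
  integrable_mul_of_bdd hi (continuous_jm hc hi hk h0) (norm_jm_le hc hi hk h0)

lemma integrable_mul_jM (hc : Continuous q) (hi : Integrable q) (hk : 0 ≤ k.im) (h0 : k ≠ 0)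
    (n : ℕ) : Integrable fun y => (q y : ℂ) * jM q k n y :=
  integrable_mul_of_bdd hi (continuous_jM hc hi hk h0 n) (norm_jM_le hc hi hk h0 n)

lemma jT_sum (hc : Continuous q) (hi : Integrable q) (hk : 0 ≤ k.im) (h0 : k ≠ 0) (N : ℕ) (x : ℝ) :
    jT k (fun y => (q y : ℂ) * ∑ n ∈ Finset.range N, jM q k n y) x =
      ∑ n ∈ Finset.range N, jM q k (n + 1) x := by
  induction N with
  | zero => simp [jT, jD]
  | succ N ih =>
    have hs : Integrable fun y => (q y : ℂ) * ∑ n ∈ Finset.range N, jM q k n y := by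
      simp only [Finset.mul_sum]
      exact integrable_finsetSum _ fun n _ => integrable_mul_jM hc hi hk h0 n
    have hs' : Integrable fun y => (q y : ℂ) * ∑ n ∈ Finset.range (N + 1), jM q k n y := by
      simp only [Finset.mul_sum]
      exact integrable_finsetSum _ fun n _ => integrable_mul_jM hc hi hk h0 n
    have := jT_sub hk hs' hs x
    rw [Finset.sum_range_succ, ← ih, ← sub_eq_iff_eq_add', ← this]
    simp only [Finset.sum_range_succ, mul_add, add_sub_cancel_left]
    rfl

lemma jm_eq (hc : Continuous q) (hi : Integrable q) (hk : 0 ≤ k.im) (h0 : k ≠ 0) (x : ℝ) :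
    jm q k x = 1 + jT k (fun y => (q y : ℂ) * jm q k y) x := by
  have hlim : Tendsto (fun N : ℕ => (1 / 2 : ℝ) ^ N * (2 * jB q k)) atTop (𝓝 0) := by
    simpa using (tendsto_pow_atTop_nhds_zero_of_lt_one (r := (1 / 2 : ℝ)) (by norm_num)
      (by norm_num)).mul_const (2 * jB q k)
  have h1 : Tendsto (fun N => ∑ n ∈ Finset.range (N + 1), jM q k n x) atTop (𝓝 (jm q k x)) :=
    (tendsto_add_atTop_iff_nat 1).mpr (summable_jM hc hi hk h0 x).hasSum.tendsto_sum_nat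
  have h2 : Tendsto (fun N => ∑ n ∈ Finset.range (N + 1), jM q k n x) atTop
      (𝓝 (1 + jT k (fun y => (q y : ℂ) * jm q k y) x)) := by
    have e : (fun N => ∑ n ∈ Finset.range (N + 1), jM q k n x) =
        fun N => 1 + jT k (fun y => (q y : ℂ) * ∑ n ∈ Finset.range N, jM q k n y) x := by
      funext N
      rw [jT_sum hc hi hk h0, Finset.sum_range_succ', add_comm]
      rfl
    rw [e]
    refine tendsto_const_nhds.add (tendsto_iff_norm_sub_tendsto_zero.mpr ?_)
    have hs : ∀ N, Integrable fun y => (q y : ℂ) * ∑ n ∈ Finset.range N, jM q k n y := fun N => by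
      simp only [Finset.mul_sum]
      exact integrable_finsetSum _ fun n _ => integrable_mul_jM hc hi hk h0 n
    have hg : Tendsto (fun N : ℕ => (‖k‖⁻¹ * ∫ y, |q y|) * ((1 / 2 : ℝ) ^ N * (2 * jB q k))) atTop
        (𝓝 0) := by simpa only [mul_zero] using hlim.const_mul (‖k‖⁻¹ * ∫ y, |q y|)
    refine squeeze_zero (fun _ => norm_nonneg _) (fun N => ?_) hg
    rw [← jT_sub hk (hs N) (integrable_mul_jm hc hi hk h0)]
    refine (norm_jT_le hk h0 ((hs N).sub (integrable_mul_jm hc hi hk h0)) x).trans ?_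
    rw [mul_assoc]
    refine mul_le_mul_of_nonneg_left ?_ (by positivity)
    refine (setIntegral_le_integral ((hs N).sub (integrable_mul_jm hc hi hk h0)).norm
      (Eventually.of_forall fun _ => norm_nonneg _)).trans ?_
    rw [← integral_mul_const]
    refine integral_mono ((hs N).sub (integrable_mul_jm hc hi hk h0)).norm
      (hi.abs.mul_const _) fun y => ?_
    rw [Pi.sub_apply, ← mul_sub, norm_mul, Complex.norm_real, Real.norm_eq_abs, norm_sub_rev]
    exact mul_le_mul_of_nonneg_left (norm_jm_sub_sum_le hc hi hk h0 N y) (abs_nonneg _)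
  exact tendsto_nhds_unique h1 h2

/-- The derivative of the normalized Jost solution. -/
noncomputable def jm' (q : ℝ → ℝ) (k : ℂ) (x : ℝ) : ℂ := jD k (fun y => (q y : ℂ) * jm q k y) x

lemma hasDerivAt_jm (hc : Continuous q) (hi : Integrable q) (hk : 0 ≤ k.im) (h0 : k ≠ 0) (x : ℝ) :
    HasDerivAt (jm q k) (jm' q k x) x := by
  have e : jm q k = fun x => 1 + jT k (fun y => (q y : ℂ) * jm q k y) x :=
    funext fun x => jm_eq hc hi hk h0 x
  have hcm := continuous_jm hc hi hk h0
  have := (hasDerivAt_jT hk h0 (h := fun y => (q y : ℂ) * jm q k y)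
    (by fun_prop) (integrable_mul_jm hc hi hk h0) x).const_add 1
  rw [← e] at this
  exact this

lemma hasDerivAt_jm' (hc : Continuous q) (hi : Integrable q) (hk : 0 ≤ k.im) (h0 : k ≠ 0) (x : ℝ) :
    HasDerivAt (jm' q k) (-(2 * Complex.I * k) * jm' q k x - q x * jm q k x) x := by
  have hcm := continuous_jm hc hi hk h0
  exact hasDerivAt_jD hk (by fun_prop) (integrable_mul_jm hc hi hk h0) x

lemma tendsto_jm (hc : Continuous q) (hi : Integrable q) (hk : 0 ≤ k.im) (h0 : k ≠ 0) :
    Tendsto (jm q k) atTop (𝓝 1) := by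
  have e : jm q k = fun x => 1 + jT k (fun y => (q y : ℂ) * jm q k y) x :=
    funext fun x => jm_eq hc hi hk h0 x
  rw [e]
  simpa using (tendsto_jT hk h0 (integrable_mul_jm hc hi hk h0)).const_add 1

lemma tendsto_jm' (hc : Continuous q) (hi : Integrable q) (hk : 0 ≤ k.im) (h0 : k ≠ 0) :
    Tendsto (jm' q k) atTop (𝓝 0) :=
  tendsto_jD hk (integrable_mul_jm hc hi hk h0)

lemma norm_jm'_le (hc : Continuous q) (hi : Integrable q) (hk : 0 ≤ k.im) (h0 : k ≠ 0) (x : ℝ) :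
    ‖jm' q k x‖ ≤ (∫ y, |q y|) * (2 * jB q k) := by
  refine (norm_jD_le hk (integrable_mul_jm hc hi hk h0) x).trans ?_
  refine (setIntegral_le_integral (integrable_mul_jm hc hi hk h0).norm
    (Eventually.of_forall fun _ => norm_nonneg _)).trans ?_
  rw [← integral_mul_const]
  refine integral_mono (integrable_mul_jm hc hi hk h0).norm (hi.abs.mul_const _) fun y => ?_
  simp only [norm_mul, Complex.norm_real, Real.norm_eq_abs]
  exact mul_le_mul_of_nonneg_left (norm_jm_le hc hi hk h0 y) (abs_nonneg _)

/-- Lipschitz dependence of the Jost solution on the potential. -/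
lemma norm_jm_sub_le {p : ℝ → ℝ} (hc : Continuous q) (hi : Integrable q) (pc : Continuous p)
    (pi : Integrable p) (hk : 0 ≤ k.im) (h0 : k ≠ 0) (x : ℝ) :
    ‖jm q k x - jm p k x‖ ≤ 4 * ‖k‖⁻¹ * jB q k * jB p k * ∫ y, |q y - p y| := by
  have hcq := continuous_jm hc hi hk h0
  have hcp := continuous_jm pc pi hk h0
  have hp : 0 < ‖k‖ := norm_pos_iff.mpr h0
  have iq := integrable_mul_jm hc hi hk h0
  have ip := integrable_mul_jm pc pi hk h0
  have hd : Integrable fun y => |q y - p y| := (hi.sub pi).abs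
  set A := ‖k‖⁻¹ * ((∫ y, |q y - p y|) * (2 * jB p k)) with hA
  have hA0 : 0 ≤ A := by
    have : 0 ≤ ∫ y, |q y - p y| := integral_nonneg fun _ => abs_nonneg _
    have : 0 < jB p k := Real.exp_pos _
    positivity
  have hbd : ∀ x, ‖jm q k x - jm p k x‖ ≤ 2 * jB q k + 2 * jB p k := fun x =>
    (norm_sub_le _ _).trans (add_le_add (norm_jm_le hc hi hk h0 x) (norm_jm_le pc pi hk h0 x))
  have main := le_of_le_add_integral_Ioi hc hi (c := ‖k‖⁻¹) (A := A) (by positivity)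
    (d := fun x => ‖jm q k x - jm p k x‖) (by fun_prop) (fun _ => norm_nonneg _) hbd hA0 (fun x => by
      have i1 : Integrable fun y => |q y| * ‖jm q k y - jm p k y‖ :=
        hi.abs.mul_bdd (c := 2 * jB q k + 2 * jB p k) (by fun_prop : Continuous _).aestronglyMeasurable
          (Eventually.of_forall fun y => by rw [norm_norm]; exact hbd y)
      have i2 : Integrable fun y => |q y - p y| * (2 * jB p k) := hd.mul_const _
      rw [jm_eq hc hi hk h0 x, jm_eq pc pi hk h0 x, add_sub_add_left_eq_sub, ← jT_sub hk iq ip]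
      refine (norm_jT_le hk h0 (iq.sub ip) x).trans ?_
      have h1 : (∫ y in Set.Ioi x, ‖(q y : ℂ) * jm q k y - (p y : ℂ) * jm p k y‖) ≤
          (∫ y in Set.Ioi x, |q y - p y| * (2 * jB p k)) +
            ∫ y in Set.Ioi x, |q y| * ‖jm q k y - jm p k y‖ := by
        rw [← integral_add i2.integrableOn i1.integrableOn]
        refine integral_mono (iq.sub ip).norm.integrableOn (i2.add i1).integrableOn fun y => ?_
        have e : (q y : ℂ) * jm q k y - (p y : ℂ) * jm p k y =
          ((q y - p y : ℝ) : ℂ) * jm p k y + (q y : ℂ) * (jm q k y - jm p k y) := by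
            push_cast; ring
        rw [e]
        refine (norm_add_le _ _).trans ?_
        simp only [norm_mul, Complex.norm_real, Real.norm_eq_abs]
        gcongr
        exact norm_jm_le pc pi hk h0 y
      have h2 : (∫ y in Set.Ioi x, |q y - p y| * (2 * jB p k)) ≤
          (∫ y, |q y - p y|) * (2 * jB p k) := by
        rw [← integral_mul_const]
        refine setIntegral_le_integral i2 (Eventually.of_forall fun y => ?_)
        have : 0 < jB p k := Real.exp_pos _
        dsimp only [Pi.zero_apply]
        positivity
      calc ‖k‖⁻¹ * _ ≤ ‖k‖⁻¹ * ((∫ y, |q y - p y|) * (2 * jB p k) +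
            ∫ y in Set.Ioi x, |q y| * ‖jm q k y - jm p k y‖) := by
            gcongr
            exact h1.trans (add_le_add_left h2 _)
        _ = _ := by rw [mul_add]) x
  refine main.trans ?_
  calc 2 * A * Real.exp (2 * ‖k‖⁻¹ * jtail q x) ≤ 2 * A * jB q k :=
        mul_le_mul_of_nonneg_left (exp_jtail_le hi k x) (by positivity)
    _ = _ := by rw [hA]; ring

end

/-- The Jost solution at `+∞`. -/
noncomputable def jf (q : ℝ → ℝ) (k : ℂ) (x : ℝ) : ℂ := Complex.exp (Complex.I * k * x) * jm q k x

/-- The space derivative of the Jost solution at `+∞`. -/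
noncomputable def jf' (q : ℝ → ℝ) (k : ℂ) (x : ℝ) : ℂ :=
  Complex.exp (Complex.I * k * x) * (Complex.I * k * jm q k x + jm' q k x)

/-- The conjugate of the Jost solution at `-∞`. -/
noncomputable def jg (q : ℝ → ℝ) (k : ℂ) (x : ℝ) : ℂ :=
  starRingEnd ℂ (jf (fun y => q (-y)) k (-x))

/-- The space derivative of the conjugate Jost solution at `-∞`. -/
noncomputable def jg' (q : ℝ → ℝ) (k : ℂ) (x : ℝ) : ℂ :=
  -starRingEnd ℂ (jf' (fun y => q (-y)) k (-x))

/-- The Wronskian of the Jost solutions. -/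
noncomputable def jw (q : ℝ → ℝ) (k : ℂ) : ℂ := jf q k 0 * jg' q k 0 - jf' q k 0 * jg q k 0

lemma is_const_of_hasDerivAt_zero {F : ℝ → ℂ} (h : ∀ x, HasDerivAt F 0 x) (x y : ℝ) : F x = F y :=
  is_const_of_deriv_eq_zero (fun x => (h x).differentiableAt) (fun x => (h x).deriv) x y

section

variable {q p : ℝ → ℝ} {k : ℂ}

lemma hasDerivAt_jf (hc : Continuous q) (hi : Integrable q) (hk : 0 ≤ k.im) (h0 : k ≠ 0) (x : ℝ) :
    HasDerivAt (jf q k) (jf' q k x) x := by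
  refine ((hasDerivAt_cexp_mul (Complex.I * k) x).mul (hasDerivAt_jm hc hi hk h0 x)).congr_deriv ?_
  rw [jf']; ring

lemma hasDerivAt_jf' (hc : Continuous q) (hi : Integrable q) (hk : 0 ≤ k.im) (h0 : k ≠ 0) (x : ℝ) :
    HasDerivAt (jf' q k) (-(q x + k ^ 2) * jf q k x) x := by
  refine ((hasDerivAt_cexp_mul (Complex.I * k) x).mul
    (((hasDerivAt_jm hc hi hk h0 x).const_mul (Complex.I * k)).add
      (hasDerivAt_jm' hc hi hk h0 x))).congr_deriv ?_
  rw [jf, Pi.add_apply]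
  linear_combination (Complex.exp (Complex.I * k * x) * jm q k x * k ^ 2) * Complex.I_sq

lemma comp_neg_data (hc : Continuous q) (hi : Integrable q) :
    Continuous (fun y => q (-y)) ∧ Integrable fun y => q (-y) :=
  ⟨hc.comp continuous_neg, hi.comp_neg⟩

lemma hasDerivAt_comp_neg {F : ℝ → ℂ} {c : ℂ} {x : ℝ} (h : HasDerivAt F c (-x)) :
    HasDerivAt (fun y => F (-y)) (-c) x := by
  have := h.scomp x (hasDerivAt_neg x)
  rw [neg_one_smul] at this
  exact this

lemma hasDerivAt_conj {F : ℝ → ℂ} {c : ℂ} {x : ℝ} (h : HasDerivAt F c x) :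
    HasDerivAt (fun y => starRingEnd ℂ (F y)) (starRingEnd ℂ c) x :=
  (Complex.conjCLE : ℂ →L[ℝ] ℂ).hasFDerivAt.comp_hasDerivAt x h

lemma hasDerivAt_jg (hc : Continuous q) (hi : Integrable q) (hk : 0 ≤ k.im) (h0 : k ≠ 0) (x : ℝ) :
    HasDerivAt (jg q k) (jg' q k x) x := by
  obtain ⟨nc, ni⟩ := comp_neg_data hc hi
  have := hasDerivAt_conj (hasDerivAt_comp_neg (hasDerivAt_jf nc ni hk h0 (-x)))
  rw [map_neg] at this
  exact this

lemma hasDerivAt_jg' (hc : Continuous q) (hi : Integrable q) {k : ℝ} (h0 : k ≠ 0) (x : ℝ) :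
    HasDerivAt (jg' q k) (-(q x + k ^ 2) * jg q k x) x := by
  obtain ⟨nc, ni⟩ := comp_neg_data hc hi
  have := (hasDerivAt_conj (hasDerivAt_comp_neg (hasDerivAt_jf' nc ni (k := k) (by simp)
    (by exact_mod_cast h0) (-x)))).neg
  refine this.congr_deriv ?_
  simp [jg]

lemma norm_cexp_real (k x : ℝ) : ‖Complex.exp (Complex.I * k * x)‖ = 1 := by
  rw [Complex.norm_exp]; simp

end

section RealFrequency

variable {q p : ℝ → ℝ} {k : ℝ}

/-- Common bound for the derivative of the Jost solutions. -/
noncomputable def jB' (q : ℝ → ℝ) (k : ℂ) : ℝ := (‖k‖ + ∫ y, |q y|) * (2 * jB q k)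

lemma norm_jf_le (hc : Continuous q) (hi : Integrable q) (h0 : k ≠ 0) (x : ℝ) :
    ‖jf q k x‖ ≤ 2 * jB q k := by
  rw [jf, norm_mul, norm_cexp_real, one_mul]
  exact norm_jm_le hc hi (by simp) (by exact_mod_cast h0) x

lemma norm_jf'_le (hc : Continuous q) (hi : Integrable q) (h0 : k ≠ 0) (x : ℝ) :
    ‖jf' q k x‖ ≤ jB' q k := by
  rw [jf', norm_mul, norm_cexp_real, one_mul, jB', add_mul]
  refine (norm_add_le _ _).trans (add_le_add ?_ (norm_jm'_le hc hi (by simp) (by exact_mod_cast h0) x))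
  rw [norm_mul, norm_mul, Complex.norm_I, one_mul]
  exact mul_le_mul_of_nonneg_left (norm_jm_le hc hi (by simp) (by exact_mod_cast h0) x)
    (norm_nonneg _)

lemma integral_abs_comp_neg (q : ℝ → ℝ) : ∫ y, |q (-y)| = ∫ y, |q y| :=
  integral_neg_eq_self (fun y => |q y|) volume

lemma jB_comp_neg (q : ℝ → ℝ) (k : ℂ) : jB (fun y => q (-y)) k = jB q k := by
  rw [jB, jB, integral_abs_comp_neg]

lemma jB'_comp_neg (q : ℝ → ℝ) (k : ℂ) : jB' (fun y => q (-y)) k = jB' q k := by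
  rw [jB', jB', jB_comp_neg, integral_abs_comp_neg]

lemma norm_jg_le (hc : Continuous q) (hi : Integrable q) (h0 : k ≠ 0) (x : ℝ) :
    ‖jg q k x‖ ≤ 2 * jB q k := by
  obtain ⟨nc, ni⟩ := comp_neg_data hc hi
  rw [jg, RCLike.norm_conj, ← jB_comp_neg]
  exact norm_jf_le nc ni h0 _

lemma norm_jg'_le (hc : Continuous q) (hi : Integrable q) (h0 : k ≠ 0) (x : ℝ) :
    ‖jg' q k x‖ ≤ jB' q k := by
  obtain ⟨nc, ni⟩ := comp_neg_data hc hi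
  rw [jg', norm_neg, RCLike.norm_conj, ← jB'_comp_neg]
  exact norm_jf'_le nc ni h0 _

lemma norm_jf_sub_le (hc : Continuous q) (hi : Integrable q) (pc : Continuous p)
    (pi : Integrable p) (h0 : k ≠ 0) (x : ℝ) :
    ‖jf q k x - jf p k x‖ ≤ 4 * ‖(k : ℂ)‖⁻¹ * jB q k * jB p k * ∫ y, |q y - p y| := by
  rw [jf, jf, ← mul_sub, norm_mul, norm_cexp_real, one_mul]
  exact norm_jm_sub_le hc hi pc pi (by simp) (by exact_mod_cast h0) x

lemma norm_jg_sub_le (hc : Continuous q) (hi : Integrable q) (pc : Continuous p)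
    (pi : Integrable p) (h0 : k ≠ 0) (x : ℝ) :
    ‖jg q k x - jg p k x‖ ≤ 4 * ‖(k : ℂ)‖⁻¹ * jB q k * jB p k * ∫ y, |q y - p y| := by
  obtain ⟨nc, ni⟩ := comp_neg_data hc hi
  obtain ⟨nc', ni'⟩ := comp_neg_data pc pi
  rw [jg, jg, ← map_sub, RCLike.norm_conj, ← integral_neg_eq_self (fun y => |q y - p y|) volume,
    ← jB_comp_neg q, ← jB_comp_neg p]
  exact norm_jf_sub_le nc ni nc' ni' h0 _

lemma tendsto_jf'_sub (hc : Continuous q) (hi : Integrable q) (h0 : k ≠ 0) :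
    Tendsto (fun x => jf' q k x - Complex.I * k * jf q k x) atTop (𝓝 0) := by
  have := (tendsto_jm' hc hi (k := k) (by simp) (by exact_mod_cast h0)).norm
  refine squeeze_zero_norm (fun x => le_of_eq ?_) (by simpa using this)
  have e : jf' q k x - Complex.I * k * jf q k x = Complex.exp (Complex.I * k * x) * jm' q k x := by
    rw [jf', jf]; ring
  rw [e, norm_mul, norm_cexp_real, one_mul]

lemma tendsto_jf_sub (hc : Continuous q) (hi : Integrable q) (pc : Continuous p)
    (pi : Integrable p) (h0 : k ≠ 0) : Tendsto (fun x => jf q k x - jf p k x) atTop (𝓝 0) := by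
  have := ((tendsto_jm hc hi (k := k) (by simp) (by exact_mod_cast h0)).sub
    (tendsto_jm pc pi (k := k) (by simp) (by exact_mod_cast h0))).norm
  refine squeeze_zero_norm (fun x => le_of_eq ?_) (by simpa using this)
  rw [jf, jf, ← mul_sub, norm_mul, norm_cexp_real, one_mul]

lemma tendsto_jf'_sub_jf' (hc : Continuous q) (hi : Integrable q) (pc : Continuous p)
    (pi : Integrable p) (h0 : k ≠ 0) : Tendsto (fun x => jf' q k x - jf' p k x) atTop (𝓝 0) := by
  have := ((tendsto_jf'_sub hc hi h0).sub (tendsto_jf'_sub pc pi h0)).add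
    ((tendsto_jf_sub hc hi pc pi h0).const_mul (Complex.I * k))
  simp only [sub_zero, mul_zero, add_zero] at this
  refine this.congr fun x => ?_
  ring

lemma tendsto_conj_comp_neg {F : ℝ → ℂ} (h : Tendsto F atTop (𝓝 0)) :
    Tendsto (fun x => starRingEnd ℂ (F (-x))) atBot (𝓝 0) := by
  have := (Complex.continuous_conj.tendsto 0).comp (h.comp tendsto_neg_atBot_atTop)
  rw [map_zero] at this
  exact this

lemma tendsto_jg'_sub (hc : Continuous q) (hi : Integrable q) (h0 : k ≠ 0) :
    Tendsto (fun x => jg' q k x - Complex.I * k * jg q k x) atBot (𝓝 0) := by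
  obtain ⟨nc, ni⟩ := comp_neg_data hc hi
  have := (tendsto_conj_comp_neg (tendsto_jf'_sub nc ni h0)).neg
  rw [neg_zero] at this
  refine this.congr fun x => ?_
  simp [jg', jg]
  ring

lemma tendsto_jg_sub (hc : Continuous q) (hi : Integrable q) (pc : Continuous p)
    (pi : Integrable p) (h0 : k ≠ 0) : Tendsto (fun x => jg q k x - jg p k x) atBot (𝓝 0) := by
  obtain ⟨nc, ni⟩ := comp_neg_data hc hi
  obtain ⟨nc', ni'⟩ := comp_neg_data pc pi
  have := tendsto_conj_comp_neg (tendsto_jf_sub nc ni nc' ni' h0)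
  refine this.congr fun x => ?_
  simp [jg]

lemma tendsto_jg'_sub_jg' (hc : Continuous q) (hi : Integrable q) (pc : Continuous p)
    (pi : Integrable p) (h0 : k ≠ 0) : Tendsto (fun x => jg' q k x - jg' p k x) atBot (𝓝 0) := by
  have := ((tendsto_jg'_sub hc hi h0).sub (tendsto_jg'_sub pc pi h0)).add
    ((tendsto_jg_sub hc hi pc pi h0).const_mul (Complex.I * k))
  simp only [sub_zero, mul_zero, add_zero] at this
  refine this.congr fun x => ?_
  ring

lemma tendsto_zero_mul_bdd {l : Filter ℝ} {F G : ℝ → ℂ} (hF : Tendsto F l (𝓝 0)) {B : ℝ}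
    (hG : ∀ x, ‖G x‖ ≤ B) : Tendsto (fun x => F x * G x) l (𝓝 0) := by
  refine squeeze_zero_norm (fun x => ?_) (by simpa using hF.norm.mul_const B)
  rw [norm_mul]
  exact mul_le_mul_of_nonneg_left (hG x) (norm_nonneg _)

lemma jw_eq (hc : Continuous q) (hi : Integrable q) (h0 : k ≠ 0) (x : ℝ) :
    jf q k x * jg' q k x - jf' q k x * jg q k x = jw q k := by
  have hk : 0 ≤ (k : ℂ).im := by simp
  have hk0 : (k : ℂ) ≠ 0 := by exact_mod_cast h0
  refine is_const_of_hasDerivAt_zero (F := fun x => jf q k x * jg' q k x - jf' q k x * jg q k x)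
    (fun x => ?_) x 0
  refine (((hasDerivAt_jf hc hi hk hk0 x).mul (hasDerivAt_jg' hc hi h0 x)).sub
    ((hasDerivAt_jf' hc hi hk hk0 x).mul (hasDerivAt_jg hc hi hk hk0 x))).congr_deriv ?_
  ring

lemma integrable_mul_jf_jg (hi : Integrable q) {p₁ p₂ : ℝ → ℝ} (c₁ : Continuous p₁)
    (i₁ : Integrable p₁) (c₂ : Continuous p₂) (i₂ : Integrable p₂) (h0 : k ≠ 0) :
    Integrable fun x => (q x : ℂ) * (jf p₁ k x * jg p₂ k x) := by
  have hk : 0 ≤ (k : ℂ).im := by simp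
  have hk0 : (k : ℂ) ≠ 0 := by exact_mod_cast h0
  have k1 : Continuous (jf p₁ k) :=
    continuous_iff_continuousAt.mpr fun x => (hasDerivAt_jf c₁ i₁ hk hk0 x).continuousAt
  have k2 : Continuous (jg p₂ k) :=
    continuous_iff_continuousAt.mpr fun x => (hasDerivAt_jg c₂ i₂ hk hk0 x).continuousAt
  refine integrable_mul_of_bdd hi (B := (2 * jB p₁ k) * (2 * jB p₂ k)) (by fun_prop) fun x => ?_
  rw [norm_mul]
  have : 0 < jB p₁ k := Real.exp_pos _
  exact mul_le_mul (norm_jf_le c₁ i₁ h0 x) (norm_jg_le c₂ i₂ h0 x) (norm_nonneg _) (by positivity)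

lemma jw_sub_jw (hc : Continuous q) (hi : Integrable q) (pc : Continuous p)
    (pi : Integrable p) (h0 : k ≠ 0) :
    jw p k - jw q k = ∫ x, ((q x - p x : ℝ) : ℂ) * (jf q k x * jg p k x) := by
  have hk : 0 ≤ (k : ℂ).im := by simp
  have hk0 : (k : ℂ) ≠ 0 := by exact_mod_cast h0
  symm
  refine integral_of_hasDerivAt_of_tendsto
    (f := fun x => jf q k x * jg' p k x - jf' q k x * jg p k x) (fun x => ?_)
    (integrable_mul_jf_jg (hi.sub pi) hc hi pc pi h0) ?_ ?_
  · refine (((hasDerivAt_jf hc hi hk hk0 x).mul (hasDerivAt_jg' pc pi h0 x)).sub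
      ((hasDerivAt_jf' hc hi hk hk0 x).mul (hasDerivAt_jg pc pi hk hk0 x))).congr_deriv ?_
    push_cast
    ring
  · have h1 := tendsto_zero_mul_bdd (tendsto_jg'_sub_jg' pc pi hc hi h0) (norm_jf_le hc hi h0)
    have h2 := tendsto_zero_mul_bdd (tendsto_jg_sub pc pi hc hi h0) (norm_jf'_le hc hi h0)
    have h3 := (h1.sub h2).add_const (jw q k)
    simp only [sub_zero, zero_add] at h3
    refine h3.congr fun x => ?_
    rw [← jw_eq hc hi h0 x]; ring
  · have h1 := tendsto_zero_mul_bdd (tendsto_jf_sub hc hi pc pi h0) (norm_jg'_le pc pi h0)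
    have h2 := tendsto_zero_mul_bdd (tendsto_jf'_sub_jf' hc hi pc pi h0) (norm_jg_le pc pi h0)
    have h3 := (h1.sub h2).add_const (jw p k)
    simp only [sub_zero, zero_add] at h3
    refine h3.congr fun x => ?_
    rw [← jw_eq pc pi h0 x]; ring

lemma jw_eq_integral (hc : Continuous q) (hi : Integrable q) (h0 : k ≠ 0) :
    jw q k = -∫ y : ℝ, Complex.exp (2 * Complex.I * k * y) * (q y * jm q k y) := by
  have hk : 0 ≤ (k : ℂ).im := by simp
  have hk0 : (k : ℂ) ≠ 0 := by exact_mod_cast h0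
  obtain ⟨nc, ni⟩ := comp_neg_data hc hi
  set h : ℝ → ℂ := fun y => Complex.exp (2 * Complex.I * k * y) * (q y * jm q k y) with hh
  have ih : Integrable h := by
    refine (integrable_mul_jm hc hi hk hk0).bdd_mul (c := 1)
      (by fun_prop : Continuous _).aestronglyMeasurable (Eventually.of_forall fun y => ?_)
    have := norm_cexp_real (2 * k) y
    rw [← this]
    push_cast
    exact le_of_eq (by ring_nf)
  have t1 : Tendsto (fun x => ∫ y in Set.Ioi x, h y) atBot (𝓝 (∫ y, h y)) := by
    have h1 := (tendsto_setIntegral_Ioi_atTop ih.comp_neg).comp tendsto_neg_atBot_atTop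
    have h2 := h1.const_sub (∫ y, h y)
    rw [sub_zero] at h2
    refine h2.congr fun x => ?_
    have e1 := integral_comp_neg_Ioi (-x) h
    rw [neg_neg] at e1
    rw [Function.comp_apply, e1, ← intervalIntegral.integral_Iic_add_Ioi
      (ih.integrableOn (s := Set.Iic x)) ih.integrableOn, add_sub_cancel_left]
  have t2 : Tendsto (fun x => starRingEnd ℂ (jm (fun y => q (-y)) k (-x))) atBot (𝓝 1) := by
    have := (Complex.continuous_conj.tendsto 1).comp ((tendsto_jm nc ni hk hk0).comp
      tendsto_neg_atBot_atTop)
    rw [map_one] at this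
    exact this
  have t3 := tendsto_zero_mul_bdd (tendsto_jg'_sub hc hi h0) (norm_jf_le hc hi h0)
  have t4 := t3.sub (t1.mul t2)
  rw [zero_sub, mul_one] at t4
  refine tendsto_nhds_unique (tendsto_const_nhds.congr fun x => ?_) t4
  rw [← jw_eq hc hi h0 x]
  have e1 : jf' q k x - Complex.I * k * jf q k x = Complex.exp (Complex.I * k * x) * jm' q k x := by
    rw [jf', jf]; ring
  have e2 : Complex.exp (Complex.I * k * x) * jm' q k x * jg q k x =
      (∫ y in Set.Ioi x, h y) * starRingEnd ℂ (jm (fun y => q (-y)) k (-x)) := by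
    have e3 : Complex.exp (Complex.I * k * x) * Complex.exp (-(2 * Complex.I * k * x)) *
        Complex.exp (Complex.I * k * x) = 1 := by
      rw [← Complex.exp_add, ← Complex.exp_add, ← Complex.exp_zero]
      congr 1; ring
    have e4 : starRingEnd ℂ (Complex.exp (Complex.I * k * (-x : ℝ))) =
        Complex.exp (Complex.I * k * x) := by
      rw [← Complex.exp_conj]; simp
    rw [jg, jf, map_mul, e4, jm', jD]
    simp only [hh]
    linear_combination ((∫ y in Set.Ioi x, Complex.exp (2 * Complex.I * k * y) * (q y * jm q k y)) *
      starRingEnd ℂ (jm (fun y => q (-y)) k (-x))) * e3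
  linear_combination (-jg q k x) * e1 - e2

end RealFrequency

lemma tendsto_zero_of_integrable_deriv {F F' : ℝ → ℝ} (h : ∀ x, HasDerivAt F (F' x) x)
    (i : Integrable F) (i' : Integrable F') : Tendsto F atTop (𝓝 0) ∧ Tendsto F atBot (𝓝 0) :=
  ⟨tendsto_zero_of_hasDerivAt_of_integrableOn_Ioi (a := 0) (fun x _ => h x) i'.integrableOn
      i.integrableOn,
    tendsto_zero_of_hasDerivAt_of_integrableOn_Iic (a := 0) (fun x _ => h x) i'.integrableOn
      i.integrableOn⟩

/-- The regularized Korteweg–de Vries velocity, for the mollified potential `Q` and mollified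
square `S`. -/
noncomputable def kdvVel (Q S : ℝ → ℝ) (x : ℝ) : ℝ :=
  -deriv (deriv (deriv Q)) x - 3 * deriv S x

/-- A smooth integrable potential, together with an approximation of its square. -/
structure NicePot (M a C : ℝ) (Q S : ℝ → ℝ) : Prop where
  smooth : ContDiff ℝ 3 Q
  smooth' : ContDiff ℝ 1 S
  int : Integrable Q
  int1 : Integrable (deriv Q)
  int2 : Integrable (deriv (deriv Q))
  int3 : Integrable (deriv (deriv (deriv Q)))
  intS : Integrable S
  intS' : Integrable (deriv S)
  bdd : ∀ x, |Q x| ≤ 1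
  l1_le : (∫ x, |Q x|) ≤ M
  defect : (∫ x, |S x - Q x ^ 2|) ≤ a
  vel : (∫ x, |kdvVel Q S x|) ≤ C

/-- Derivative of the product of the two Jost solutions. -/
noncomputable def jp' (q : ℝ → ℝ) (k : ℂ) (x : ℝ) : ℂ := jf' q k x * jg q k x + jf q k x * jg' q k x

section

variable {M a C : ℝ} {Q S : ℝ → ℝ} {k : ℝ}

lemma continuous_jf (hc : Continuous Q) (hi : Integrable Q) (h0 : k ≠ 0) : Continuous (jf Q k) :=
  continuous_iff_continuousAt.mpr fun x =>
    (hasDerivAt_jf hc hi (by simp) (by exact_mod_cast h0) x).continuousAt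

lemma continuous_jf' (hc : Continuous Q) (hi : Integrable Q) (h0 : k ≠ 0) : Continuous (jf' Q k) :=
  continuous_iff_continuousAt.mpr fun x =>
    (hasDerivAt_jf' hc hi (by simp) (by exact_mod_cast h0) x).continuousAt

lemma continuous_jg (hc : Continuous Q) (hi : Integrable Q) (h0 : k ≠ 0) : Continuous (jg Q k) :=
  continuous_iff_continuousAt.mpr fun x =>
    (hasDerivAt_jg hc hi (by simp) (by exact_mod_cast h0) x).continuousAt

lemma continuous_jg' (hc : Continuous Q) (hi : Integrable Q) (h0 : k ≠ 0) : Continuous (jg' Q k) :=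
  continuous_iff_continuousAt.mpr fun x => (hasDerivAt_jg' hc hi h0 x).continuousAt

lemma norm_jp_le (hc : Continuous Q) (hi : Integrable Q) (h0 : k ≠ 0) (x : ℝ) :
    ‖jf Q k x * jg Q k x‖ ≤ (2 * jB Q k) * (2 * jB Q k) := by
  have : 0 < jB Q k := Real.exp_pos _
  rw [norm_mul]
  exact mul_le_mul (norm_jf_le hc hi h0 x) (norm_jg_le hc hi h0 x) (norm_nonneg _) (by positivity)

lemma norm_jp'_le (hc : Continuous Q) (hi : Integrable Q) (h0 : k ≠ 0) (x : ℝ) :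
    ‖jp' Q k x‖ ≤ 2 * (jB' Q k * (2 * jB Q k)) := by
  have hB : 0 < jB Q k := Real.exp_pos _
  have hB' : 0 ≤ jB' Q k := (norm_nonneg _).trans (norm_jf'_le hc hi h0 0)
  refine (norm_add_le _ _).trans ?_
  rw [norm_mul, norm_mul, two_mul]
  refine add_le_add (mul_le_mul (norm_jf'_le hc hi h0 x) (norm_jg_le hc hi h0 x)
    (norm_nonneg _) hB') ?_
  rw [mul_comm (jB' Q k)]
  exact mul_le_mul (norm_jf_le hc hi h0 x) (norm_jg'_le hc hi h0 x) (norm_nonneg _) (by positivity)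

lemma NicePot.integral_vel (h : NicePot M a C Q S) (h0 : k ≠ 0) :
    ∫ x, (kdvVel Q S x : ℂ) * (jf Q k x * jg Q k x) = 8 * Complex.I * k ^ 3 * jw Q k +
      3 * ∫ x, ((S x - Q x ^ 2 : ℝ) : ℂ) * jp' Q k x := by
  have hc := h.smooth.continuous
  have hi := h.int
  have hk : 0 ≤ (k : ℂ).im := by simp
  have hk0 : (k : ℂ) ≠ 0 := by exact_mod_cast h0
  have kf := continuous_jf hc hi h0
  have kf' := continuous_jf' hc hi h0
  have kg := continuous_jg hc hi h0
  have kg' := continuous_jg' hc hi h0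
  have kp' : Continuous (jp' Q k) := by unfold jp'; fun_prop
  have s1 : ContDiff ℝ 2 (deriv Q) := h.smooth.deriv'
  have s2 : ContDiff ℝ 1 (deriv (deriv Q)) := s1.deriv'
  have d0 : ∀ x, HasDerivAt Q (deriv Q x) x := fun x =>
    (h.smooth.differentiable (by norm_num) x).hasDerivAt
  have d1 : ∀ x, HasDerivAt (deriv Q) (deriv (deriv Q) x) x := fun x =>
    (s1.differentiable (by norm_num) x).hasDerivAt
  have d2 : ∀ x, HasDerivAt (deriv (deriv Q)) (deriv (deriv (deriv Q)) x) x := fun x =>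
    (s2.differentiable (by norm_num) x).hasDerivAt
  have dS : ∀ x, HasDerivAt S (deriv S x) x := fun x =>
    (h.smooth'.differentiable (by norm_num) x).hasDerivAt
  have iF : Integrable (kdvVel Q S) := by
    have : Integrable fun x => -deriv (deriv (deriv Q)) x - 3 * deriv S x :=
      h.int3.neg.sub (h.intS'.const_mul 3)
    exact this
  have iQ2 : Integrable fun x => Q x ^ 2 := by
    simp only [pow_two]
    exact hi.mul_bdd (c := 1) hc.aestronglyMeasurable (Eventually.of_forall h.bdd)
  have iE : Integrable fun x => S x - Q x ^ 2 := h.intS.sub iQ2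
  have i1 := integrable_mul_of_bdd iF (h := fun x => jf Q k x * jg Q k x) (by fun_prop)
    (norm_jp_le hc hi h0)
  have i2 := integrable_mul_of_bdd iE kp' (norm_jp'_le hc hi h0)
  rw [← sub_eq_iff_eq_add, ← integral_const_mul, ← integral_sub i1 (i2.const_mul 3)]
  have hb := norm_jp_le hc hi h0
  have hb' := norm_jp'_le hc hi h0
  have hb2 : ∀ x, ‖2 * (jf' Q k x * jg' Q k x) - 2 * ((Q x + k ^ 2 : ℝ) : ℂ) * (jf Q k x * jg Q k x)‖
      ≤ 2 * (jB' Q k * jB' Q k) + 2 * (1 + k ^ 2) * ((2 * jB Q k) * (2 * jB Q k)) := fun x => by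
    have hB' : 0 ≤ jB' Q k := (norm_nonneg _).trans (norm_jf'_le hc hi h0 0)
    refine (norm_sub_le _ _).trans (add_le_add ?_ ?_)
    · rw [norm_mul, norm_mul, Complex.norm_two]
      have := mul_le_mul (norm_jf'_le hc hi h0 x) (norm_jg'_le hc hi h0 x) (norm_nonneg _) hB'
      linarith
    · rw [norm_mul, norm_mul, Complex.norm_two, Complex.norm_real, Real.norm_eq_abs]
      have e1 : |Q x + k ^ 2| ≤ 1 + k ^ 2 :=
        (abs_add_le _ _).trans (add_le_add (h.bdd x) (abs_of_nonneg (sq_nonneg k)).le)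
      exact mul_le_mul (by linarith) (hb x) (norm_nonneg _) (by positivity)
  have zr : ∀ {l : Filter ℝ} {P : ℝ → ℝ} {G : ℝ → ℂ} {B : ℝ}, Tendsto P l (𝓝 0) →
      (∀ x, ‖G x‖ ≤ B) → Tendsto (fun x => (P x : ℂ) * G x) l (𝓝 0) := fun hP hG => by
    refine tendsto_zero_mul_bdd ?_ hG
    have := (Complex.continuous_ofReal.tendsto 0).comp hP
    rw [Complex.ofReal_zero] at this
    exact this
  obtain ⟨z0, z0'⟩ := tendsto_zero_of_integrable_deriv d0 hi h.int1
  obtain ⟨z1, z1'⟩ := tendsto_zero_of_integrable_deriv d1 h.int1 h.int2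
  obtain ⟨z2, z2'⟩ := tendsto_zero_of_integrable_deriv d2 h.int2 h.int3
  obtain ⟨zS, zS'⟩ := tendsto_zero_of_integrable_deriv dS h.intS h.intS'
  set Z : ℝ → ℂ := fun x => -(((deriv (deriv Q) x : ℝ) : ℂ) * (jf Q k x * jg Q k x)) +
    ((deriv Q x : ℝ) : ℂ) * jp' Q k x - ((Q x : ℝ) : ℂ) * (2 * (jf' Q k x * jg' Q k x) -
      2 * ((Q x + k ^ 2 : ℝ) : ℂ) * (jf Q k x * jg Q k x)) -
    3 * (((S x : ℝ) : ℂ) * (jf Q k x * jg Q k x)) - ((Q x ^ 2 : ℝ) : ℂ) * (jf Q k x * jg Q k x) with hZ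
  set Y : ℝ → ℂ := fun x => 4 * k ^ 2 * (jf' Q k x * jg' Q k x + k ^ 2 * (jf Q k x * jg Q k x))
    with hY
  have lim : ∀ {l : Filter ℝ}, Tendsto Q l (𝓝 0) → Tendsto (deriv Q) l (𝓝 0) →
      Tendsto (deriv (deriv Q)) l (𝓝 0) → Tendsto S l (𝓝 0) → Tendsto Z l (𝓝 0) :=
    fun {l} y0 y1 y2 y3 => by
      have y4 : Tendsto (fun x => Q x ^ 2) l (𝓝 0) := by simpa using y0.pow 2
      have := ((((zr y2 hb).neg.add (zr y1 hb')).sub (zr y0 hb2)).sub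
        ((zr y3 hb).const_mul 3)).sub (zr y4 hb)
      rw [show -(0 : ℂ) + 0 - 0 - 3 * 0 - 0 = 0 by norm_num] at this
      exact this
  have l1 : Tendsto Y atTop (𝓝 (4 * k ^ 2 * (Complex.I * k * jw Q k))) := by
    have t1 := tendsto_zero_mul_bdd (tendsto_jf'_sub hc hi h0) (norm_jg'_le hc hi h0)
    have t2 := tendsto_zero_mul_bdd (tendsto_jf'_sub hc hi h0) (norm_jg_le hc hi h0)
    have t3 := ((t1.add (t2.const_mul (Complex.I * k))).add_const
      (Complex.I * k * jw Q k)).const_mul (4 * (k : ℂ) ^ 2)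
    simp only [mul_zero, add_zero, zero_add] at t3
    refine t3.congr fun x => ?_
    rw [← jw_eq hc hi h0 x, hY]
    dsimp only
    linear_combination (-4 * (k : ℂ) ^ 4 * jf Q k x * jg Q k x) * Complex.I_sq
  have l2 : Tendsto Y atBot (𝓝 (4 * k ^ 2 * (-(Complex.I * k * jw Q k)))) := by
    have t1 := tendsto_zero_mul_bdd (tendsto_jg'_sub hc hi h0) (norm_jf'_le hc hi h0)
    have t2 := tendsto_zero_mul_bdd (tendsto_jg'_sub hc hi h0) (norm_jf_le hc hi h0)
    have t3 := ((t1.add (t2.const_mul (Complex.I * k))).add_const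
      (-(Complex.I * k * jw Q k))).const_mul (4 * (k : ℂ) ^ 2)
    simp only [mul_zero, add_zero, zero_add] at t3
    refine t3.congr fun x => ?_
    rw [← jw_eq hc hi h0 x, hY]
    dsimp only
    linear_combination (-4 * (k : ℂ) ^ 4 * jf Q k x * jg Q k x) * Complex.I_sq
  have i3 : Integrable fun x => (kdvVel Q S x : ℂ) * (jf Q k x * jg Q k x) -
      3 * (((S x - Q x ^ 2 : ℝ) : ℂ) * jp' Q k x) := i1.sub (i2.const_mul 3)
  rw [integral_of_hasDerivAt_of_tendsto (f := fun x => Z x + Y x) (fun x => ?_) i3 ((lim z0' z1' z2' zS').add l2) ((lim z0 z1 z2 zS).add l1)]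
  · ring
  · have ef := hasDerivAt_jf hc hi hk hk0 x
    have ef' := hasDerivAt_jf' hc hi hk hk0 x
    have eg := hasDerivAt_jg hc hi hk hk0 x
    have eg' := hasDerivAt_jg' hc hi h0 x
    have ep := ef.fun_mul eg
    have ep' : HasDerivAt (jp' Q k) _ x := (ef'.fun_mul eg).fun_add (ef.fun_mul eg')
    have e0 := (d0 x).ofReal_comp
    have e1 := (d1 x).ofReal_comp
    have e2 := (d2 x).ofReal_comp
    have e3 := (dS x).ofReal_comp
    have e4 := ((d0 x).fun_pow 2).ofReal_comp
    have e5 := ((d0 x).add_const (k ^ 2)).ofReal_comp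
    have z := ((((e2.fun_mul ep).fun_neg.fun_add (e1.fun_mul ep')).fun_sub
      (e0.fun_mul (((ef'.fun_mul eg').const_mul 2).fun_sub ((e5.const_mul 2).fun_mul ep)))).fun_sub
      ((e3.fun_mul ep).const_mul 3)).fun_sub (e4.fun_mul ep)
    have y := ((ef'.fun_mul eg').fun_add (ep.const_mul ((k : ℂ) ^ 2))).const_mul (4 * (k : ℂ) ^ 2)
    refine (z.fun_add y).congr_deriv ?_
    simp only [kdvVel, jp']
    push_cast
    ring

end

/-- A family of smooth potentials solving an approximate Korteweg–de Vries equation. -/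
structure NiceFlow (M a C : ℝ) (Q S : ℝ → ℝ → ℝ) : Prop where
  nice : ∀ t, 2 < t → NicePot M a C (Q t) (S t)
  deriv : ∀ t, 2 < t → ∀ x, HasDerivAt (fun s => Q s x) (kdvVel (Q t) (S t) x) t
  cont : ∀ x, ContinuousOn (fun t => kdvVel (Q t) (S t) x) (Set.Ioi 2)

lemma integrable_prod_of_slices {F : ℝ → ℝ → ℝ} {t s C : ℝ} (hτ : ∀ x, ContinuousOn (fun τ => F τ x) (Set.Ici t))
    (hx : ∀ τ, t ≤ τ → Continuous (F τ)) (hi : ∀ τ, t ≤ τ → Integrable (F τ))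
    (hC : ∀ τ, t ≤ τ → (∫ x, |F τ x|) ≤ C) :
    Integrable (Function.uncurry F) ((volume.restrict (Set.Ioc t s)).prod volume) := by
  have hG : Measurable (Function.uncurry fun τ x => F (max t τ) x) := by
    refine measurable_uncurry_of_continuous_of_measurable (fun x => ?_)
      fun τ => (hx _ (le_max_left _ _)).measurable
    exact (hτ x).comp_continuous (by fun_prop) fun τ => Set.mem_Ici.2 (le_max_left _ _)
  have hs : (volume.restrict (Set.Ioc t s)).prod (volume : Measure ℝ) =
      ((volume : Measure ℝ).prod volume).restrict (Set.Ioc t s ×ˢ Set.univ) := by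
    rw [← Measure.prod_restrict, Measure.restrict_univ]
  have hm : AEStronglyMeasurable (Function.uncurry F)
      ((volume.restrict (Set.Ioc t s)).prod volume) := by
    refine hG.aestronglyMeasurable.congr ?_
    rw [hs]
    filter_upwards [ae_restrict_mem (measurableSet_Ioc.prod MeasurableSet.univ)] with p hp
    simp only [Function.uncurry, max_eq_right hp.1.1.le]
  rw [integrable_prod_iff hm]
  have hmem : ∀ᵐ τ ∂(volume.restrict (Set.Ioc t s)), t ≤ τ :=
    (ae_restrict_mem measurableSet_Ioc).mono fun τ hτ => hτ.1.le
  refine ⟨hmem.mono fun τ h => hi τ h, ?_⟩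
  refine Integrable.of_bound hm.norm.integral_prod_right' C (hmem.mono fun τ h => ?_)
  rw [Real.norm_eq_abs, abs_of_nonneg (integral_nonneg fun _ => norm_nonneg _)]
  exact hC τ h

section
variable {M a C : ℝ} {Q S : ℝ → ℝ → ℝ} {k : ℝ}

lemma NicePot.continuous_vel {Q S : ℝ → ℝ} (h : NicePot M a C Q S) : Continuous (kdvVel Q S) := by
  have s1 : ContDiff ℝ 2 (_root_.deriv Q) := h.smooth.deriv'
  have s2 : ContDiff ℝ 1 (_root_.deriv (_root_.deriv Q)) := s1.deriv'
  exact (s2.continuous_deriv le_rfl).neg.sub (continuous_const.mul (h.smooth'.continuous_deriv le_rfl))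

lemma NicePot.integrable_vel {Q S : ℝ → ℝ} (h : NicePot M a C Q S) : Integrable (kdvVel Q S) :=
  h.int3.neg.sub (h.intS'.const_mul 3)

lemma NiceFlow.integrable_vel (h : NiceFlow M a C Q S) {t s : ℝ} (ht : 2 < t) :
    Integrable (Function.uncurry fun τ x => kdvVel (Q τ) (S τ) x)
      ((volume.restrict (Set.Ioc t s)).prod volume) :=
  integrable_prod_of_slices
    (fun x => (h.cont x).mono fun _ hτ => lt_of_lt_of_le ht hτ)
    (fun τ hτ => (h.nice τ (ht.trans_le hτ)).continuous_vel)
    (fun τ hτ => (h.nice τ (ht.trans_le hτ)).integrable_vel)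
    fun τ hτ => (h.nice τ (ht.trans_le hτ)).vel

lemma NiceFlow.sub_eq (h : NiceFlow M a C Q S) {t s : ℝ} (ht : 2 < t) (hs : t ≤ s) (x : ℝ) :
    Q s x - Q t x = ∫ τ in Set.Ioc t s, kdvVel (Q τ) (S τ) x := by
  have hsub : Set.uIcc t s ⊆ Set.Ioi 2 := by
    rw [Set.uIcc_of_le hs]; exact fun τ hτ => lt_of_lt_of_le ht hτ.1
  rw [← intervalIntegral.integral_of_le hs, intervalIntegral.integral_eq_sub_of_hasDerivAt
    (fun τ hτ => h.deriv τ (hsub hτ) x) ((h.cont x).mono hsub).intervalIntegrable]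

lemma NiceFlow.integral_abs_sub_le (h : NiceFlow M a C Q S) {t s : ℝ} (ht : 2 < t) (hs : t ≤ s) :
    (∫ x, |Q s x - Q t x|) ≤ C * (s - t) := by
  have hF := (h.integrable_vel (s := s) ht).abs
  have h1 : (∫ x, |Q s x - Q t x|) ≤ ∫ x, ∫ τ in Set.Ioc t s, |kdvVel (Q τ) (S τ) x| := by
    refine integral_mono (((h.nice s (ht.trans_le hs)).int.sub (h.nice t ht).int).abs)
      hF.integral_prod_right fun x => ?_
    dsimp only
    rw [h.sub_eq ht hs x]
    exact abs_integral_le_integral_abs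
  refine h1.trans ?_
  rw [← integral_integral_swap (f := fun τ x => |kdvVel (Q τ) (S τ) x|) hF]
  refine (integral_mono_of_nonneg (Eventually.of_forall fun τ => integral_nonneg fun x => abs_nonneg _)
    (integrable_const C) ?_).trans ?_
  · filter_upwards [ae_restrict_mem measurableSet_Ioc] with τ hτ
    exact (h.nice τ (ht.trans hτ.1)).vel
  · simp [hs, mul_comm]

lemma NiceFlow.integral_sub_mul (h : NiceFlow M a C Q S) {t s : ℝ} (ht : 2 < t) (hs : t ≤ s)
    {Φ : ℝ → ℂ} (hΦ : Continuous Φ) {B : ℝ} (hB : ∀ x, ‖Φ x‖ ≤ B) :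
    IntegrableOn (fun τ => ∫ x, (kdvVel (Q τ) (S τ) x : ℂ) * Φ x) (Set.Ioc t s) ∧
    ∫ x, ((Q s x - Q t x : ℝ) : ℂ) * Φ x =
      ∫ τ in Set.Ioc t s, ∫ x, (kdvVel (Q τ) (S τ) x : ℂ) * Φ x := by
  have hF : Integrable (Function.uncurry fun τ x => (kdvVel (Q τ) (S τ) x : ℂ) * Φ x)
      ((volume.restrict (Set.Ioc t s)).prod volume) :=
    (h.integrable_vel (s := s) ht).ofReal.mul_bdd (c := B)
      (hΦ.comp continuous_snd).aestronglyMeasurable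
      (Eventually.of_forall fun p => hB p.2)
  refine ⟨hF.integral_prod_left, ?_⟩
  rw [integral_integral_swap hF]
  congr 1 with x
  rw [h.sub_eq ht hs x, integral_mul_const]
  congr 1
  exact (integral_ofReal (𝕜 := ℂ)).symm

end

lemma norm_integral_mul_le {F : ℝ → ℝ} {Φ : ℝ → ℂ} {B c : ℝ} (hF : Integrable F)
    (hB : ∀ x, ‖Φ x‖ ≤ B) (hc : (∫ x, |F x|) ≤ c) : ‖∫ x, (F x : ℂ) * Φ x‖ ≤ B * c := by
  have hB0 : 0 ≤ B := (norm_nonneg _).trans (hB 0)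
  refine (norm_integral_le_of_norm_le (hF.abs.const_mul B) (Eventually.of_forall fun x => ?_)).trans ?_
  · rw [norm_mul, Complex.norm_real, Real.norm_eq_abs, mul_comm]
    exact mul_le_mul_of_nonneg_right (hB x) (abs_nonneg _)
  · rw [integral_const_mul]; exact mul_le_mul_of_nonneg_left hc hB0

/-- A bound for `jB` in terms of the size of the potential. -/
noncomputable def jE (M k : ℝ) : ℝ := Real.exp (2 * ‖(k : ℂ)‖⁻¹ * M)

/-- The constant controlling the effect of the defect of a mollified solution. -/
noncomputable def jA (M k : ℝ) : ℝ := 3 * (2 * ((‖(k : ℂ)‖ + M) * (2 * jE M k) * (2 * jE M k)))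

section
variable {M a C : ℝ} {k : ℝ}

lemma jE_pos (M k : ℝ) : 0 < jE M k := Real.exp_pos _

lemma jB_le_jE {q : ℝ → ℝ} (hM : (∫ x, |q x|) ≤ M) (k : ℝ) : jB q k ≤ jE M k :=
  Real.exp_le_exp.2 (mul_le_mul_of_nonneg_left hM (by positivity))

lemma jB_pos (q : ℝ → ℝ) (k : ℂ) : 0 < jB q k := Real.exp_pos _

lemma norm_jw_sub_le {q p : ℝ → ℝ} (hc : Continuous q) (hi : Integrable q) (pc : Continuous p)
    (pi : Integrable p) (h0 : k ≠ 0) (hq : (∫ x, |q x|) ≤ M) (hp : (∫ x, |p x|) ≤ M) :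
    ‖jw p k - jw q k‖ ≤ (2 * jE M k) * (2 * jE M k) * ∫ x, |q x - p x| := by
  rw [jw_sub_jw hc hi pc pi h0]
  refine norm_integral_mul_le (hi.sub pi) (fun x => ?_) le_rfl
  rw [norm_mul]
  have h1 := jB_le_jE hq k
  have h2 := jB_le_jE hp k
  have h3 := jE_pos M k
  exact mul_le_mul ((norm_jf_le hc hi h0 x).trans (by linarith))
    ((norm_jg_le pc pi h0 x).trans (by linarith)) (norm_nonneg _) (by positivity)

lemma norm_jp'_le' {q : ℝ → ℝ} (hc : Continuous q) (hi : Integrable q) (h0 : k ≠ 0)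
    (hq : (∫ x, |q x|) ≤ M) (x : ℝ) :
    ‖jp' q k x‖ ≤ 2 * ((‖(k : ℂ)‖ + M) * (2 * jE M k) * (2 * jE M k)) := by
  refine (norm_jp'_le hc hi h0 x).trans ?_
  have h1 := jB_le_jE hq k
  have h3 := jB_pos q k
  have : 0 ≤ ∫ x, |q x| := integral_nonneg fun _ => abs_nonneg _
  have hE := jE_pos M k
  have hM : 0 ≤ M := this.trans hq
  unfold jB'
  gcongr

lemma jprod_sub_le {f₁ f₂ g₁ g₂ : ℂ} {B L : ℝ} (hf : ‖f₁ - f₂‖ ≤ L) (hg : ‖g₁ - g₂‖ ≤ L)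
    (h1 : ‖g₁‖ ≤ B) (h2 : ‖f₂‖ ≤ B) : ‖f₁ * g₁ - f₂ * g₂‖ ≤ 2 * (L * B) := by
  have e : f₁ * g₁ - f₂ * g₂ = (f₁ - f₂) * g₁ + f₂ * (g₁ - g₂) := by ring
  rw [e]
  refine (norm_add_le _ _).trans ?_
  rw [norm_mul, norm_mul]
  have hL := (norm_nonneg _).trans hf
  have hB := (norm_nonneg _).trans h1
  nlinarith [mul_le_mul hf h1 (norm_nonneg _) hL, mul_le_mul h2 hg (norm_nonneg _) hB]

lemma jsol_sub_le {q p : ℝ → ℝ} {d : ℝ} (hq : (∫ x, |q x|) ≤ M) (hp : (∫ x, |p x|) ≤ M) (hd : (∫ x, |q x - p x|) ≤ d) :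
    4 * ‖(k : ℂ)‖⁻¹ * jB q k * jB p k * (∫ x, |q x - p x|) ≤
      4 * ‖(k : ℂ)‖⁻¹ * jE M k * jE M k * d := by
  have h1 := jB_le_jE hq k
  have h2 := jB_le_jE hp k
  have h3 := jB_pos q k
  have h4 := jB_pos p k
  have : 0 ≤ ∫ x, |q x - p x| := integral_nonneg fun _ => abs_nonneg _
  have hE := jE_pos M k
  gcongr

lemma NiceFlow.step {Q S : ℝ → ℝ → ℝ} (h : NiceFlow M a C Q S) (h0 : k ≠ 0) :
    ∃ K, 0 ≤ K ∧ ∀ t s, 2 < t → t ≤ s →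
      ‖jw (Q s) k - jw (Q t) k + 8 * Complex.I * k ^ 3 * (s - t) * jw (Q t) k‖ ≤
        jA M k * a * (s - t) + K * (s - t) ^ 2 := by
  have hEp := jE_pos M k
  set E := jE M k with hE
  have hC : 0 ≤ C := (integral_nonneg fun _ => abs_nonneg _).trans (h.nice 3 (by norm_num)).vel
  refine ⟨8 * |k| ^ 3 * ((2 * E) * (2 * E) * C) +
    2 * ((4 * ‖(k : ℂ)‖⁻¹ * E * E * C) * (2 * E)) * C, by positivity, fun t s ht hs => ?_⟩
  have Nt := h.nice t ht
  have Ns := h.nice s (ht.trans_le hs)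
  have cf := continuous_jf Nt.smooth.continuous Nt.int h0
  have cg := continuous_jg Ns.smooth.continuous Ns.int h0
  have bf : ∀ τ, 2 < τ → ∀ x, ‖jf (Q τ) k x‖ ≤ 2 * E := fun τ hτ x => by
    have N := h.nice τ hτ
    have := jB_le_jE N.l1_le k
    exact (norm_jf_le N.smooth.continuous N.int h0 x).trans (by linarith)
  have bg : ∀ τ, 2 < τ → ∀ x, ‖jg (Q τ) k x‖ ≤ 2 * E := fun τ hτ x => by
    have N := h.nice τ hτ
    have := jB_le_jE N.l1_le k
    exact (norm_jg_le N.smooth.continuous N.int h0 x).trans (by linarith)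
  have bΦ : ∀ x, ‖jf (Q t) k x * jg (Q s) k x‖ ≤ (2 * E) * (2 * E) := fun x => by
    rw [norm_mul]
    exact mul_le_mul (bf t ht x) (bg s (ht.trans_le hs) x) (norm_nonneg _) (by positivity)
  obtain ⟨hL1, heq⟩ := h.integral_sub_mul ht hs (cf.mul cg) bΦ
  set G : ℝ → ℂ := fun τ => ∫ x, (kdvVel (Q τ) (S τ) x : ℂ) * (jf (Q t) k x * jg (Q s) k x) with hG
  replace hL1 : IntegrableOn G (Set.Ioc t s) := hL1
  replace heq : ∫ x, ((Q s x - Q t x : ℝ) : ℂ) * (jf (Q t) k x * jg (Q s) k x) =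
      ∫ τ in Set.Ioc t s, G τ := heq
  have hconst : IntegrableOn (fun _ : ℝ => 8 * Complex.I * (k : ℂ) ^ 3 * jw (Q t) k)
      (Set.Ioc t s) := integrableOn_const (by simp)
  have key : ∀ τ ∈ Set.Ioc t s, ‖G τ - 8 * Complex.I * k ^ 3 * jw (Q t) k‖ ≤ jA M k * a +
      (8 * |k| ^ 3 * ((2 * E) * (2 * E) * C) +
        2 * ((4 * ‖(k : ℂ)‖⁻¹ * E * E * C) * (2 * E)) * C) * (s - t) := fun τ hτ => by
    have h2τ : 2 < τ := ht.trans hτ.1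
    have N := h.nice τ h2τ
    have d1 : (∫ x, |Q t x - Q τ x|) ≤ C * (s - t) := by
      simp only [abs_sub_comm (Q t _)]
      exact (h.integral_abs_sub_le ht hτ.1.le).trans (mul_le_mul_of_nonneg_left (by linarith [hτ.2]) hC)
    have d2 : (∫ x, |Q s x - Q τ x|) ≤ C * (s - t) :=
      (h.integral_abs_sub_le h2τ hτ.2).trans (mul_le_mul_of_nonneg_left (by linarith [hτ.1]) hC)
    have i1 : Integrable fun x => (kdvVel (Q τ) (S τ) x : ℂ) * (jf (Q t) k x * jg (Q s) k x) :=
      integrable_mul_of_bdd N.integrable_vel (cf.mul cg) bΦ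
    have i2 : Integrable fun x => (kdvVel (Q τ) (S τ) x : ℂ) * (jf (Q τ) k x * jg (Q τ) k x) :=
      integrable_mul_of_bdd N.integrable_vel
      ((continuous_jf N.smooth.continuous N.int h0).mul
        (continuous_jg N.smooth.continuous N.int h0)) (norm_jp_le N.smooth.continuous N.int h0)
    have e1 := N.integral_vel h0
    have e2 : G τ - ∫ x, (kdvVel (Q τ) (S τ) x : ℂ) * (jf (Q τ) k x * jg (Q τ) k x) =
        ∫ x, (kdvVel (Q τ) (S τ) x : ℂ) * (jf (Q t) k x * jg (Q s) k x -
          jf (Q τ) k x * jg (Q τ) k x) := by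
      rw [hG]
      dsimp only
      rw [← integral_sub i1 i2]
      congr 1 with x
      ring
    have e3 : G τ - 8 * Complex.I * k ^ 3 * jw (Q t) k =
        3 * (∫ x, ((S τ x - Q τ x ^ 2 : ℝ) : ℂ) * jp' (Q τ) k x) +
        (8 * Complex.I * k ^ 3 * (jw (Q τ) k - jw (Q t) k) +
        ∫ x, (kdvVel (Q τ) (S τ) x : ℂ) * (jf (Q t) k x * jg (Q s) k x -
          jf (Q τ) k x * jg (Q τ) k x)) := by
      rw [← e2, e1]; ring
    have iE : Integrable fun x => S τ x - Q τ x ^ 2 := by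
      refine N.intS.sub ?_
      simp only [pow_two]
      exact N.int.mul_bdd (c := 1) N.smooth.continuous.aestronglyMeasurable
        (Eventually.of_forall N.bdd)
    have b1 := norm_integral_mul_le iE (norm_jp'_le' N.smooth.continuous N.int h0 N.l1_le) N.defect
    have b2 : ‖jw (Q τ) k - jw (Q t) k‖ ≤ (2 * E) * (2 * E) * (C * (s - t)) :=
      (norm_jw_sub_le Nt.smooth.continuous Nt.int N.smooth.continuous N.int h0 Nt.l1_le N.l1_le).trans
        (mul_le_mul_of_nonneg_left d1 (by positivity))
    have b3 := norm_integral_mul_le N.integrable_vel (fun x => jprod_sub_le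
      ((norm_jf_sub_le Nt.smooth.continuous Nt.int N.smooth.continuous N.int h0 x).trans
        (jsol_sub_le Nt.l1_le N.l1_le d1))
      ((norm_jg_sub_le Ns.smooth.continuous Ns.int N.smooth.continuous N.int h0 x).trans
        (jsol_sub_le Ns.l1_le N.l1_le d2)) (bg s (ht.trans_le hs) x) (bf τ h2τ x)) N.vel
    rw [e3]
    refine (norm_add_le _ _).trans ?_
    have n3 : ‖8 * Complex.I * (k : ℂ) ^ 3‖ = 8 * |k| ^ 3 := by simp
    have b4 : ‖(3 : ℂ) * (∫ x, ((S τ x - Q τ x ^ 2 : ℝ) : ℂ) * jp' (Q τ) k x)‖ ≤ jA M k * a := by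
      rw [norm_mul, jA, mul_assoc 3]
      refine mul_le_mul (by simp) b1 (norm_nonneg _) (by norm_num)
    have b5 : ‖8 * Complex.I * (k : ℂ) ^ 3 * (jw (Q τ) k - jw (Q t) k)‖ ≤
        8 * |k| ^ 3 * ((2 * E) * (2 * E) * (C * (s - t))) := by
      rw [norm_mul, n3]
      exact mul_le_mul_of_nonneg_left b2 (by positivity)
    refine (add_le_add b4 ((norm_add_le _ _).trans (add_le_add b5 b3))).trans (le_of_eq ?_)
    ring
  have e4 : jw (Q s) k - jw (Q t) k + 8 * Complex.I * k ^ 3 * (s - t) * jw (Q t) k =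
      -∫ τ in Set.Ioc t s, (G τ - 8 * Complex.I * k ^ 3 * jw (Q t) k) := by
    rw [jw_sub_jw Nt.smooth.continuous Nt.int Ns.smooth.continuous Ns.int h0,
      integral_sub hL1 hconst, ← heq, setIntegral_const]
    have : ∀ x, ((Q t x - Q s x : ℝ) : ℂ) * (jf (Q t) k x * jg (Q s) k x) =
        -(((Q s x - Q t x : ℝ) : ℂ) * (jf (Q t) k x * jg (Q s) k x)) := fun x => by
      push_cast; ring
    simp only [this, integral_neg, Measure.real, Real.volume_Ioc,
      ENNReal.toReal_ofReal (sub_nonneg.2 hs), Complex.real_smul]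
    push_cast
    ring
  rw [e4, norm_neg]
  refine (norm_setIntegral_le_of_norm_le_const (by simp) key).trans (le_of_eq ?_)
  simp only [Measure.real, Real.volume_Ioc, ENNReal.toReal_ofReal (sub_nonneg.2 hs)]
  ring

end

lemma dist_le_of_local_lipschitz {h : ℝ → ℂ} {t T A K r : ℝ} (htT : t ≤ T) (hr : 0 < r)
    (H : ∀ x y, t ≤ x → x ≤ y → y ≤ T → y - x ≤ r → ‖h y - h x‖ ≤ A * (y - x) + K * (y - x) ^ 2) :
    ‖h T - h t‖ ≤ A * (T - t) := by
  set d := T - t with hd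
  have hd0 : 0 ≤ d := sub_nonneg.2 htT
  have hn : ∀ n : ℕ, 0 < n → d / n ≤ r → ‖h T - h t‖ ≤ A * d + K * d ^ 2 / n := fun n hn hnr => by
    have hn' : (0 : ℝ) < n := by exact_mod_cast hn
    have := dist_le_range_sum_of_dist_le (f := fun i : ℕ => h (t + i * (d / n))) (n := n)
      (d := fun _ => A * (d / n) + K * (d / n) ^ 2) fun {i} hi => by
        have hi' : (i : ℝ) + 1 ≤ n := by exact_mod_cast hi
        have hdn : 0 ≤ d / n := by positivity
        have e : t + ((i + 1 : ℕ) : ℝ) * (d / n) - (t + i * (d / n)) = d / n := by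
          push_cast; ring
        have h2 : ((i : ℝ) + 1) * (d / n) ≤ d := by
          calc ((i : ℝ) + 1) * (d / n) ≤ n * (d / n) := by gcongr
            _ = d := by field_simp
        have := H (t + i * (d / n)) (t + ((i + 1 : ℕ) : ℝ) * (d / n)) (by
          have : 0 ≤ (i : ℝ) * (d / n) := by positivity
          linarith) (by linarith) (by push_cast; linarith) (by linarith)
        rw [e] at this
        rwa [dist_comm, dist_eq_norm]
    rw [dist_comm, dist_eq_norm, Finset.sum_const, Finset.card_range, nsmul_eq_mul] at this
    have e1 : t + (n : ℝ) * (d / n) = T := by field_simp; rw [hd]; ring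
    simp only [e1, Nat.cast_zero, zero_mul, add_zero] at this
    refine this.trans (le_of_eq ?_)
    field_simp
  have lim : Tendsto (fun n : ℕ => A * d + K * d ^ 2 / n) atTop (𝓝 (A * d)) := by
    simpa using tendsto_const_nhds.add (tendsto_const_div_atTop_nhds_zero_nat (K * d ^ 2))
  refine ge_of_tendsto lim ?_
  have l2 := (tendsto_const_div_atTop_nhds_zero_nat d).eventually_le_const hr
  filter_upwards [l2, eventually_gt_atTop 0] with n h1 h2 using hn n h2 h1

section
variable {M a C : ℝ} {k : ℝ}

lemma norm_jw_le {q : ℝ → ℝ} (hc : Continuous q) (hi : Integrable q) (h0 : k ≠ 0)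
    (hq : (∫ x, |q x|) ≤ M) : ‖jw q k‖ ≤ 2 * jE M k * M := by
  rw [jw_eq_integral hc hi h0, norm_neg]
  have e : ∀ y : ℝ, Complex.exp (2 * Complex.I * k * y) * (q y * jm q k y) =
      (q y : ℂ) * (Complex.exp (2 * Complex.I * k * y) * jm q k y) := fun y => by ring
  simp only [e]
  refine norm_integral_mul_le hi (fun y => ?_) hq
  have h1 : ‖Complex.exp (2 * Complex.I * k * y)‖ = 1 := by
    rw [Complex.norm_exp]; simp
  rw [norm_mul, h1, one_mul]
  exact (norm_jm_le hc hi (by simp) (by exact_mod_cast h0) y).trans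
    (by linarith [jB_le_jE hq k])

lemma NiceFlow.jw_evolution {Q S : ℝ → ℝ → ℝ} (h : NiceFlow M a C Q S) (h0 : k ≠ 0) {t T : ℝ}
    (ht : 2 < t) (hT : t ≤ T) :
    ‖Complex.exp (8 * Complex.I * k ^ 3 * T) * jw (Q T) k -
      Complex.exp (8 * Complex.I * k ^ 3 * t) * jw (Q t) k‖ ≤ jA M k * a * (T - t) := by
  obtain ⟨K, hK, hstep⟩ := h.step h0
  have hk : 0 < |k| := abs_pos.2 h0
  have hr : 0 < (8 * |k| ^ 3)⁻¹ := by positivity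
  refine dist_le_of_local_lipschitz
    (h := fun t => Complex.exp (8 * Complex.I * k ^ 3 * t) * jw (Q t) k)
    (K := K + (8 * |k| ^ 3) ^ 2 * (2 * jE M k * M)) hT hr fun x y hx hxy hy hd => ?_
  have h1 := hstep x y (ht.trans_le hx) hxy
  have Nx := h.nice x (ht.trans_le hx)
  have h2 := norm_jw_le Nx.smooth.continuous Nx.int h0 Nx.l1_le
  set z : ℂ := -(8 * Complex.I * k ^ 3 * (y - x)) with hz
  have nz : ‖z‖ = 8 * |k| ^ 3 * (y - x) := by
    rw [hz, norm_neg]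
    have : ‖(y : ℂ) - x‖ = y - x := by
      rw [← Complex.ofReal_sub, Complex.norm_real, Real.norm_eq_abs, abs_of_nonneg (by linarith)]
    simp [this]
  have nz1 : ‖z‖ ≤ 1 := by
    rw [nz]
    calc 8 * |k| ^ 3 * (y - x) ≤ 8 * |k| ^ 3 * (8 * |k| ^ 3)⁻¹ := by gcongr
      _ = 1 := mul_inv_cancel₀ (by positivity)
  have h3 := Complex.norm_exp_sub_one_sub_id_le nz1
  have e1 : ∀ s : ℝ, ‖Complex.exp (8 * Complex.I * k ^ 3 * s)‖ = 1 := fun s => by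
    have : 8 * Complex.I * (k : ℂ) ^ 3 * s = Complex.I * ((8 * k ^ 3 : ℝ) : ℂ) * s := by
      push_cast; ring
    rw [this, norm_cexp_real]
  have e2 : Complex.exp (8 * Complex.I * k ^ 3 * y) * jw (Q y) k -
      Complex.exp (8 * Complex.I * k ^ 3 * x) * jw (Q x) k =
      Complex.exp (8 * Complex.I * k ^ 3 * y) * ((jw (Q y) k - jw (Q x) k +
        8 * Complex.I * k ^ 3 * (y - x) * jw (Q x) k) - (Complex.exp z - 1 - z) * jw (Q x) k) := by
    have : Complex.exp (8 * Complex.I * k ^ 3 * x) =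
        Complex.exp (8 * Complex.I * k ^ 3 * y) * Complex.exp z := by
      rw [← Complex.exp_add]; congr 1; rw [hz]; ring
    rw [this, hz]; ring
  rw [e2, norm_mul, e1, one_mul]
  refine (norm_sub_le _ _).trans ?_
  rw [norm_mul]
  have h4 : ‖Complex.exp z - 1 - z‖ * ‖jw (Q x) k‖ ≤ ‖z‖ ^ 2 * (2 * jE M k * M) :=
    mul_le_mul h3 h2 (norm_nonneg _) (by positivity)
  rw [nz] at h4
  nlinarith

end

/-- Convolution of `g` with the kernel `ρ`. -/
noncomputable def mol (ρ g : ℝ → ℝ) (x : ℝ) : ℝ := ∫ y, ρ (x - y) * g y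

/-- Smooth compactly supported functions. -/
def Test (ρ : ℝ → ℝ) : Prop := ContDiff ℝ ((⊤ : ℕ∞) : WithTop ℕ∞) ρ ∧ HasCompactSupport ρ

section
variable {ρ g : ℝ → ℝ}

lemma Test.deriv (h : Test ρ) : Test (deriv ρ) := ⟨h.1.deriv', h.2.deriv⟩

lemma Test.continuous (h : Test ρ) : Continuous ρ := h.1.continuous

lemma Test.hasDerivAt (h : Test ρ) (x : ℝ) : HasDerivAt ρ (_root_.deriv ρ x) x :=
  (h.1.differentiable (by simp) x).hasDerivAt

lemma Test.integrable (h : Test ρ) : Integrable ρ := h.continuous.integrable_of_hasCompactSupport h.2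

lemma Test.bdd (h : Test ρ) : ∃ B, 0 ≤ B ∧ ∀ x, |ρ x| ≤ B := by
  obtain ⟨B, hB⟩ := h.continuous.bounded_above_of_compact_support h.2
  exact ⟨B, (norm_nonneg _).trans (hB 0), hB⟩

lemma Test.comp_sub (h : Test ρ) (x : ℝ) : Test fun y => ρ (x - y) :=
  ⟨h.1.comp (contDiff_const.sub contDiff_id),
    h.2.comp_homeomorph (Homeomorph.subLeft x)⟩

lemma Test.le_wt (h : Test ρ) : ∃ B, 0 ≤ B ∧ ∀ x, |ρ x| ≤ B * wt 1 x := by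
  obtain ⟨B, hB⟩ := (h.continuous.mul (by fun_prop : Continuous fun x : ℝ => 1 + x ^ 2)
    ).bounded_above_of_compact_support h.2.mul_right
  refine ⟨B, (norm_nonneg _).trans (hB 0), fun x => ?_⟩
  have hx : 0 < 1 + x ^ 2 := by positivity
  have := hB x
  rw [Pi.mul_apply, norm_mul, Real.norm_eq_abs, Real.norm_eq_abs, abs_of_pos hx] at this
  rw [wt, pow_one, ← div_eq_mul_inv, le_div_iff₀ hx]
  exact this

lemma Test.loc (h : Test ρ) : Loc ρ := by
  obtain ⟨B0, p0, h0⟩ := h.bdd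
  obtain ⟨B1, p1, h1⟩ := h.deriv.le_wt
  obtain ⟨B2, p2, h2⟩ := h.deriv.deriv.le_wt
  obtain ⟨B3, p3, h3⟩ := h.deriv.deriv.deriv.le_wt
  obtain ⟨B4, p4, h4⟩ := h.deriv.deriv.deriv.deriv.le_wt
  refine ⟨contDiff_infty.1 h.1 4, B0 + B1 + B2 + B3 + B4, fun x => ?_, fun x => ?_,
    fun x => ?_, fun x => ?_, fun x => ?_⟩
  · linarith [h0 x]
  all_goals
    have := wt_pos 1 x
    first
    | refine (h1 x).trans (mul_le_mul_of_nonneg_right (by linarith) this.le)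
    | refine (h2 x).trans (mul_le_mul_of_nonneg_right (by linarith) this.le)
    | refine (h3 x).trans (mul_le_mul_of_nonneg_right (by linarith) this.le)
    | refine (h4 x).trans (mul_le_mul_of_nonneg_right (by linarith) this.le)

lemma Test.integrable_mul (h : Test ρ) (hg : Integrable g) (x : ℝ) :
    Integrable fun y => ρ (x - y) * g y := by
  obtain ⟨B, -, hB⟩ := h.bdd
  exact hg.bdd_mul (c := B) (h.continuous.comp (by fun_prop)).aestronglyMeasurable
    (Eventually.of_forall fun y => hB _)

lemma Test.hasDerivAt_mol (h : Test ρ) (hg : Integrable g) (x : ℝ) :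
    HasDerivAt (mol ρ g) (mol (_root_.deriv ρ) g x) x := by
  obtain ⟨B, -, hB⟩ := h.deriv.bdd
  refine (hasDerivAt_integral_of_dominated_loc_of_deriv_le (bound := fun y => B * |g y|)
    (F := fun x y => ρ (x - y) * g y) (F' := fun x y => _root_.deriv ρ (x - y) * g y)
    (s := Set.univ) univ_mem
    (Eventually.of_forall fun x => (h.integrable_mul hg x).aestronglyMeasurable)
    (h.integrable_mul hg x) (h.deriv.integrable_mul hg x).aestronglyMeasurable
    (Eventually.of_forall fun y x _ => ?_) (hg.abs.const_mul B)
    (Eventually.of_forall fun y x _ => ?_)).2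
  · rw [norm_mul, Real.norm_eq_abs, Real.norm_eq_abs]
    exact mul_le_mul_of_nonneg_right (hB _) (abs_nonneg _)
  · exact ((h.hasDerivAt (x - y)).comp_sub_const x y).mul_const (g y)

lemma Test.deriv_mol (h : Test ρ) (hg : Integrable g) : _root_.deriv (mol ρ g) = mol (_root_.deriv ρ) g :=
  funext fun x => (h.hasDerivAt_mol hg x).deriv

lemma Test.contDiff_mol (h : Test ρ) (hg : Integrable g) (n : ℕ) : ContDiff ℝ n (mol ρ g) := by
  induction n generalizing ρ with
  | zero =>
    exact contDiff_zero.2 (continuous_iff_continuousAt.2 fun x => (h.hasDerivAt_mol hg x).continuousAt)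
  | succ n ih =>
    push_cast
    rw [contDiff_succ_iff_deriv]
    refine ⟨fun x => (h.hasDerivAt_mol hg x).differentiableAt, by simp, ?_⟩
    rw [h.deriv_mol hg]
    exact ih h.deriv

lemma Test.integrable_abs_prod (h : Test ρ) (hg : Integrable g) :
    Integrable (fun p : ℝ × ℝ => ρ (p.1 - p.2) * g p.2) (volume.prod volume) := by
  have := hg.convolution_integrand (ContinuousLinearMap.mul ℝ ℝ) h.integrable
  simpa [mul_comm] using this

lemma Test.integrable_mol (h : Test ρ) (hg : Integrable g) : Integrable (mol ρ g) :=
  (h.integrable_abs_prod hg).integral_prod_left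

lemma Test.integral_abs_mol_le (h : Test ρ) (hg : Integrable g) :
    (∫ x, |mol ρ g x|) ≤ (∫ x, |ρ x|) * ∫ x, |g x| := by
  have hF := (h.integrable_abs_prod hg).abs
  have h1 : (∫ x, |mol ρ g x|) ≤ ∫ x, ∫ y, |ρ (x - y) * g y| :=
    integral_mono (h.integrable_mol hg).abs hF.integral_prod_left
      fun x => abs_integral_le_integral_abs
  refine h1.trans (le_of_eq ?_)
  rw [integral_integral_swap (f := fun x y => |ρ (x - y) * g y|) hF]
  simp only [abs_mul, integral_mul_const]
  simp only [integral_sub_right_eq_self (fun x => |ρ x|), integral_const_mul]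

lemma Test.abs_mol_le (h : Test ρ) (hg : Integrable g) {B : ℝ} (hB : ∀ x, |g x| ≤ B) (x : ℝ) :
    |mol ρ g x| ≤ (∫ x, |ρ x|) * B := by
  rw [← integral_sub_left_eq_self (fun y => |ρ y|) volume x, ← integral_mul_const]
  refine abs_integral_le_integral_abs.trans (integral_mono (h.integrable_mul hg x).abs
    ((h.comp_sub x).integrable.abs.mul_const B) fun y => ?_)
  dsimp only
  rw [abs_mul]
  exact mul_le_mul_of_nonneg_left (hB y) (abs_nonneg _)

end

/-- A mollifying kernel of width `η`. -/
structure Moll (η : ℝ) (ρ : ℝ → ℝ) : Prop where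
  test : Test ρ
  nonneg : ∀ x, 0 ≤ ρ x
  integral : (∫ x, ρ x) = 1
  supp : ∀ x, ρ x ≠ 0 → |x| ≤ η

lemma exists_moll {η : ℝ} (hη : 0 < η) : ∃ ρ, Moll η ρ := by
  let b : ContDiffBump (0 : ℝ) := ⟨η / 2, η, by positivity, by linarith⟩
  refine ⟨b.normed volume, ⟨b.contDiff_normed, b.hasCompactSupport_normed⟩, b.nonneg_normed,
    b.integral_normed, fun x hx => ?_⟩
  have : x ∈ Function.support (b.normed volume) := hx
  rw [b.support_normed_eq] at this
  simpa using (Metric.mem_ball.1 this).le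

section
variable {M r η : ℝ} {v ρ g : ℝ → ℝ}

lemma Slice.abs_sub_le (h : Slice M v) (hr : 0 < r) {x y : ℝ} (hxy : |x - y| ≤ 2 * r ^ 2) :
    |v x - v y| ≤ 2 * r := by
  wlog hle : y ≤ x generalizing x y
  · rw [abs_sub_comm]
    exact this (by rwa [abs_sub_comm]) (le_of_not_ge hle)
  rw [abs_of_nonneg (sub_nonneg.2 hle)] at hxy
  have hd : v x - v y = ∫ z in y..x, deriv v z :=
    (intervalIntegral.integral_eq_sub_of_hasDerivAt (fun z _ => h.hasDerivAt z)
      (h.continuous_deriv.intervalIntegrable _ _)).symm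
  have hi : Integrable fun z => (deriv v z) ^ 2 / (2 * r⁻¹) := h.int_deriv_sq.div_const _
  rw [hd, intervalIntegral.integral_of_le hle]
  have hf : IntegrableOn (fun _ : ℝ => r⁻¹ / 2) (Set.Ioc y x) := integrableOn_const (by simp)
  refine abs_integral_le_integral_abs.trans ?_
  have h1 : (∫ z in Set.Ioc y x, |deriv v z|) ≤
      ∫ z in Set.Ioc y x, (r⁻¹ / 2 + (deriv v z) ^ 2 / (2 * r⁻¹)) := by
    refine integral_mono (((h.continuous_deriv.abs.integrableOn_Icc).mono_set
      Set.Ioc_subset_Icc_self)) (hf.add hi.integrableOn) fun z => ?_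
    dsimp only
    rw [← sq_abs]
    have hr' : 0 < r⁻¹ := by positivity
    rw [div_add_div _ _ (by norm_num) (by positivity), le_div_iff₀ (by positivity)]
    nlinarith [sq_nonneg (|deriv v z| - r⁻¹)]
  refine h1.trans ?_
  have hde : (∫ z, (deriv v z) ^ 2) ≤ 1 := (integral_mono h.int_deriv_sq
    (h.int_sq.add h.int_deriv_sq) fun x => by
      simp only [Pi.add_apply]; nlinarith [sq_nonneg (v x)]).trans h.h1_le
  rw [integral_add hf hi.integrableOn, setIntegral_const, integral_div]
  have h2 := (setIntegral_le_integral (s := Set.Ioc y x) h.int_deriv_sq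
    (Eventually.of_forall fun z => sq_nonneg _)).trans hde
  have h3 : (∫ z in Set.Ioc y x, (deriv v z) ^ 2) / (2 * r⁻¹) ≤ r / 2 := by
    rw [div_le_iff₀ (by positivity)]
    refine h2.trans (le_of_eq ?_)
    field_simp
  simp only [Measure.real, Real.volume_Ioc, ENNReal.toReal_ofReal (sub_nonneg.2 hle), smul_eq_mul]
  have h4 : (x - y) * (r⁻¹ / 2) ≤ r := by
    calc (x - y) * (r⁻¹ / 2) ≤ (2 * r ^ 2) * (r⁻¹ / 2) := by gcongr
      _ = r := by field_simp
  linarith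

lemma Moll.integral_abs (h : Moll η ρ) : (∫ x, |ρ x|) = 1 := by
  simpa only [abs_of_nonneg (h.nonneg _)] using h.integral

lemma Moll.integral_comp (h : Moll η ρ) (x : ℝ) : (∫ y, ρ (x - y)) = 1 := by
  rw [integral_sub_left_eq_self (fun y => ρ y) volume x, h.integral]

/-- Averages against a mollifier are close to a value that the function is close to. -/
lemma Moll.abs_mol_sub_le (h : Moll η ρ) (hg : Integrable g) {x c d : ℝ}
    (hd : ∀ y, |x - y| ≤ η → |g y - c| ≤ d) : |mol ρ g x - c| ≤ d := by
  have i1 := h.test.integrable_mul hg x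
  have i2 := (h.test.comp_sub x).integrable
  have e : mol ρ g x - c = ∫ y, ρ (x - y) * (g y - c) := by
    simp only [mul_sub]
    rw [integral_sub i1 (i2.mul_const c), integral_mul_const, h.integral_comp, one_mul, mol]
  rw [e]
  have : (∫ y, ρ (x - y) * d) = d := by rw [integral_mul_const, h.integral_comp, one_mul]
  rw [← this]
  refine abs_integral_le_integral (i2.mul_const d) fun y => ?_
  rw [abs_mul, abs_of_nonneg (h.nonneg _)]
  by_cases hy : ρ (x - y) = 0
  · simp [hy]
  · exact mul_le_mul_of_nonneg_left (hd y (h.supp _ hy)) (h.nonneg _)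

lemma Moll.defect (h : Moll η ρ) (hg : Integrable g) (hg2 : Integrable fun y => g y ^ 2) {d : ℝ}
    (hd : ∀ x y, |x - y| ≤ 2 * η → |g x - g y| ≤ d) :
    (∫ x, |mol ρ (fun y => g y ^ 2) x - mol ρ g x ^ 2|) ≤ d * ∫ x, |g x| := by
  have hd0 : 0 ≤ η → 0 ≤ d := fun hη => (abs_nonneg _).trans (hd 0 0 (by simpa using hη))
  have ia : Integrable (mol ρ fun y => |g y|) := h.test.integrable_mol hg.abs
  have key : ∀ x, |mol ρ (fun y => g y ^ 2) x - mol ρ g x ^ 2| ≤ d * mol ρ (fun y => |g y|) x :=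
    fun x => by
      have i1 := h.test.integrable_mul hg x
      have i2 := h.test.integrable_mul hg2 x
      have e : mol ρ (fun y => g y ^ 2) x - mol ρ g x ^ 2 =
          ∫ y, (ρ (x - y) * g y ^ 2 - ρ (x - y) * g y * mol ρ g x) := by
        rw [integral_sub i2 (i1.mul_const _), integral_mul_const, mol, pow_two, mol]
      have e3 : d * mol ρ (fun y => |g y|) x = ∫ y, d * (ρ (x - y) * |g y|) := by
        rw [integral_const_mul, mol]
      rw [e, e3]
      refine abs_integral_le_integral ((h.test.integrable_mul hg.abs x).const_mul d) fun y => ?_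
      have e2 : ρ (x - y) * g y ^ 2 - ρ (x - y) * g y * mol ρ g x =
          ρ (x - y) * g y * (g y - mol ρ g x) := by ring
      rw [e2, abs_mul, abs_mul, abs_of_nonneg (h.nonneg _)]
      by_cases hy : ρ (x - y) = 0
      · simp [hy]
      have hxy := h.supp _ hy
      have h3 : |g y - mol ρ g x| ≤ d := by
        rw [abs_sub_comm]
        refine h.abs_mol_sub_le hg fun z hz => hd _ _ ?_
        calc |z - y| = |(x - y) - (x - z)| := by congr 1; ring
          _ ≤ |x - y| + |x - z| := abs_sub _ _
          _ ≤ 2 * η := by linarith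
      have := mul_le_mul_of_nonneg_left h3 (mul_nonneg (h.nonneg (x - y)) (abs_nonneg (g y)))
      linarith
  refine (integral_mono_of_nonneg (Eventually.of_forall fun x => abs_nonneg _) (ia.const_mul d)
    (Eventually.of_forall key)).trans ?_
  rw [integral_const_mul]
  by_cases hη : 0 ≤ η
  · refine mul_le_mul_of_nonneg_left ?_ (hd0 hη)
    refine (integral_mono ia ia.abs fun x => le_abs_self _).trans
      ((h.test.integral_abs_mol_le hg.abs).trans (le_of_eq ?_))
    rw [h.integral_abs, one_mul]
    simp
  · have : ∀ x, ρ x = 0 := fun x => by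
      by_contra hx
      exact hη ((abs_nonneg _).trans (h.supp x hx))
    have h2 := h.integral
    simp [this] at h2

lemma Moll.integral_abs_sub_le (h : Moll η ρ) (hη : η ≤ 1) (hg : Integrable g) {d N : ℝ}
    (hN : 0 ≤ N) (hd : ∀ x y, |x - y| ≤ η → |g x - g y| ≤ d) :
    (∫ x, |g x - mol ρ g x|) ≤ 2 * (N + 1) * d + 2 * ∫ x in {x | N < |x|}, |g x| := by
  have hS : MeasurableSet {x : ℝ | N < |x|} := measurableSet_lt measurable_const (by fun_prop)
  have iQ := h.test.integrable_mol hg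
  set g' : ℝ → ℝ := {x : ℝ | N < |x|}.indicator fun x => |g x| with hg'
  have ig' : Integrable g' := hg.abs.indicator hS
  have iQ' := h.test.integrable_mol ig'
  set χ : ℝ → ℝ := (Set.Icc (-(N + 1)) (N + 1)).indicator fun _ => d with hχ
  have iχ : Integrable χ := (integrableOn_const (by simp)).integrable_indicator measurableSet_Icc
  have pos : ∀ x, 0 ≤ g' x := fun x => Set.indicator_nonneg (fun _ _ => abs_nonneg _) x
  have posQ : ∀ x, 0 ≤ mol ρ g' x := fun x => integral_nonneg fun y => mul_nonneg (h.nonneg _) (pos y)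
  have key : ∀ x, |g x - mol ρ g x| ≤ χ x + (g' x + mol ρ g' x) := fun x => by
    by_cases hx : x ∈ Set.Icc (-(N + 1)) (N + 1)
    · have h1 : |g x - mol ρ g x| ≤ d := by
        rw [abs_sub_comm]
        exact h.abs_mol_sub_le hg fun y hy => hd _ _ (by rwa [abs_sub_comm])
      rw [hχ, Set.indicator_of_mem hx]
      linarith [pos x, posQ x]
    · have hx' : N + 1 < |x| := by
        by_contra hc
        exact hx (abs_le.1 (not_lt.1 hc))
      rw [hχ, Set.indicator_of_notMem hx, zero_add]
      refine (abs_sub _ _).trans (add_le_add (le_of_eq ?_) ?_)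
      · rw [hg', Set.indicator_of_mem]
        show N < |x|
        linarith
      · refine abs_integral_le_integral (h.test.integrable_mul ig' x) fun y => ?_
        rw [abs_mul, abs_of_nonneg (h.nonneg _)]
        by_cases hy : ρ (x - y) = 0
        · simp [hy]
        refine mul_le_mul_of_nonneg_left (le_of_eq ?_) (h.nonneg _)
        rw [hg', Set.indicator_of_mem]
        have h1 := h.supp _ hy
        have h2 : |x| ≤ |x - y| + |y| := by
          simpa using abs_add_le (x - y) y
        show N < |y|
        linarith
  refine (integral_mono (hg.sub iQ).abs (iχ.add (ig'.add iQ')) key).trans ?_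
  rw [integral_add' iχ (ig'.add iQ'), integral_add' ig' iQ']
  have e1 : ∫ x, χ x = 2 * (N + 1) * d := by
    rw [hχ, integral_indicator measurableSet_Icc, setIntegral_const]
    simp only [Measure.real, Real.volume_Icc, smul_eq_mul]
    rw [ENNReal.toReal_ofReal (by linarith)]
    ring
  have e2 : ∫ x, g' x = ∫ x in {x | N < |x|}, |g x| := integral_indicator hS
  have e3 : (∫ x, mol ρ g' x) ≤ ∫ x, g' x := by
    have := h.test.integral_abs_mol_le ig'
    simp only [abs_of_nonneg (posQ _), abs_of_nonneg (pos _)] at this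
    rwa [h.integral_abs, one_mul] at this
  rw [e1]
  linarith

lemma tendsto_integral_tail (hg : Integrable g) :
    Tendsto (fun N : ℕ => ∫ x in {x : ℝ | (N : ℝ) < |x|}, |g x|) atTop (𝓝 0) := by
  have := tendsto_setIntegral_of_antitone (μ := volume) (f := fun x => |g x|)
    (s := fun N : ℕ => {x : ℝ | (N : ℝ) < |x|})
    (fun N => measurableSet_lt measurable_const (by fun_prop))
    (fun a b hab x (hx : (b : ℝ) < |x|) => lt_of_le_of_lt (Nat.cast_le.2 hab) hx)
    ⟨0, hg.abs.integrableOn⟩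
  have e : (⋂ N : ℕ, {x : ℝ | (N : ℝ) < |x|}) = ∅ := by
    ext x
    simp only [Set.mem_iInter, Set.mem_ofPred_eq, Set.mem_empty_iff_false, iff_false, not_forall,
      not_lt]
    exact exists_nat_ge |x|
  rw [e] at this
  simpa using this

end

section
variable {M r η : ℝ} {v ρ : ℝ → ℝ}

lemma Slice.abs_sub_le_third (h : Slice M v) (hr : 0 < r) {x y : ℝ} (hxy : |x - y| ≤ 2 * r ^ 2) :
    |v x / 3 - v y / 3| ≤ r := by
  have := h.abs_sub_le hr hxy
  rw [← sub_div, abs_div, abs_of_pos (by norm_num : (0 : ℝ) < 3)]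
  linarith

lemma Slice.integral_abs_third_le (h : Slice M v) : (∫ x, |v x / 3|) ≤ M := by
  have e : ∀ x, |v x / 3| = |v x| / 3 := fun x => by
    rw [abs_div, abs_of_pos (by norm_num : (0 : ℝ) < 3)]
  simp only [e, integral_div]
  linarith [h.l1_le, h.M_nonneg]

lemma Slice.int_third (h : Slice M v) : Integrable fun x => v x / 3 := h.int.div_const 3

lemma Slice.int_third_sq (h : Slice M v) : Integrable fun x => (v x / 3) ^ 2 := by
  simp only [div_pow]; exact h.int_sq.div_const _

lemma Slice.integral_third_sq_le (h : Slice M v) : (∫ x, |(v x / 3) ^ 2|) ≤ 1 := by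
  have e : ∀ x, |(v x / 3) ^ 2| = (v x) ^ 2 / 9 := fun x => by rw [abs_of_nonneg (sq_nonneg _)]; ring
  simp only [e, integral_div]
  linarith [h.integral_sq_le]

lemma Slice.nicePot (h : Slice M v) (hρ : Moll (r ^ 2) ρ) (hr : 0 < r) :
    NicePot M (r * M) ((∫ x, |deriv (deriv (deriv ρ)) x|) * M + 3 * ∫ x, |deriv ρ x|)
      (mol ρ fun x => v x / 3) (mol ρ fun x => (v x / 3) ^ 2) := by
  have t := hρ.test
  have i1 := h.int_third
  have i2 := h.int_third_sq
  have e1 := t.deriv_mol i1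
  have e2 := t.deriv.deriv_mol i1
  have e3 := t.deriv.deriv.deriv_mol i1
  have e4 := t.deriv_mol i2
  constructor
  · exact t.contDiff_mol i1 3
  · exact t.contDiff_mol i2 1
  · exact t.integrable_mol i1
  · rw [e1]; exact t.deriv.integrable_mol i1
  · rw [e1, e2]; exact t.deriv.deriv.integrable_mol i1
  · rw [e1, e2, e3]; exact t.deriv.deriv.deriv.integrable_mol i1
  · exact t.integrable_mol i2
  · rw [e4]; exact t.deriv.integrable_mol i2
  · intro x
    have := t.abs_mol_le i1 (B := 1) (fun y => ?_) x
    · rwa [hρ.integral_abs, one_mul] at this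
    · rw [abs_div, abs_of_pos (by norm_num : (0 : ℝ) < 3)]
      linarith [h.abs_le_one y]
  · refine (t.integral_abs_mol_le i1).trans ?_
    rw [hρ.integral_abs, one_mul]
    exact h.integral_abs_third_le
  · refine (hρ.defect i1 i2 fun x y hxy => h.abs_sub_le_third hr hxy).trans ?_
    exact mul_le_mul_of_nonneg_left h.integral_abs_third_le hr.le
  · have j1 := t.deriv.deriv.deriv.integrable_mol i1
    have j2 := t.deriv.integrable_mol i2
    have b1 := (t.deriv.deriv.deriv.integral_abs_mol_le i1).trans (mul_le_mul_of_nonneg_left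
      h.integral_abs_third_le (integral_nonneg fun _ => abs_nonneg _))
    have b2 := (t.deriv.integral_abs_mol_le i2).trans (mul_le_mul_of_nonneg_left
      h.integral_third_sq_le (integral_nonneg fun _ => abs_nonneg _))
    rw [mul_one] at b2
    unfold kdvVel
    rw [e1, e2, e3, e4]
    refine (integral_mono_of_nonneg (Eventually.of_forall fun x => abs_nonneg _)
      (j1.abs.add (j2.abs.const_mul 3)) (Eventually.of_forall fun x => ?_)).trans ?_
    · refine (abs_sub _ _).trans (le_of_eq ?_)
      simp [abs_mul]
    · rw [integral_add' j1.abs (j2.abs.const_mul 3), integral_const_mul]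
      linarith

end

section
variable {M r : ℝ} {u : ℝ → ℝ → ℝ} {ρ : ℝ → ℝ}

lemma Sol.hasDerivAt_mol (h : Sol M u) (hρ : Test ρ) (x : ℝ) {t : ℝ} (ht : 2 < t) :
    HasDerivAt (fun s => mol ρ (fun y => u s y / 3) x)
      (kdvVel (mol ρ fun y => u t y / 3) (mol ρ fun y => (u t y / 3) ^ 2) x) t := by
  have hs := h.slice t
  have c := hρ.comp_sub x
  have d1 : ∀ f : ℝ → ℝ, deriv (fun y => f (x - y)) = fun y => -deriv f (x - y) := fun f =>
    funext fun y => by simp [deriv_comp_const_sub]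
  have := (h.flow_fixed.lin _ c.loc t ht).div_const 3
  simp only [div_one, ← integral_div, one_mul] at this
  have e : ∀ s, (∫ y, ρ (x - y) * u s y / 3) = mol ρ (fun y => u s y / 3) x := fun s => by
    simp only [mol, mul_div_assoc]
  simp only [e] at this
  refine this.congr_deriv ?_
  have e1 := hρ.deriv_mol hs.int_third
  have e2 := hρ.deriv.deriv_mol hs.int_third
  have e3 := hρ.deriv.deriv.deriv_mol hs.int_third
  have e4 := hρ.deriv_mol hs.int_third_sq
  unfold kdvVel
  rw [e1, e2, e3, e4, virLin]
  have dd : deriv (deriv (deriv fun y => ρ (x - y))) = fun y => -deriv (deriv (deriv ρ)) (x - y) := by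
    rw [d1, show (deriv fun y => -deriv ρ (x - y)) = fun y => deriv (deriv ρ) (x - y) from ?_, d1]
    ext y
    rw [deriv.fun_neg, d1]; simp
  rw [dd, d1]
  have g1 : mol (deriv (deriv (deriv ρ))) (fun y => u t y / 3) x =
      (∫ y, deriv (deriv (deriv ρ)) (x - y) * u t y) / 3 := by
    simp only [mol, ← mul_div_assoc, integral_div]
  have g2 : mol (deriv ρ) (fun y => (u t y / 3) ^ 2) x =
      (∫ y, deriv ρ (x - y) * (u t y) ^ 2) / 9 := by
    rw [mol, ← integral_div]; congr 1 with y; ring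
  rw [g1, g2]
  simp only [div_one, neg_mul, integral_neg]
  ring

lemma Sol.niceFlow (h : Sol M u) (hρ : Moll (r ^ 2) ρ) (hr : 0 < r) :
    NiceFlow M (r * M) ((∫ x, |deriv (deriv (deriv ρ)) x|) * M + 3 * ∫ x, |deriv ρ x|)
      (fun t => mol ρ fun x => u t x / 3) (fun t => mol ρ fun x => (u t x / 3) ^ 2) where
  nice t _ := (h.slice t).nicePot hρ hr
  deriv t ht x := h.hasDerivAt_mol hρ.test x ht
  cont x t ht := by
    refine ContinuousAt.continuousWithinAt ?_
    have c1 := (h.hasDerivAt_mol hρ.test.deriv.deriv.deriv x ht).continuousAt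
    have c2 := ((h.flow_fixed.mass _ (hρ.test.deriv.comp_sub x).loc t ht).const_mul (2 / 9)).continuousAt
    have := c1.neg.sub (continuousAt_const.mul c2 (x := t) (f := fun _ => (3 : ℝ)))
    refine this.congr (Eventually.of_forall fun s => ?_)
    have hs := h.slice s
    simp only [kdvVel, hρ.test.deriv_mol hs.int_third, hρ.test.deriv.deriv_mol hs.int_third,
      hρ.test.deriv.deriv.deriv_mol hs.int_third, hρ.test.deriv_mol hs.int_third_sq, Pi.neg_apply,
      Pi.sub_apply, Pi.mul_apply, div_one, ← mul_assoc]
    have g : mol (deriv ρ) (fun y => (u s y / 3) ^ 2) x =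
        (∫ y, deriv ρ (x - y) * (u s y) ^ 2) / 9 := by
      rw [mol, ← integral_div]; congr 1 with y; ring
    rw [g]
    ring

end

section
variable {M r : ℝ} {v : ℝ → ℝ} {u : ℝ → ℝ → ℝ} {ρ : ℝ → ℝ}

lemma Slice.eventually_integral_abs_sub_mol_le (h : Slice M v) {e : ℝ} (he : 0 < e) :
    ∀ᶠ r in 𝓝[>] (0 : ℝ), ∀ ρ, Moll (r ^ 2) ρ →
      (∫ x, |v x / 3 - mol ρ (fun y => v y / 3) x|) ≤ e := by
  obtain ⟨N, hN⟩ := ((tendsto_integral_tail h.int_third).eventually_lt_const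
    (by positivity : 0 < e / 4)).exists
  have hr : ∀ᶠ r in 𝓝[>] (0 : ℝ), 2 * ((N : ℝ) + 1) * r < e / 2 := by
    have : Tendsto (fun r : ℝ => 2 * ((N : ℝ) + 1) * r) (𝓝 0) (𝓝 0) := by
      simpa using (tendsto_id (x := 𝓝 (0 : ℝ))).const_mul (2 * ((N : ℝ) + 1))
    exact (this.mono_left nhdsWithin_le_nhds).eventually_lt_const (by positivity)
  have hr1 : ∀ᶠ r in 𝓝[>] (0 : ℝ), r < 1 :=
    nhdsWithin_le_nhds (eventually_lt_nhds one_pos)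
  filter_upwards [hr, hr1, self_mem_nhdsWithin] with r h1 h2 (h3 : 0 < r) ρ hρ
  have := hρ.integral_abs_sub_le (by nlinarith) h.int_third N.cast_nonneg
    (fun x y hxy => h.abs_sub_le_third h3 (hxy.trans (by nlinarith [sq_nonneg r])))
  linarith

/-- The Wronskian of the Jost solutions evolves linearly along the flow. -/
lemma Sol.jw_evolution (h : Sol M u) {k : ℝ} (h0 : k ≠ 0) {t T : ℝ} (ht : 2 < t) (hT : t ≤ T) :
    Complex.exp (8 * Complex.I * k ^ 3 * T) * jw (fun x => u T x / 3) k =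
      Complex.exp (8 * Complex.I * k ^ 3 * t) * jw (fun x => u t x / 3) k := by
  have unit : ∀ s : ℝ, ‖Complex.exp (8 * Complex.I * k ^ 3 * s)‖ = 1 := fun s => by
    rw [show (8 * Complex.I * k ^ 3 * s : ℂ) = ((8 * k ^ 3 * s : ℝ) : ℂ) * Complex.I by
      push_cast; ring, Complex.norm_exp_ofReal_mul_I]
  set E : ℝ := (2 * jE M k) * (2 * jE M k) with hE
  have hE0 : 0 ≤ E := mul_self_nonneg _
  set D : ℂ := Complex.exp (8 * Complex.I * k ^ 3 * T) * jw (fun x => u T x / 3) k -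
    Complex.exp (8 * Complex.I * k ^ 3 * t) * jw (fun x => u t x / 3) k with hD
  have key : ∀ e > 0, ‖D‖ ≤ E * e + E * e + e := by
    intro e he
    have hr : ∀ᶠ r in 𝓝[>] (0 : ℝ), jA M k * (r * M) * (T - t) < e := by
      have : Tendsto (fun r : ℝ => jA M k * (r * M) * (T - t)) (𝓝 0) (𝓝 0) := by
        have : Continuous fun r : ℝ => jA M k * (r * M) * (T - t) := by fun_prop
        simpa using this.tendsto 0
      exact (this.mono_left nhdsWithin_le_nhds).eventually_lt_const he
    obtain ⟨r, h1, h2, h3, h4 : 0 < r⟩ :=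
      (((h.slice t).eventually_integral_abs_sub_mol_le he).and
        (((h.slice T).eventually_integral_abs_sub_mol_le he).and
          (hr.and self_mem_nhdsWithin))).exists
    obtain ⟨ρ, hρ⟩ := exists_moll (by positivity : 0 < r ^ 2)
    have b1 := (h.niceFlow hρ h4).jw_evolution h0 ht hT
    have b2 : ∀ s, (∫ x, |u s x / 3 - mol ρ (fun y => u s y / 3) x|) ≤ e →
        ‖Complex.exp (8 * Complex.I * k ^ 3 * s) * jw (mol ρ fun y => u s y / 3) k -
          Complex.exp (8 * Complex.I * k ^ 3 * s) * jw (fun x => u s x / 3) k‖ ≤ E * e := by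
      intro s hs
      have hS := h.slice s
      have n := hS.nicePot hρ h4
      rw [← mul_sub, norm_mul, unit, one_mul]
      exact (norm_jw_sub_le (hS.continuous.div_const 3) hS.int_third n.smooth.continuous n.int h0
        hS.integral_abs_third_le n.l1_le).trans (mul_le_mul_of_nonneg_left hs hE0)
    have c1 := b2 t (h1 ρ hρ)
    have c2 := b2 T (h2 ρ hρ)
    refine (norm_sub_le_norm_sub_add_norm_sub _ (Complex.exp (8 * Complex.I * k ^ 3 * T) *
      jw (mol ρ fun y => u T y / 3) k) _).trans ?_
    rw [norm_sub_rev]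
    have := norm_sub_le_norm_sub_add_norm_sub (Complex.exp (8 * Complex.I * k ^ 3 * T) *
      jw (mol ρ fun y => u T y / 3) k) (Complex.exp (8 * Complex.I * k ^ 3 * t) *
      jw (mol ρ fun y => u t y / 3) k) (Complex.exp (8 * Complex.I * k ^ 3 * t) *
      jw (fun x => u t x / 3) k)
    linarith
  have : ‖D‖ ≤ 0 := by
    have hc : Tendsto (fun e : ℝ => E * e + E * e + e) (𝓝[>] 0) (𝓝 0) := by
      have : Continuous fun e : ℝ => E * e + E * e + e := by fun_prop
      simpa using (this.tendsto 0).mono_left nhdsWithin_le_nhds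
    exact ge_of_tendsto hc (by filter_upwards [self_mem_nhdsWithin] with e he using key e he)
  exact sub_eq_zero.1 (norm_le_zero_iff.1 this)

end

/-- Holomorphy of integrals depending on a parameter. -/
lemma differentiableOn_integral_of_dominated {μ : Measure ℝ} {U : Set ℂ} (hU : IsOpen U)
    {F : ℂ → ℝ → ℂ} {G : ℝ → ℝ} (hm : ∀ k ∈ U, AEStronglyMeasurable (F k) μ)
    (hG : Integrable G μ) (hb : ∀ᵐ y ∂μ, ∀ k ∈ U, ‖F k y‖ ≤ G y)
    (hd : ∀ᵐ y ∂μ, DifferentiableOn ℂ (fun k => F k y) U) :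
    DifferentiableOn ℂ (fun k => ∫ y, F k y ∂μ) U := by
  intro k hk
  obtain ⟨R, hR, hball⟩ := Metric.isOpen_iff.1 hU k hk
  have hsub : ∀ z ∈ Metric.ball k (R / 2), Metric.closedBall z (R / 4) ⊆ U := fun z hz w hw => by
    refine hball ?_
    rw [Metric.mem_ball] at hz ⊢
    rw [Metric.mem_closedBall] at hw
    linarith [dist_triangle w z k]
  have hmem : Metric.ball k (R / 2) ⊆ U := fun z hz =>
    hsub z hz (Metric.mem_closedBall_self (by positivity))
  have hk2 : k ∈ Metric.ball k (R / 2) := Metric.mem_ball_self (by positivity)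
  have hda : ∀ᵐ y ∂μ, ∀ z ∈ Metric.ball k (R / 2),
      HasDerivAt (fun k => F k y) (deriv (fun k => F k y) z) z := by
    filter_upwards [hd] with y hy z hz
    exact (hy.differentiableAt (hU.mem_nhds (hmem hz))).hasDerivAt
  refine (hasDerivAt_integral_of_dominated_loc_of_deriv_le (F' := fun z y => deriv (fun k => F k y) z)
    (bound := fun y => G y / (R / 4)) (Metric.ball_mem_nhds k (by positivity : 0 < R / 2))
    (Filter.mem_of_superset (hU.mem_nhds hk) fun z hz => hm z hz)
    (hG.mono' (hm k hk) (hb.mono fun y hy => hy k hk)) ?_ ?_ (hG.div_const _) hda).2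
    |>.differentiableAt.differentiableWithinAt
  · have hR4 : 0 < R / 4 := by positivity
    let ε : ℕ → ℂ := fun n => ((R / 4 / ((n : ℝ) + 1) : ℝ) : ℂ)
    have hε0 : ∀ n, ε n ≠ 0 := fun n => by
      have : (R / 4 / ((n : ℝ) + 1)) ≠ 0 := by positivity
      exact Complex.ofReal_ne_zero.2 this
    have hεt : Tendsto ε atTop (𝓝[≠] 0) := by
      rw [tendsto_nhdsWithin_iff]
      refine ⟨?_, Eventually.of_forall hε0⟩
      have : Tendsto (fun n : ℕ => R / 4 / ((n : ℝ) + 1)) atTop (𝓝 0) := by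
        simpa [div_eq_mul_inv] using (tendsto_one_div_add_atTop_nhds_zero_nat (𝕜 := ℝ)).const_mul (R / 4)
      have := (Complex.continuous_ofReal.tendsto 0).comp this
      rwa [Complex.ofReal_zero] at this
    have hεU : ∀ n, k + ε n ∈ U := fun n => hsub k hk2 (by
      rw [Metric.mem_closedBall, dist_eq_norm, add_sub_cancel_left, Complex.norm_real,
        Real.norm_of_nonneg (by positivity)]
      exact div_le_self hR4.le (by linarith [(Nat.cast_nonneg n : (0 : ℝ) ≤ n)]))
    refine aestronglyMeasurable_of_tendsto_ae (u := atTop)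
      (f := fun (n : ℕ) y => (ε n)⁻¹ • (F (k + ε n) y - F k y)) (fun n => ?_) ?_
    · exact ((hm _ (hεU n)).sub (hm k hk)).const_smul (ε n)⁻¹
    · filter_upwards [hda] with y hy
      exact (hasDerivAt_iff_tendsto_slope_zero.1 (hy k hk2)).comp hεt
  · filter_upwards [hb, hd] with y hy hdy z hz
    refine Complex.norm_deriv_le_of_forall_mem_sphere_norm_le (by positivity) ?_
      fun w hw => hy w (hsub z hz (Metric.sphere_subset_closedBall hw))
    refine (hdy.mono ?_).diffContOnCl
    rw [closure_ball _ (by positivity)]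
    exact hsub z hz

/-- The closed upper half plane outside of a disk. -/
def upOut (r : ℝ) : Set ℂ := {k | 0 ≤ k.im ∧ r < ‖k‖}

/-- The open upper half plane outside of a disk. -/
def upOut' (r : ℝ) : Set ℂ := {k | 0 < k.im ∧ r < ‖k‖}

lemma isOpen_upOut' (r : ℝ) : IsOpen (upOut' r) :=
  (isOpen_lt continuous_const Complex.continuous_im).inter (isOpen_lt continuous_const continuous_norm)

lemma upOut'_subset (r : ℝ) : upOut' r ⊆ upOut r := fun _ h => ⟨h.1.le, h.2⟩

/-- A family of functions with continuous dependence on a spectral parameter in the closed upper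
half plane, holomorphic inside. -/
structure KReg (r : ℝ) (h : ℂ → ℝ → ℂ) : Prop where
  cont : ∀ y, ContinuousOn (fun k => h k y) (upOut r)
  diff : ∀ y, DifferentiableOn ℂ (fun k => h k y) (upOut' r)

section
variable {r : ℝ} {h : ℂ → ℝ → ℂ} {G : ℝ → ℝ} {q : ℝ → ℝ}

lemma upOut_ne_zero (hr : 0 < r) {k : ℂ} (hk : k ∈ upOut r) : k ≠ 0 :=
  norm_pos_iff.1 (hr.trans hk.2)

lemma KReg.integral_Ioi (H : KReg r h) (hc : ∀ k ∈ upOut r, Continuous (h k)) (hG : Integrable G)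
    {x : ℝ} (hb : ∀ k ∈ upOut r, ∀ y, x < y → ‖h k y‖ ≤ G y) :
    ContinuousOn (fun k => ∫ y in Set.Ioi x, h k y) (upOut r) ∧
      DifferentiableOn ℂ (fun k => ∫ y in Set.Ioi x, h k y) (upOut' r) := by
  constructor
  · refine continuousOn_of_dominated (bound := G) (fun k hk => (hc k hk).aestronglyMeasurable)
      (fun k hk => ?_) hG.integrableOn (Eventually.of_forall H.cont)
    exact (ae_restrict_iff' measurableSet_Ioi).mpr (Eventually.of_forall fun y hy => hb k hk y hy)
  · refine differentiableOn_integral_of_dominated (isOpen_upOut' r) (G := G)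
      (fun k hk => (hc k (upOut'_subset r hk)).aestronglyMeasurable) hG.integrableOn
      ?_ (Eventually.of_forall H.diff)
    exact (ae_restrict_iff' measurableSet_Ioi).mpr
      (Eventually.of_forall fun y hy k hk => hb k (upOut'_subset r hk) y hy)

lemma KReg.jD (H : KReg r h) (hc : ∀ k ∈ upOut r, Continuous (h k)) (hG : Integrable G)
    (hb : ∀ k ∈ upOut r, ∀ y, ‖h k y‖ ≤ G y) : KReg r fun k => jD k (h k) := by
  have key : ∀ x, KReg r fun k y => Complex.exp (2 * Complex.I * k * ((y - x : ℝ) : ℂ)) * h k y :=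
    fun x => ⟨fun y => ContinuousOn.mul (by fun_prop) (H.cont y), fun y =>
      DifferentiableOn.mul (by fun_prop) (H.diff y)⟩
  have := fun x => (key x).integral_Ioi (G := G) (x := x) (fun k hk => by
    have := hc k hk
    fun_prop) hG (fun k hk y hy => by
      rw [norm_mul]
      exact (mul_le_of_le_one_left (norm_nonneg _)
        (norm_exp_two_mul_le hk.1 (sub_nonneg.2 hy.le))).trans (hb k hk y))
  simp only [← jD_eq] at this
  exact ⟨fun x => (this x).1, fun x => (this x).2⟩

lemma KReg.jT (hr : 0 < r) (H : KReg r h) (hc : ∀ k ∈ upOut r, Continuous (h k)) (hG : Integrable G)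
    (hb : ∀ k ∈ upOut r, ∀ y, ‖h k y‖ ≤ G y) : KReg r fun k => jT k (h k) := by
  have h1 := H.jD hc hG hb
  have h2 := fun x => H.integral_Ioi (x := x) hc hG fun k hk y _ => hb k hk y
  have h0 : ∀ k ∈ upOut r, 2 * Complex.I * k ≠ 0 := fun k hk =>
    mul_ne_zero (mul_ne_zero two_ne_zero Complex.I_ne_zero) (upOut_ne_zero hr hk)
  exact ⟨fun x => ((h2 x).1.sub (h1.cont x)).div (by fun_prop) h0,
    fun x => ((h2 x).2.sub (h1.diff x)).div (by fun_prop) fun k hk => h0 k (upOut'_subset r hk)⟩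

lemma jB_le_of_mem (hr : 0 < r) (q : ℝ → ℝ) {k : ℂ} (hk : r ≤ ‖k‖) : jB q k ≤ jB q r := by
  refine Real.exp_le_exp.2 (mul_le_mul_of_nonneg_right ?_ (integral_nonneg fun _ => abs_nonneg _))
  rw [Complex.norm_real, Real.norm_of_nonneg hr.le]
  gcongr

lemma KReg.mul_pot (H : KReg r h) (q : ℝ → ℝ) : KReg r fun k y => (q y : ℂ) * h k y :=
  ⟨fun y => (H.cont y).const_mul _, fun y => (H.diff y).const_mul _⟩

lemma kReg_jM (hr : 0 < r) (hc : Continuous q) (hi : Integrable q) (n : ℕ) :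
    KReg r fun k => jM q k n := by
  induction n with
  | zero => exact ⟨fun y => continuousOn_const, fun y => differentiableOn_const _⟩
  | succ n ih =>
    have cM := fun k (hk : k ∈ upOut r) => continuous_jM hc hi hk.1 (upOut_ne_zero hr hk) n
    refine KReg.jT (G := fun y => |q y| * ((1 / 2) ^ n * jB q r)) hr (ih.mul_pot q)
      (fun k hk => ?_) (hi.abs.mul_const _) fun k hk y => ?_
    · have := cM k hk
      fun_prop
    · rw [norm_mul, Complex.norm_real, Real.norm_eq_abs]
      have := norm_jM_le hc hi hk.1 (upOut_ne_zero hr hk) n y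
      have := jB_le_of_mem hr q hk.2.le
      gcongr
      exact (norm_jM_le hc hi hk.1 (upOut_ne_zero hr hk) n y).trans (by gcongr)

lemma kReg_jm (hr : 0 < r) (hc : Continuous q) (hi : Integrable q) : KReg r fun k => jm q k := by
  have hb : ∀ (n : ℕ) (y : ℝ) k, k ∈ upOut r → ‖jM q k n y‖ ≤ (1 / 2) ^ n * jB q r := fun n y k hk =>
    (norm_jM_le hc hi hk.1 (upOut_ne_zero hr hk) n y).trans
      (mul_le_mul_of_nonneg_left (jB_le_of_mem hr q hk.2.le) (by positivity))
  exact ⟨fun y => continuousOn_tsum (fun n => (kReg_jM hr hc hi n).cont y)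
      (summable_half_mul (jB q r)) fun n k hk => hb n y k hk,
    fun y => Complex.differentiableOn_tsum_of_summable_norm (summable_half_mul (jB q r))
      (fun n => (kReg_jM hr hc hi n).diff y) (isOpen_upOut' r)
      fun n k hk => hb n y k (upOut'_subset r hk)⟩

lemma kReg_jm' (hr : 0 < r) (hc : Continuous q) (hi : Integrable q) : KReg r fun k => jm' q k := by
  refine KReg.jD (G := fun y => |q y| * (2 * jB q r)) ((kReg_jm hr hc hi).mul_pot q)
    (fun k hk => ?_) (hi.abs.mul_const _) fun k hk y => ?_
  · have := continuous_jm hc hi hk.1 (upOut_ne_zero hr hk)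
    fun_prop
  · rw [norm_mul, Complex.norm_real, Real.norm_eq_abs]
    have := jB_le_of_mem hr q hk.2.le
    gcongr
    exact (norm_jm_le hc hi hk.1 (upOut_ne_zero hr hk) y).trans (by gcongr)

lemma kReg_jf (hr : 0 < r) (hc : Continuous q) (hi : Integrable q) : KReg r fun k => jf q k :=
  ⟨fun y => ContinuousOn.mul (by fun_prop) ((kReg_jm hr hc hi).cont y),
    fun y => DifferentiableOn.mul (by fun_prop) ((kReg_jm hr hc hi).diff y)⟩

lemma kReg_jf' (hr : 0 < r) (hc : Continuous q) (hi : Integrable q) : KReg r fun k => jf' q k :=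
  ⟨fun y => ContinuousOn.mul (by fun_prop) ((ContinuousOn.mul (by fun_prop)
      ((kReg_jm hr hc hi).cont y)).add ((kReg_jm' hr hc hi).cont y)),
    fun y => DifferentiableOn.mul (by fun_prop) ((DifferentiableOn.mul (by fun_prop)
      ((kReg_jm hr hc hi).diff y)).add ((kReg_jm' hr hc hi).diff y))⟩

/-- Regularity outside of every disk gives continuity in the punctured closed upper half plane. -/
lemma KReg.continuousOn {h : ℂ → ℝ → ℂ} (H : ∀ r, 0 < r → KReg r h) (y : ℝ) :
    ContinuousOn (fun k => h k y) {k | 0 ≤ k.im ∧ k ≠ 0} := by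
  intro k hk
  have h0 : 0 < ‖k‖ := norm_pos_iff.2 hk.2
  refine (((H (‖k‖ / 2) (by positivity)).cont y) k ⟨hk.1, by linarith⟩).mono_of_mem_nhdsWithin ?_
  have : {z : ℂ | ‖k‖ / 2 < ‖z‖} ∈ 𝓝 k :=
    (isOpen_lt continuous_const continuous_norm).mem_nhds (half_lt_self h0)
  filter_upwards [mem_nhdsWithin_of_mem_nhds this, self_mem_nhdsWithin] with z h1 h2
  exact ⟨h2.1, h1⟩

lemma KReg.differentiableAt {h : ℂ → ℝ → ℂ} (H : ∀ r, 0 < r → KReg r h) (y : ℝ) {k : ℂ}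
    (hk : 0 < k.im) : DifferentiableAt ℂ (fun k => h k y) k := by
  have h0 : 0 < ‖k‖ := norm_pos_iff.2 fun h => by simp [h] at hk
  exact ((H (‖k‖ / 2) (by positivity)).diff y).differentiableAt
    ((isOpen_upOut' _).mem_nhds ⟨hk, by linarith⟩)

end

/-- The Wronskian is continuous in the frequency. -/
lemma continuousOn_jw {q : ℝ → ℝ} (hc : Continuous q) (hi : Integrable q) :
    ContinuousOn (fun k : ℝ => jw q k) {k | k ≠ 0} := by
  obtain ⟨nc, ni⟩ := comp_neg_data hc hi
  have hmap : Set.MapsTo (fun k : ℝ => (k : ℂ)) {k | k ≠ 0} {k : ℂ | 0 ≤ k.im ∧ k ≠ 0} :=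
    fun k hk => ⟨by simp, Complex.ofReal_ne_zero.2 hk⟩
  have c := fun {h : ℂ → ℝ → ℂ} (H : ∀ r, 0 < r → KReg r h) (y : ℝ) =>
    (KReg.continuousOn H y).comp Complex.continuous_ofReal.continuousOn hmap
  have c1 := c (fun r hr => kReg_jf hr hc hi) 0
  have c2 := c (fun r hr => kReg_jf' hr hc hi) 0
  have c3 := Complex.continuous_conj.comp_continuousOn (c (fun r hr => kReg_jf hr nc ni) (-0))
  have c4 := (Complex.continuous_conj.comp_continuousOn (c (fun r hr => kReg_jf' hr nc ni) (-0))).neg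
  exact (c1.mul c4).sub (c2.mul c3)

/-- Riemann–Lebesgue lemma for a quadratic phase without stationary points. -/
lemma tendsto_setIntegral_mul_exp_sq (H : ℝ → ℂ) {c : ℝ} (hc : c ≠ 0) :
    Tendsto (fun τ : ℝ => ∫ s in Set.Ioi (0 : ℝ), H s * Complex.exp ((c * τ * s ^ 2 : ℝ) * Complex.I))
      atTop (𝓝 0) := by
  set g : ℝ → ℂ := fun v => H (Real.sqrt v) / ((2 * Real.sqrt v : ℝ) : ℂ) with hg
  have hlin : Tendsto (fun τ : ℝ => -(c * τ / (2 * Real.pi))) atTop (cocompact ℝ) := by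
    refine tendsto_cocompact_of_tendsto_dist_comp_atTop 0 ?_
    have h0 : 0 < |c / (2 * Real.pi)| := abs_pos.2 (div_ne_zero hc (by positivity))
    refine (tendsto_abs_atTop_atTop.atTop_mul_const h0).congr fun τ => ?_
    rw [dist_zero_right, norm_neg, Real.norm_eq_abs, ← abs_mul]
    congr 1
    ring
  refine ((Real.tendsto_integral_exp_smul_cocompact
    ((Set.Ioi (0 : ℝ)).indicator g)).comp hlin).congr fun τ => ?_
  have e1 : (fun v => Real.fourierChar (-(v * -(c * τ / (2 * Real.pi)))) • (Set.Ioi (0 : ℝ)).indicator g v) =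
      (Set.Ioi (0 : ℝ)).indicator fun v => g v * Complex.exp ((c * τ * v : ℝ) * Complex.I) := by
    funext v
    by_cases hv : v ∈ Set.Ioi (0 : ℝ)
    · rw [Set.indicator_of_mem hv, Set.indicator_of_mem hv, Circle.smul_def, Real.fourierChar_apply,
        smul_eq_mul, mul_comm]
      congr 4
      field_simp
    · rw [Set.indicator_of_notMem hv, Set.indicator_of_notMem hv, smul_zero]
  rw [Function.comp_apply, e1, integral_indicator measurableSet_Ioi,
    ← integral_comp_rpow_Ioi_of_pos (p := 2) two_pos]
  refine setIntegral_congr_fun measurableSet_Ioi fun x (hx : 0 < x) => ?_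
  have h2 : x ^ (2 : ℝ) = x ^ 2 := by norm_num
  have h1 : x ^ ((2 : ℝ) - 1) = x := by norm_num
  simp only [h1, h2, hg, Real.sqrt_sq hx.le, Complex.real_smul]
  have : ((2 * x : ℝ) : ℂ) ≠ 0 := Complex.ofReal_ne_zero.2 (by positivity)
  field_simp

/-- Continuous amplitudes supported in `[a, b]`. -/
structure Amp (a b : ℝ) (φ : ℝ → ℂ) : Prop where
  cont : Continuous φ
  supp : ∀ k, φ k ≠ 0 → a ≤ k ∧ k ≤ b

section
variable {a b : ℝ} {φ : ℝ → ℂ}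

lemma Amp.hasCompactSupport (h : Amp a b φ) : HasCompactSupport φ :=
  HasCompactSupport.intro isCompact_Icc (K := Set.Icc a b) fun k hk => by
    by_contra h'
    exact hk (h.supp k h')

lemma Amp.integrable (h : Amp a b φ) : Integrable φ :=
  h.cont.integrable_of_hasCompactSupport h.hasCompactSupport

lemma Amp.mul (h : Amp a b φ) {ψ : ℝ → ℂ} (hψ : Continuous ψ) : Amp a b fun k => φ k * ψ k :=
  ⟨h.cont.mul hψ, fun k hk => h.supp k (left_ne_zero_of_mul hk)⟩

lemma Amp.div (h : Amp a b φ) (ha : 0 < a) : Amp a b fun k => φ k / (2 * Complex.I * k) := by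
  have e : (fun k : ℝ => φ k / (2 * Complex.I * k)) =
      fun k : ℝ => φ k * (2 * Complex.I * ((max k a : ℝ) : ℂ))⁻¹ := by
    funext k
    by_cases hk : φ k = 0
    · simp [hk]
    · rw [max_eq_left (h.supp k hk).1, div_eq_mul_inv]
  rw [e]
  refine h.mul (Continuous.inv₀ (by fun_prop) fun k => ?_)
  have : ((max k a : ℝ) : ℂ) ≠ 0 := Complex.ofReal_ne_zero.2 (lt_max_of_lt_right ha).ne'
  simp [this, Complex.I_ne_zero]

/-- Autocorrelation controls an oscillatory integral. -/
lemma sq_norm_integral_le {F : ℝ → ℂ} (hF : Integrable F) :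
    ‖∫ t, F t‖ ^ 2 ≤ ∫ h, ‖∫ t, F t * starRingEnd ℂ (F (t - h))‖ := by
  have hF' : Integrable fun t => starRingEnd ℂ (F (-t)) :=
    (Complex.conjCLE : ℂ →L[ℝ] ℂ).integrable_comp hF.comp_neg
  have e := integral_convolution (ContinuousLinearMap.mul ℝ ℂ) hF hF'
  have e2 : (∫ t, starRingEnd ℂ (F (-t))) = starRingEnd ℂ (∫ t, F t) := by
    rw [integral_conj, integral_neg_eq_self F volume]
  simp only [convolution_def, ContinuousLinearMap.mul_apply', neg_sub, e2] at e
  have e3 : ‖(∫ t, F t) * starRingEnd ℂ (∫ t, F t)‖ = ‖∫ t, F t‖ ^ 2 := by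
    rw [norm_mul, RCLike.norm_conj, sq]
  rw [← e3, ← e]
  exact norm_integral_le_integral_norm _

/-- The autocorrelation of an amplitude modulated by a cubic phase. -/
noncomputable def autoCorr (φ : ℝ → ℂ) (τ h : ℝ) : ℝ :=
  ‖∫ t : ℝ, φ t * starRingEnd ℂ (φ (t - h)) *
    Complex.exp ((8 * τ * (t ^ 3 - (t - h) ^ 3) : ℝ) * Complex.I)‖

lemma Amp.tendsto_autoCorr (hφ : Amp a b φ) (ha : 0 < a) {h : ℝ} (h0 : h ≠ 0) :
    Tendsto (fun τ => autoCorr φ τ h) atTop (𝓝 0) := by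
  have key := (tendsto_setIntegral_mul_exp_sq
    (fun s => φ (s + h / 2) * starRingEnd ℂ (φ (s - h / 2)))
    (c := 24 * h) (mul_ne_zero (by norm_num) h0)).norm
  rw [norm_zero] at key
  refine key.congr fun τ => ?_
  have e : (∫ t : ℝ, φ t * starRingEnd ℂ (φ (t - h)) *
      Complex.exp ((8 * τ * (t ^ 3 - (t - h) ^ 3) : ℝ) * Complex.I)) =
      Complex.exp ((2 * τ * h ^ 3 : ℝ) * Complex.I) * ∫ s in Set.Ioi (0 : ℝ),
        φ (s + h / 2) * starRingEnd ℂ (φ (s - h / 2)) *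
          Complex.exp ((24 * h * τ * s ^ 2 : ℝ) * Complex.I) := by
    rw [← integral_add_right_eq_self _ (h / 2), ← integral_const_mul, ← integral_indicator measurableSet_Ioi]
    congr 1
    funext s
    by_cases hs : s ∈ Set.Ioi (0 : ℝ)
    · rw [Set.indicator_of_mem hs, show s + h / 2 - h = s - h / 2 by ring, mul_left_comm,
        ← Complex.exp_add]
      congr 2
      push_cast
      ring
    · rw [Set.indicator_of_notMem hs, show s + h / 2 - h = s - h / 2 by ring]
      by_cases h1 : φ (s + h / 2) = 0
      · simp [h1]
      · by_cases h2 : φ (s - h / 2) = 0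
        · simp [h2]
        · have := (hφ.supp _ h1).1
          have := (hφ.supp _ h2).1
          exact absurd (show 0 < s by linarith) hs
  rw [autoCorr, e, norm_mul, Complex.norm_exp_ofReal_mul_I, one_mul]

lemma Amp.tendsto_integral_autoCorr (hφ : Amp a b φ) (ha : 0 < a) :
    Tendsto (fun τ => ∫ h, autoCorr φ τ h) atTop (𝓝 0) := by
  have hi := hφ.integrable.norm
  have hb : Integrable fun h => ∫ t, ‖φ t‖ * ‖φ (t - h)‖ := by
    have := hi.integrable_convolution (ContinuousLinearMap.mul ℝ ℝ) hi.comp_neg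
    refine this.congr (Eventually.of_forall fun h => ?_)
    simp only [convolution_def, ContinuousLinearMap.mul_apply', neg_sub]
  have := tendsto_integral_filter_of_dominated_convergence (l := atTop)
    (F := fun τ h => autoCorr φ τ h) (f := fun _ => (0 : ℝ))
    (fun h => ∫ t, ‖φ t‖ * ‖φ (t - h)‖) (Eventually.of_forall fun τ => ?_)
    (Eventually.of_forall fun τ => Eventually.of_forall fun h => ?_) hb
    (((volume : Measure ℝ).ae_ne 0).mono fun h h0 => hφ.tendsto_autoCorr ha h0)
  · simpa using this
  · have hc : StronglyMeasurable (Function.uncurry fun h t : ℝ => φ t * starRingEnd ℂ (φ (t - h)) *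
        Complex.exp ((8 * τ * (t ^ 3 - (t - h) ^ 3) : ℝ) * Complex.I)) := by
      refine Continuous.stronglyMeasurable ?_
      have h1 := hφ.cont
      have h2 := Complex.continuous_conj
      unfold Function.uncurry
      fun_prop
    exact hc.integral_prod_right.norm.aestronglyMeasurable
  · rw [autoCorr, norm_norm]
    refine (norm_integral_le_integral_norm _).trans (le_of_eq ?_)
    congr 1
    funext t
    rw [norm_mul, norm_mul, Complex.norm_exp_ofReal_mul_I, mul_one, RCLike.norm_conj]

/-- Dispersive decay, uniform in the position. -/
lemma Amp.exists_dispersive (hφ : Amp a b φ) (ha : 0 < a) : ∃ N : ℝ → ℝ, Tendsto N atTop (𝓝 0) ∧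
    ∀ τ ξ : ℝ, ‖∫ k : ℝ, φ k * Complex.exp ((8 * τ * k ^ 3 : ℝ) * Complex.I) *
      Complex.exp ((2 * k * ξ : ℝ) * Complex.I)‖ ≤ N τ := by
  refine ⟨fun τ => Real.sqrt (∫ h, autoCorr φ τ h), ?_, fun τ ξ => Real.le_sqrt_of_sq_le ?_⟩
  · simpa using (hφ.tendsto_integral_autoCorr ha).sqrt
  · have i := ((hφ.mul (ψ := fun k : ℝ => Complex.exp ((8 * τ * k ^ 3 : ℝ) * Complex.I))
      (by fun_prop)).mul (ψ := fun k : ℝ => Complex.exp ((2 * k * ξ : ℝ) * Complex.I))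
      (by fun_prop)).integrable
    refine (sq_norm_integral_le i).trans (le_of_eq ?_)
    congr 1
    funext h
    rw [autoCorr]
    have e : ∀ t : ℝ, φ t * Complex.exp ((8 * τ * t ^ 3 : ℝ) * Complex.I) *
        Complex.exp ((2 * t * ξ : ℝ) * Complex.I) * starRingEnd ℂ (φ (t - h) *
          Complex.exp ((8 * τ * (t - h) ^ 3 : ℝ) * Complex.I) *
          Complex.exp ((2 * (t - h) * ξ : ℝ) * Complex.I)) =
        Complex.exp ((2 * h * ξ : ℝ) * Complex.I) * (φ t * starRingEnd ℂ (φ (t - h)) *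
          Complex.exp ((8 * τ * (t ^ 3 - (t - h) ^ 3) : ℝ) * Complex.I)) := by
      intro t
      simp only [map_mul, ← Complex.exp_conj, Complex.conj_ofReal, Complex.conj_I]
      have : Complex.exp ((8 * τ * t ^ 3 : ℝ) * Complex.I) * Complex.exp ((2 * t * ξ : ℝ) * Complex.I) *
          (Complex.exp ((8 * τ * (t - h) ^ 3 : ℝ) * -Complex.I) *
          Complex.exp ((2 * (t - h) * ξ : ℝ) * -Complex.I)) =
          Complex.exp ((2 * h * ξ : ℝ) * Complex.I) *
          Complex.exp ((8 * τ * (t ^ 3 - (t - h) ^ 3) : ℝ) * Complex.I) := by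
        simp only [← Complex.exp_add]
        congr 1
        push_cast
        ring
      linear_combination (φ t * starRingEnd ℂ (φ (t - h))) * this
    simp only [e]
    rw [integral_const_mul, norm_mul, Complex.norm_exp_ofReal_mul_I, one_mul]

end

section
variable {a b : ℝ} {φ : ℝ → ℂ} {q : ℝ → ℝ}

lemma measurable_jM_freq (ha : 0 < a) (hc : Continuous q) (hi : Integrable q) (i : ℕ) :
    StronglyMeasurable (Function.uncurry fun k z : ℝ => jM q ((max k a : ℝ) : ℂ) i z) := by
  refine stronglyMeasurable_uncurry_of_continuous_of_stronglyMeasurable (fun z => ?_) fun k => ?_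
  · have hmap : ∀ k : ℝ, ((max k a : ℝ) : ℂ) ∈ upOut (a / 2) := fun k => by
      refine ⟨by simp, ?_⟩
      rw [Complex.norm_real, Real.norm_of_nonneg (le_max_of_le_right ha.le)]
      exact (half_lt_self ha).trans_le (le_max_right _ _)
    exact ((kReg_jM (half_pos ha) hc hi i).cont z).comp_continuous (by fun_prop) hmap
  · exact (continuous_jM hc hi (by simp)
      (Complex.ofReal_ne_zero.2 (lt_max_of_lt_right ha).ne') i).stronglyMeasurable

/-- Exchange of the integrations in position and frequency. -/
lemma Amp.integral_swap (hφ : Amp a b φ) (ha : 0 < a) (hc : Continuous q) (hi : Integrable q)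
    (i : ℕ) (α β : ℝ) (S : Set ℝ) :
    (Integrable fun k : ℝ => φ k * ∫ z in S, Complex.exp ((2 * k * (α + β * z) : ℝ) * Complex.I) *
        (q z * jM q k i z)) ∧
    (∫ k : ℝ, φ k * ∫ z in S, Complex.exp ((2 * k * (α + β * z) : ℝ) * Complex.I) *
        (q z * jM q k i z)) =
      ∫ z in S, (q z : ℂ) * ∫ k : ℝ, φ k * Complex.exp ((2 * k * (α + β * z) : ℝ) * Complex.I) *
        jM q k i z := by
  set F : ℝ → ℝ → ℂ := fun k z => φ k * (Complex.exp ((2 * k * (α + β * z) : ℝ) * Complex.I) *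
    (q z * jM q ((max k a : ℝ) : ℂ) i z)) with hF
  have hFe : ∀ k z, F k z = φ k * (Complex.exp ((2 * k * (α + β * z) : ℝ) * Complex.I) *
      (q z * jM q k i z)) := fun k z => by
    by_cases h : φ k = 0
    · simp [hF, h]
    · simp only [hF, max_eq_left (hφ.supp k h).1]
  have hL1 : Integrable (Function.uncurry F) ((volume : Measure ℝ).prod (volume.restrict S)) := by
    refine (hφ.integrable.norm.mul_prod ((hi.abs.mul_const (jB q a)).restrict (s := S))).mono' ?_ ?_
    · have h1 := hφ.cont
      have m1 : StronglyMeasurable fun p : ℝ × ℝ => φ p.1 *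
          (Complex.exp ((2 * p.1 * (α + β * p.2) : ℝ) * Complex.I) * q p.2) :=
        Continuous.stronglyMeasurable (by fun_prop)
      refine ((m1.mul (measurable_jM_freq ha hc hi i)).aestronglyMeasurable).congr
        (Eventually.of_forall fun p => ?_)
      simp only [hF, Function.uncurry, Pi.mul_apply]
      ring
    · refine Eventually.of_forall fun p => ?_
      have hb : ‖jM q ((max p.1 a : ℝ) : ℂ) i p.2‖ ≤ jB q a := by
        have h0 : ((max p.1 a : ℝ) : ℂ) ≠ 0 := Complex.ofReal_ne_zero.2 (lt_max_of_lt_right ha).ne'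
        refine (norm_jM_le hc hi (by simp) h0 i p.2).trans ((mul_le_of_le_one_left
          (Real.exp_pos _).le (pow_le_one₀ (by norm_num) (by norm_num))).trans
          (jB_le_of_mem ha q ?_))
        rw [Complex.norm_real, Real.norm_of_nonneg (le_max_of_le_right ha.le)]
        exact le_max_right _ _
      simp only [hF, Function.uncurry, norm_mul, Complex.norm_exp_ofReal_mul_I, one_mul,
        Complex.norm_real, Real.norm_eq_abs]
      gcongr
  have h1 := hL1.integral_prod_left
  have := integral_integral_swap hL1
  simp only [Function.uncurry, hFe, integral_const_mul] at this h1
  refine ⟨h1, ?_⟩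
  rw [this]
  congr 1
  funext z
  rw [← integral_const_mul]
  congr 1
  funext k
  ring

/-- Dispersive decay of the terms of the Neumann series of the Jost solution. -/
lemma exists_dispersive_jM (ha : 0 < a) (M : ℝ) (i : ℕ) :
    ∀ φ, Amp a b φ → ∃ N : ℝ → ℝ, Tendsto N atTop (𝓝 0) ∧ ∀ q : ℝ → ℝ, Continuous q →
      Integrable q → (∫ x, |q x|) ≤ M → ∀ τ ξ y : ℝ,
      ‖∫ k : ℝ, φ k * Complex.exp ((8 * τ * k ^ 3 : ℝ) * Complex.I) *
        Complex.exp ((2 * k * ξ : ℝ) * Complex.I) * jM q k i y‖ ≤ N τ := by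
  induction i with
  | zero =>
    intro φ hφ
    obtain ⟨N, hN, hb⟩ := hφ.exists_dispersive ha
    exact ⟨N, hN, fun q _ _ _ τ ξ y => by simpa only [jM, mul_one] using hb τ ξ⟩
  | succ i ih =>
    intro φ hφ
    obtain ⟨N, hN, hb⟩ := ih _ (hφ.div ha)
    refine ⟨fun τ => 2 * M * N τ, by simpa using hN.const_mul (2 * M), fun q hc hi hq τ ξ y => ?_⟩
    have hN0 : 0 ≤ N τ := (norm_nonneg _).trans (hb q hc hi hq τ 0 0)
    set ψ : ℝ → ℂ := fun k => φ k / (2 * Complex.I * k) *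
      Complex.exp ((8 * τ * k ^ 3 : ℝ) * Complex.I) with hψ
    have aψ : Amp a b ψ := (hφ.div ha).mul (by fun_prop)
    have bd : ∀ α β : ℝ, ‖∫ z in Set.Ioi y, (q z : ℂ) * ∫ k : ℝ, ψ k *
        Complex.exp ((2 * k * (α + β * z) : ℝ) * Complex.I) * jM q k i z‖ ≤ M * N τ := by
      intro α β
      have : (∫ z in Set.Ioi y, |q z| * N τ) ≤ M * N τ := by
        rw [integral_mul_const]
        exact mul_le_mul_of_nonneg_right ((jtail_le hi y).trans hq) hN0
      refine (norm_integral_le_of_norm_le ((hi.abs.mul_const _).integrableOn)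
        (Eventually.of_forall fun z => ?_)).trans this
      rw [norm_mul, Complex.norm_real, Real.norm_eq_abs]
      exact mul_le_mul_of_nonneg_left (hb q hc hi hq τ _ z) (abs_nonneg _)
    have e : ∀ k : ℝ, φ k * Complex.exp ((8 * τ * k ^ 3 : ℝ) * Complex.I) *
        Complex.exp ((2 * k * ξ : ℝ) * Complex.I) * jM q k (i + 1) y =
        ψ k * (∫ z in Set.Ioi y, Complex.exp ((2 * k * (ξ + 0 * z) : ℝ) * Complex.I) *
          (q z * jM q k i z)) -
        ψ k * ∫ z in Set.Ioi y, Complex.exp ((2 * k * (ξ - y + 1 * z) : ℝ) * Complex.I) *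
          (q z * jM q k i z) := by
      intro k
      have e1 : (∫ z in Set.Ioi y, Complex.exp ((2 * k * (ξ + 0 * z) : ℝ) * Complex.I) *
          (q z * jM q k i z)) = Complex.exp ((2 * k * ξ : ℝ) * Complex.I) *
          ∫ z in Set.Ioi y, (q z * jM q k i z : ℂ) := by
        simp only [zero_mul, add_zero, integral_const_mul]
      have e2 : (∫ z in Set.Ioi y, Complex.exp ((2 * k * (ξ - y + 1 * z) : ℝ) * Complex.I) *
          (q z * jM q k i z)) = Complex.exp ((2 * k * ξ : ℝ) * Complex.I) *
          jD k (fun z => (q z : ℂ) * jM q k i z) y := by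
        rw [jD_eq, ← integral_const_mul]
        congr 1
        funext z
        have : Complex.exp ((2 * k * (ξ - y + 1 * z) : ℝ) * Complex.I) =
            Complex.exp ((2 * k * ξ : ℝ) * Complex.I) *
              Complex.exp (2 * Complex.I * k * ((z - y : ℝ) : ℂ)) := by
          rw [← Complex.exp_add]
          congr 1
          push_cast
          ring
        rw [this, mul_assoc]
      rw [e1, e2, jM, jT, hψ]
      ring
    simp only [e]
    obtain ⟨i1, s1⟩ := aψ.integral_swap ha hc hi i ξ 0 (Set.Ioi y)
    obtain ⟨i2, s2⟩ := aψ.integral_swap ha hc hi i (ξ - y) 1 (Set.Ioi y)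
    rw [integral_sub i1 i2, s1, s2]
    refine (norm_sub_le _ _).trans ?_
    have := bd ξ 0
    have := bd (ξ - y) 1
    linarith

end

section
variable {q : ℝ → ℝ} {M a b : ℝ}

lemma norm_jw_add_sum_le (hc : Continuous q) (hi : Integrable q) {k : ℝ} (h0 : k ≠ 0) (J : ℕ) :
    ‖jw q k + ∑ i ∈ Finset.range J,
        ∫ z in Set.univ, Complex.exp ((2 * k * (0 + 1 * z) : ℝ) * Complex.I) * ((q z : ℂ) * jM q k i z)‖
      ≤ (∫ z, |q z|) * ((1 / 2) ^ J * (2 * jB q k)) := by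
  have hk : (0 : ℝ) ≤ (k : ℂ).im := by simp
  have h0' : (k : ℂ) ≠ 0 := Complex.ofReal_ne_zero.2 h0
  have hE : ∀ z : ℝ, Complex.exp ((2 * k * (0 + 1 * z) : ℝ) * Complex.I) =
      Complex.exp (2 * Complex.I * k * z) := fun z => by
    congr 1; push_cast; ring
  have hn : ∀ z : ℝ, ‖Complex.exp (2 * Complex.I * k * z)‖ = 1 := fun z => by
    rw [← hE, Complex.norm_exp_ofReal_mul_I]
  have hmul : ∀ F : ℝ → ℂ, Continuous F → (Integrable fun z => (q z : ℂ) * F z) →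
      Integrable fun z : ℝ => Complex.exp (2 * Complex.I * k * z) * ((q z : ℂ) * F z) := fun F hF hI =>
    hI.bdd_mul (c := 1) (by fun_prop) (ae_of_all _ fun z => (hn z).le)
  have hM := fun i => hmul _ (continuous_jM hc hi hk h0' i) (integrable_mul_jM hc hi hk h0' i)
  have hm := hmul _ (continuous_jm hc hi hk h0') (integrable_mul_jm hc hi hk h0')
  simp only [hE, setIntegral_univ]
  rw [jw_eq_integral hc hi h0, ← integral_finsetSum _ fun i _ => hM i, neg_add_eq_sub, norm_sub_rev,
    ← integral_sub hm (integrable_finsetSum _ fun i _ => hM i), ← integral_mul_const]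
  refine norm_integral_le_of_norm_le (hi.abs.mul_const _) (ae_of_all _ fun z => ?_)
  rw [← Finset.mul_sum, ← mul_sub, ← Finset.mul_sum, ← mul_sub, norm_mul, hn, one_mul, norm_mul,
    Complex.norm_real, Real.norm_eq_abs]
  exact mul_le_mul_of_nonneg_left (norm_jm_sub_sum_le hc hi hk h0' J z) (abs_nonneg _)

lemma jB_le_of_integral_le (ha : 0 < a) {k : ℂ} (hk : a ≤ ‖k‖) (hM : (∫ x, |q x|) ≤ M) :
    jB q k ≤ Real.exp (2 * a⁻¹ * M) := by
  refine Real.exp_le_exp.2 ?_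
  have : ‖k‖⁻¹ ≤ a⁻¹ := inv_anti₀ ha hk
  have h0 : 0 ≤ ∫ x, |q x| := integral_nonneg fun _ => abs_nonneg _
  have h1 : 0 ≤ a⁻¹ := by positivity
  gcongr

lemma norm_integral_amp_jw_le (ha : 0 < a) {φ : ℝ → ℂ} (hφ : Amp a b φ) {N : ℕ → ℝ → ℝ}
    (hN : ∀ i, ∀ q : ℝ → ℝ, Continuous q → Integrable q → (∫ x, |q x|) ≤ M → ∀ τ ξ y,
      ‖∫ k, φ k * Complex.exp ((8 * τ * k ^ 3 : ℝ) * Complex.I) *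
        Complex.exp ((2 * k * ξ : ℝ) * Complex.I) * jM q k i y‖ ≤ N i τ)
    (hc : Continuous q) (hi : Integrable q) (hM : (∫ x, |q x|) ≤ M) (J : ℕ) (τ : ℝ)
    (hI : Integrable fun k : ℝ => φ k * Complex.exp ((8 * τ * k ^ 3 : ℝ) * Complex.I) * jw q k) :
    ‖∫ k : ℝ, φ k * Complex.exp ((8 * τ * k ^ 3 : ℝ) * Complex.I) * jw q k‖ ≤
      (∑ i ∈ Finset.range J, M * N i τ) +
        (∫ k, ‖φ k‖) * (M * ((1 / 2) ^ J * (2 * Real.exp (2 * a⁻¹ * M)))) := by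
  have hφ' : Amp a b fun k => φ k * Complex.exp ((8 * τ * k ^ 3 : ℝ) * Complex.I) :=
    hφ.mul (by fun_prop)
  set A : ℝ → ℂ := fun k => φ k * Complex.exp ((8 * τ * k ^ 3 : ℝ) * Complex.I) with hA
  have hs := fun i => hφ'.integral_swap ha hc hi i 0 1 Set.univ
  have hS : Integrable fun k : ℝ => A k * ∑ i ∈ Finset.range J, ∫ z in Set.univ,
      Complex.exp ((2 * k * (0 + 1 * z) : ℝ) * Complex.I) * ((q z : ℂ) * jM q k i z) := by
    simp only [Finset.mul_sum]
    exact integrable_finsetSum _ fun i _ => (hs i).1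
  have h1 : ‖∫ k : ℝ, A k * ∑ i ∈ Finset.range J, ∫ z in Set.univ,
      Complex.exp ((2 * k * (0 + 1 * z) : ℝ) * Complex.I) * ((q z : ℂ) * jM q k i z)‖ ≤
      ∑ i ∈ Finset.range J, M * N i τ := by
    simp only [Finset.mul_sum]
    rw [integral_finsetSum _ fun i _ => (hs i).1]
    refine (norm_sum_le _ _).trans (Finset.sum_le_sum fun i _ => ?_)
    have hN0 : 0 ≤ N i τ := (norm_nonneg _).trans (hN i q hc hi hM τ 0 0)
    rw [(hs i).2]
    refine (norm_integral_le_of_norm_le (g := fun z => |q z| * N i τ) ?_ (ae_of_all _ fun z => ?_)).trans ?_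
    · exact (hi.abs.mul_const _).restrict
    · rw [norm_mul, Complex.norm_real, Real.norm_eq_abs]
      refine mul_le_mul_of_nonneg_left ?_ (abs_nonneg _)
      have := hN i q hc hi hM τ z z
      simpa only [zero_add, one_mul] using this
    · rw [setIntegral_univ, integral_mul_const]
      exact mul_le_mul_of_nonneg_right hM hN0
  have h2 : ‖∫ k : ℝ, (A k * jw q k + A k * ∑ i ∈ Finset.range J, ∫ z in Set.univ,
      Complex.exp ((2 * k * (0 + 1 * z) : ℝ) * Complex.I) * ((q z : ℂ) * jM q k i z))‖ ≤
      (∫ k, ‖φ k‖) * (M * ((1 / 2) ^ J * (2 * Real.exp (2 * a⁻¹ * M)))) := by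
    rw [← integral_mul_const]
    refine norm_integral_le_of_norm_le (hφ.integrable.norm.mul_const _) (ae_of_all _ fun k => ?_)
    rw [← mul_add, norm_mul]
    have e : ‖A k‖ = ‖φ k‖ := by rw [hA]; simp only [norm_mul, Complex.norm_exp_ofReal_mul_I, mul_one]
    rw [e]
    by_cases hk : φ k = 0
    · simp [hk]
    obtain ⟨hk1, -⟩ := hφ.supp k hk
    have hk0 : k ≠ 0 := (ha.trans_le hk1).ne'
    refine mul_le_mul_of_nonneg_left ((norm_jw_add_sum_le hc hi hk0 J).trans ?_) (norm_nonneg _)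
    have hk2 : a ≤ ‖(k : ℂ)‖ := by
      rw [Complex.norm_real, Real.norm_eq_abs]; exact hk1.trans (le_abs_self _)
    have := jB_le_of_integral_le ha hk2 hM
    have h0 : 0 ≤ ∫ x, |q x| := integral_nonneg fun _ => abs_nonneg _
    have hB : 0 ≤ jB q k := (Real.exp_pos _).le
    gcongr
    exact h0.trans hM
  rw [integral_add hI hS] at h2
  have := norm_sub_norm_le (∫ k : ℝ, A k * jw q k) (-∫ k : ℝ, A k * ∑ i ∈ Finset.range J, ∫ z in Set.univ,
      Complex.exp ((2 * k * (0 + 1 * z) : ℝ) * Complex.I) * ((q z : ℂ) * jM q k i z))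
  rw [norm_neg, sub_neg_eq_add] at this
  linarith

end

/-- Solutions bounded in `L¹` are reflectionless: the Wronskian of the Jost solution at `+∞` and the
conjugate of the Jost solution at `-∞` vanishes. -/
lemma Sol.jw_eq_zero {M : ℝ} {u : ℝ → ℝ → ℝ} (h : Sol M u) {k : ℝ} (hk : 0 < k) {t : ℝ} (ht : 2 < t) :
    jw (fun x => u t x / 3) k = 0 := by
  by_contra hne
  set a : ℝ := k / 2 with ha'
  have ha : 0 < a := half_pos hk
  have hnp := fun T => (h.slice T)
  have hc : ∀ T, Continuous fun x => u T x / 3 := fun T => (hnp T).continuous.div_const 3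
  have hi : ∀ T, Integrable fun x => u T x / 3 := fun T => (hnp T).int.div_const 3
  set W : ℝ → ℂ := fun s => jw (fun x => u t x / 3) (max s a : ℝ) with hW
  have hWc : Continuous W := by
    have := continuousOn_jw (hc t) (hi t)
    exact this.comp_continuous (by fun_prop : Continuous fun s : ℝ => max s a)
      fun s => (ha.trans_le (le_max_right _ _)).ne'
  set χ : ℝ → ℝ := fun s => max 0 (1 - |s - k| / a) with hχ
  have hχc : Continuous χ := by fun_prop
  have hχ0 : ∀ s, 0 ≤ χ s := fun s => le_max_left _ _
  set φ : ℝ → ℂ := fun s => (starRingEnd ℂ) (W s) * χ s with hφ'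
  have hφ : Amp a (3 * a) φ := by
    refine ⟨(Complex.continuous_conj.comp hWc).mul (Complex.continuous_ofReal.comp hχc), fun s hs => ?_⟩
    by_contra hs'
    refine hs ?_
    have : 1 - |s - k| / a ≤ 0 := by
      rw [sub_nonpos, le_div_iff₀ ha, one_mul]
      by_contra h'
      rw [not_le, abs_lt] at h'
      exact hs' ⟨by linarith, by linarith⟩
    simp only [hφ', hχ, max_eq_left this, Complex.ofReal_zero, mul_zero]
  have hpt : ∀ s : ℝ, φ s * jw (fun x => u t x / 3) s = ((χ s * ‖W s‖ ^ 2 : ℝ) : ℂ) := fun s => by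
    by_cases hs : φ s = 0
    · have : χ s * ‖W s‖ ^ 2 = 0 := by
        rcases mul_eq_zero.1 hs with h1 | h1
        · rw [(map_eq_zero _).1 h1]; simp
        · rw [Complex.ofReal_eq_zero.1 h1, zero_mul]
      rw [hs, this]; simp
    · have e : jw (fun x => u t x / 3) s = W s := by
        rw [hW]; simp only [max_eq_left (hφ.supp s hs).1]
      rw [e, hφ']
      simp only
      rw [mul_right_comm, mul_comm ((starRingEnd ℂ) (W s)), Complex.mul_conj, Complex.normSq_eq_norm_sq]
      push_cast; ring
  have hgc : Continuous fun s => χ s * ‖W s‖ ^ 2 := by fun_prop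
  have hgs : HasCompactSupport fun s => χ s * ‖W s‖ ^ 2 := by
    refine HasCompactSupport.intro (isCompact_Icc (a := a) (b := 3 * a)) fun s hs => ?_
    by_contra h'
    refine hs (hφ.supp s fun h0 => h' ?_)
    have := hpt s
    rw [h0, zero_mul] at this
    exact Complex.ofReal_eq_zero.1 this.symm
  have hpos : 0 < ∫ s, χ s * ‖W s‖ ^ 2 := by
    refine hgc.integral_pos_of_hasCompactSupport_nonneg_nonzero hgs
      (fun s => mul_nonneg (hχ0 s) (sq_nonneg _)) (x := k) ?_
    have hka : max k a = k := max_eq_left (by linarith)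
    simp only [hχ, hW, hka, sub_self, abs_zero, zero_div, sub_zero]
    norm_num
    exact hne
  choose N hN0 hN using fun i => exists_dispersive_jM ha M i φ hφ
  have key : ∀ J : ℕ, ∀ τ : ℝ, 0 ≤ τ → (∫ s, χ s * ‖W s‖ ^ 2) ≤ (∑ i ∈ Finset.range J, M * N i τ) +
        (∫ k, ‖φ k‖) * (M * ((1 / 2) ^ J * (2 * Real.exp (2 * a⁻¹ * M)))) := fun J τ hτ => by
    have e : (fun s : ℝ => φ s * Complex.exp ((8 * τ * s ^ 3 : ℝ) * Complex.I) *
        jw (fun x => u (t + τ) x / 3) s) = fun s : ℝ => ((χ s * ‖W s‖ ^ 2 : ℝ) : ℂ) := by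
      funext s
      rw [← hpt s]
      by_cases hs : φ s = 0
      · simp [hs]
      have hs0 : s ≠ 0 := (ha.trans_le (hφ.supp s hs).1).ne'
      have := h.jw_evolution hs0 ht (le_add_of_nonneg_right hτ)
      rw [mul_assoc]
      congr 1
      have e2 : Complex.exp (8 * Complex.I * (s : ℂ) ^ 3 * (t + τ : ℝ)) =
          Complex.exp (8 * Complex.I * (s : ℂ) ^ 3 * t) *
            Complex.exp ((8 * τ * s ^ 3 : ℝ) * Complex.I) := by
        rw [← Complex.exp_add]; congr 1; push_cast; ring
      rw [e2, mul_assoc] at this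
      exact mul_left_cancel₀ (Complex.exp_ne_zero _) this
    have hI : Integrable fun s : ℝ => φ s * Complex.exp ((8 * τ * s ^ 3 : ℝ) * Complex.I) *
        jw (fun x => u (t + τ) x / 3) s := by
      rw [e]; exact (hgc.integrable_of_hasCompactSupport hgs).ofReal
    have hM1 : (∫ x, |u (t + τ) x / 3|) ≤ M := (h.slice (t + τ)).integral_abs_third_le
    have := norm_integral_amp_jw_le (M := M) ha hφ hN (hc (t + τ)) (hi (t + τ)) hM1 J τ hI
    rw [e, integral_complex_ofReal, Complex.norm_real, Real.norm_eq_abs, abs_of_pos hpos] at this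
    exact this
  have key2 : ∀ J : ℕ, (∫ s, χ s * ‖W s‖ ^ 2) ≤
        (∫ k, ‖φ k‖) * (M * ((1 / 2) ^ J * (2 * Real.exp (2 * a⁻¹ * M)))) := fun J => by
    have hl : Tendsto (fun τ => (∑ i ∈ Finset.range J, M * N i τ) +
        (∫ k, ‖φ k‖) * (M * ((1 / 2) ^ J * (2 * Real.exp (2 * a⁻¹ * M))))) atTop
        (𝓝 ((∑ i ∈ Finset.range J, M * 0) +
          (∫ k, ‖φ k‖) * (M * ((1 / 2) ^ J * (2 * Real.exp (2 * a⁻¹ * M)))))) :=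
      (tendsto_finsetSum _ fun i _ => (hN0 i).const_mul M).add_const _
    have := ge_of_tendsto hl (eventually_atTop.2 ⟨0, fun τ hτ => key J τ hτ⟩)
    simpa using this
  have hl : Tendsto (fun J : ℕ =>
      (∫ k, ‖φ k‖) * (M * ((1 / 2 : ℝ) ^ J * (2 * Real.exp (2 * a⁻¹ * M))))) atTop (𝓝
      ((∫ k, ‖φ k‖) * (M * (0 * (2 * Real.exp (2 * a⁻¹ * M)))))) :=
    (((tendsto_pow_atTop_nhds_zero_of_lt_one (by norm_num) (by norm_num)).mul_const _).const_mul _).const_mul _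
  have := ge_of_tendsto' hl key2
  simp only [zero_mul, mul_zero] at this
  linarith

/-- Functions with nonnegative real part on the unit disc: the Schwarz–Pick bound at the centre. -/
lemma norm_deriv_zero_le_two_mul_re {g : ℂ → ℂ} (hd : DifferentiableOn ℂ g (Metric.ball 0 1))
    (hg : ∀ z ∈ Metric.ball (0 : ℂ) 1, 0 ≤ (g z).re) : ‖deriv g 0‖ ≤ 2 * (g 0).re := by
  have h0 : (0 : ℂ) ∈ Metric.ball (0 : ℂ) 1 := Metric.mem_ball_self one_pos
  have key : ∀ e : ℝ, 0 < e → ‖deriv g 0‖ ≤ 2 * ((g 0).re + e) := fun e he => by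
    set c : ℂ := g 0 + e with hc
    have hcr : 0 < c.re := by
      have := hg 0 h0
      simp only [hc, Complex.add_re, Complex.ofReal_re]; linarith
    set h : ℂ → ℂ := fun z => (g z + e - c) / (g z + e + (starRingEnd ℂ) c) with hh
    have hden : ∀ z ∈ Metric.ball (0 : ℂ) 1, g z + e + (starRingEnd ℂ) c ≠ 0 := fun z hz h' => by
      have h1 := congr_arg Complex.re h'
      have := hg z hz
      simp only [Complex.add_re, Complex.ofReal_re, Complex.conj_re, Complex.zero_re] at h1
      linarith
    have hhd : DifferentiableOn ℂ h (Metric.ball 0 1) := fun z hz =>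
      (((hd z hz).add_const _).sub_const _).div (((hd z hz).add_const _).add_const _) (hden z hz)
    have hh0 : h 0 = 0 := by simp [hh, hc]
    have hmaps : Set.MapsTo h (Metric.ball 0 1) (Metric.closedBall (h 0) 1) := fun z hz => by
      rw [hh0, mem_closedBall_zero_iff, hh]
      simp only
      rw [norm_div, div_le_one (norm_pos_iff.2 (hden z hz)), ← sq_le_sq₀ (norm_nonneg _) (norm_nonneg _),
        ← Complex.normSq_eq_norm_sq, ← Complex.normSq_eq_norm_sq, Complex.normSq_apply,
        Complex.normSq_apply]
      have h1 := hg z hz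
      simp only [Complex.add_re, Complex.sub_re, Complex.add_im, Complex.sub_im, Complex.ofReal_re,
        Complex.ofReal_im, Complex.conj_re, Complex.conj_im]
      nlinarith [mul_nonneg h1 hcr.le, mul_pos he hcr]
    have hder := Complex.norm_deriv_le_one_of_mapsTo_ball hhd hmaps one_pos
    have hg0 : HasDerivAt g (deriv g 0) 0 :=
      (hd.differentiableAt (Metric.isOpen_ball.mem_nhds h0)).hasDerivAt
    have e1 : deriv h 0 = deriv g 0 / ((2 * c.re : ℝ) : ℂ) := by
      have e2 : g 0 + e + (starRingEnd ℂ) c = ((2 * c.re : ℝ) : ℂ) := by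
        rw [← hc, Complex.add_conj]
      have e3 : g 0 + e - c = 0 := by rw [hc, sub_self]
      have h1 := ((hg0.add_const (e : ℂ)).sub_const c).div
        ((hg0.add_const (e : ℂ)).add_const ((starRingEnd ℂ) c)) (hden 0 h0)
      have h2 := h1.deriv
      rw [e2, e3, zero_mul, sub_zero] at h2
      have h3 : ((2 * c.re : ℝ) : ℂ) ≠ 0 := Complex.ofReal_ne_zero.2 (by positivity)
      refine Eq.trans h2 ?_
      field_simp
    rw [e1, norm_div, Complex.norm_real, Real.norm_eq_abs, abs_of_pos (by positivity),
      div_le_one (by positivity)] at hder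
    simpa [hc] using hder
  refine le_of_forall_pos_le_add fun e he => ?_
  linarith [key (e / 2) (half_pos he)]

/-- The open right half-plane. -/
def rhp : Set ℂ := {k | 0 < k.re}

lemma isOpen_rhp : IsOpen rhp := isOpen_lt continuous_const Complex.continuous_re

lemma norm_deriv_le_re_div {P : ℂ → ℂ} (hd : DifferentiableOn ℂ P rhp)
    (hP : ∀ k ∈ rhp, 0 ≤ (P k).re) {k : ℂ} (hk : k ∈ rhp) : ‖deriv P k‖ ≤ (P k).re / k.re := by
  have hk' : 0 < k.re := hk
  set T : ℂ → ℂ := fun z => Complex.I * k.im + k.re * ((1 + z) / (1 - z)) with hT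
  have h1z : ∀ z ∈ Metric.ball (0 : ℂ) 1, 1 - z ≠ 0 := fun z hz h => by
    rw [mem_ball_zero_iff, ← sub_eq_zero.1 h, norm_one] at hz
    exact lt_irrefl _ hz
  have hTmem : ∀ z ∈ Metric.ball (0 : ℂ) 1, T z ∈ rhp := fun z hz => by
    have h2 : 0 < ((1 + z) / (1 - z)).re := by
      have hn : 0 < Complex.normSq (1 - z) := Complex.normSq_pos.2 (h1z z hz)
      have hz2 : Complex.normSq z < 1 := by
        rw [Complex.normSq_eq_norm_sq]
        rw [mem_ball_zero_iff] at hz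
        exact pow_lt_one₀ (norm_nonneg _) hz two_ne_zero
      rw [Complex.normSq_apply] at hz2
      rw [Complex.div_re, ← add_div]
      refine div_pos ?_ hn
      simp only [Complex.add_re, Complex.one_re, Complex.sub_re, Complex.add_im, Complex.one_im,
        Complex.sub_im]
      nlinarith
    change 0 < (T z).re
    simp only [hT, Complex.add_re, Complex.mul_re, Complex.I_re, Complex.I_im,
      Complex.ofReal_re, Complex.ofReal_im]
    nlinarith [mul_pos hk' h2]
  have hTd : ∀ z ∈ Metric.ball (0 : ℂ) 1, HasDerivAt T
      (k.re * ((1 * (1 - z) - (1 + z) * (-1)) / (1 - z) ^ 2)) z := fun z hz =>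
    ((((hasDerivAt_id z).const_add 1).div ((hasDerivAt_id z).const_sub 1) (h1z z hz)).const_mul
      (k.re : ℂ)).const_add _
  have hT0 : T 0 = k := by
    simp only [hT, add_zero, sub_zero, div_one, mul_one]
    rw [add_comm, mul_comm Complex.I, Complex.re_add_im]
  have h0 : (0 : ℂ) ∈ Metric.ball (0 : ℂ) 1 := Metric.mem_ball_self one_pos
  have hdk : HasDerivAt P (deriv P k) (T 0) := by
    rw [hT0]; exact (hd.differentiableAt (isOpen_rhp.mem_nhds hk)).hasDerivAt
  have hcomp := (hdk.comp 0 (hTd 0 h0)).deriv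
  have := norm_deriv_zero_le_two_mul_re (g := P ∘ T)
    (fun z hz => ((hd.differentiableAt (isOpen_rhp.mem_nhds (hTmem z hz))).comp z
      (hTd z hz).differentiableAt).differentiableWithinAt)
    fun z hz => hP _ (hTmem z hz)
  rw [hcomp, Function.comp_apply, hT0, norm_mul, norm_mul, Complex.norm_real, Real.norm_eq_abs,
    abs_of_pos hk'] at this
  norm_num at this
  rw [le_div_iff₀ hk']
  nlinarith

lemma hasDerivAt_re_horizontal {P : ℂ → ℂ} (hd : DifferentiableOn ℂ P rhp) (y : ℝ) {r : ℝ} (hr : 0 < r) :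
    HasDerivAt (fun s : ℝ => (P (s + y * Complex.I)).re) (deriv P (r + y * Complex.I)).re r := by
  have hm : (r + y * Complex.I : ℂ) ∈ rhp := by
    change 0 < (r + y * Complex.I : ℂ).re
    simpa using hr
  have h1 : HasDerivAt P (deriv P (r + y * Complex.I)) ((r : ℂ) + y * Complex.I) :=
    (hd.differentiableAt (isOpen_rhp.mem_nhds hm)).hasDerivAt
  have h2 : HasDerivAt (fun s : ℂ => P (s + y * Complex.I)) (deriv P (r + y * Complex.I)) (r : ℂ) :=
    h1.comp_add_const _ _
  exact h2.real_of_complex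

lemma re_le_re_of_rhp {P : ℂ → ℂ} (hd : DifferentiableOn ℂ P rhp) (hP : ∀ k ∈ rhp, 0 ≤ (P k).re)
    {B R : ℝ} (hB : ∀ k ∈ rhp, R ≤ ‖k‖ → ‖P k - k‖ ≤ B) {k : ℂ} (hk : k ∈ rhp) : k.re ≤ (P k).re := by
  have hk' : 0 < k.re := hk
  set y := k.im
  have hmem : ∀ s : ℝ, 0 < s → (s + y * Complex.I : ℂ) ∈ rhp := fun s hs => by
    change 0 < (s + y * Complex.I : ℂ).re
    simpa using hs
  set F : ℝ → ℝ := fun s => (P (s + y * Complex.I)).re / s with hF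
  have hanti : AntitoneOn F (Set.Ioi 0) := by
    have hder : ∀ s : ℝ, 0 < s → HasDerivAt F
        (((deriv P (s + y * Complex.I)).re * s - (P (s + y * Complex.I)).re * 1) / s ^ 2) s :=
      fun s hs => (hasDerivAt_re_horizontal hd y hs).div (hasDerivAt_id s) hs.ne'
    refine antitoneOn_of_deriv_nonpos (convex_Ioi 0)
      (fun s hs => (hder s hs).continuousAt.continuousWithinAt)
      (fun s hs => ((hder s (interior_subset hs)).differentiableAt).differentiableWithinAt)
      fun s hs => ?_
    have hs' : 0 < s := interior_subset hs
    rw [(hder s hs').deriv]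
    refine div_nonpos_of_nonpos_of_nonneg ?_ (sq_nonneg _)
    have h1 := norm_deriv_le_re_div hd hP (hmem s hs')
    have h2 : (s + y * Complex.I : ℂ).re = s := by simp
    rw [h2, le_div_iff₀ hs'] at h1
    nlinarith [Complex.re_le_norm (deriv P (s + y * Complex.I))]
  have hlim : Tendsto (fun s : ℝ => 1 - B / s) atTop (𝓝 (1 - 0)) :=
    (tendsto_const_nhds.div_atTop tendsto_id).const_sub 1
  have hle : ∀ᶠ s in atTop, 1 - B / s ≤ F k.re := by
    filter_upwards [eventually_ge_atTop k.re, eventually_ge_atTop R] with s hs hsR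
    have hs' : 0 < s := hk'.trans_le hs
    refine le_trans ?_ (hanti hk' hs' hs)
    have h2 : (s + y * Complex.I : ℂ).re = s := by simp
    have h3 : R ≤ ‖(s + y * Complex.I : ℂ)‖ := by
      refine hsR.trans (le_trans ?_ (Complex.abs_re_le_norm _)); rw [h2]; exact le_abs_self s
    have h4 := (Complex.abs_re_le_norm _).trans (hB _ (hmem s hs') h3)
    rw [Complex.sub_re, h2, abs_le] at h4
    rw [hF]; simp only
    rw [one_sub_div hs'.ne', div_le_div_iff_of_pos_right hs']
    linarith
  have h5 := le_of_tendsto hlim hle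
  have h6 : (k.re + y * Complex.I : ℂ) = k := Complex.re_add_im k
  rw [sub_zero, hF] at h5
  simp only [h6] at h5
  rwa [le_div_iff₀ hk', one_mul] at h5

lemma mul_re_sub_mono_of_rhp {P : ℂ → ℂ} (hd : DifferentiableOn ℂ P rhp) (hP : ∀ k ∈ rhp, 0 ≤ (P k).re)
    {B R : ℝ} (hB : ∀ k ∈ rhp, R ≤ ‖k‖ → ‖P k - k‖ ≤ B) :
    MonotoneOn (fun r : ℝ => r * ((P r).re - r)) (Set.Ioi 0) := by
  set P₀ : ℂ → ℂ := fun k => P k - k with hP₀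
  have hd₀ : DifferentiableOn ℂ P₀ rhp := hd.sub differentiableOn_id
  have hn : ∀ k ∈ rhp, 0 ≤ (P₀ k).re := fun k hk => by
    rw [hP₀, Complex.sub_re]; linarith [re_le_re_of_rhp hd hP hB hk]
  have hder : ∀ s : ℝ, 0 < s → HasDerivAt (fun r : ℝ => r * ((P r).re - r))
      (1 * (P₀ s).re + s * (deriv P₀ s).re) s := fun s hs => by
    have h1 := hasDerivAt_re_horizontal hd₀ 0 hs
    simp only [Complex.ofReal_zero, zero_mul, add_zero] at h1
    exact (hasDerivAt_id s).mul h1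
  refine monotoneOn_of_deriv_nonneg (convex_Ioi 0)
    (fun s hs => (hder s hs).continuousAt.continuousWithinAt)
    (fun s hs => ((hder s (interior_subset hs)).differentiableAt).differentiableWithinAt)
    fun s hs => ?_
  have hs' : 0 < s := interior_subset hs
  rw [(hder s hs').deriv]
  have h1 := norm_deriv_le_re_div hd₀ hn (k := s) (by change 0 < (s : ℂ).re; simpa using hs')
  rw [Complex.ofReal_re, le_div_iff₀ hs'] at h1
  have h2 := (abs_le.1 (Complex.abs_re_le_norm (deriv P₀ s))).1
  nlinarith

/-- A function continuous on the right half-plane and holomorphic off the real axis is holomorphic. -/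
lemma differentiableOn_rhp_of_off_real {P : ℂ → ℂ} (hc : ContinuousOn P rhp)
    (hd : ∀ k ∈ rhp, k.im ≠ 0 → DifferentiableAt ℂ P k) : DifferentiableOn ℂ P rhp := by
  intro c hcm
  obtain ⟨r, hr, hball⟩ := Metric.isOpen_iff.1 isOpen_rhp c hcm
  have hone : ∀ z w : ℂ, Complex.Rectangle z w ⊆ rhp → (0 ≤ z.im ∧ 0 ≤ w.im ∨ z.im ≤ 0 ∧ w.im ≤ 0) →
      (∫ x : ℝ in z.re..w.re, P (x + z.im * Complex.I)) - (∫ x : ℝ in z.re..w.re, P (x + w.im * Complex.I)) +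
      Complex.I • (∫ y : ℝ in z.im..w.im, P (w.re + y * Complex.I)) -
      Complex.I • (∫ y : ℝ in z.im..w.im, P (z.re + y * Complex.I)) = 0 := fun z w hzw hs => by
    refine Complex.integral_boundary_rect_eq_zero_of_continuousOn_of_differentiableOn P z w
      (hc.mono hzw) fun k hk => ?_
    obtain ⟨h1, h2⟩ := hk
    refine (hd k (hzw ⟨?_, ?_⟩) ?_).differentiableWithinAt
    · exact ⟨h1.1.le, h1.2.le⟩
    · exact ⟨h2.1.le, h2.2.le⟩
    · rcases hs with hs | hs
      · exact ((le_min hs.1 hs.2).trans_lt h2.1).ne'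
      · exact (h2.2.trans_le (max_le hs.1 hs.2)).ne
  have hcons : Complex.IsConservativeOn P (Metric.ball c r) := fun z w hzw => by
    have hzw' := hzw.trans hball
    rw [← add_eq_zero_iff_eq_neg, Complex.wedgeIntegral_add_wedgeIntegral_eq]
    by_cases hs : 0 ≤ z.im ∧ 0 ≤ w.im ∨ z.im ≤ 0 ∧ w.im ≤ 0
    · exact hone z w hzw' hs
    have h0 : (0 : ℝ) ∈ Set.uIcc z.im w.im := by
      rw [Set.mem_uIcc]; grind
    have hsub1 : Complex.Rectangle z (w.re : ℂ) ⊆ rhp := fun k hk => hzw' (by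
      obtain ⟨h1, h2⟩ := hk
      rw [Complex.ofReal_re] at h1
      rw [Complex.ofReal_im] at h2
      exact ⟨h1, Set.uIcc_subset_uIcc_left h0 h2⟩)
    have hsub2 : Complex.Rectangle (z.re : ℂ) w ⊆ rhp := fun k hk => hzw' (by
      obtain ⟨h1, h2⟩ := hk
      rw [Complex.ofReal_re] at h1
      rw [Complex.ofReal_im] at h2
      exact ⟨h1, Set.uIcc_subset_uIcc_right h0 h2⟩)
    have A := hone z (w.re : ℂ) hsub1 (by simp only [Complex.ofReal_im]; grind)
    have B := hone (z.re : ℂ) w hsub2 (by simp only [Complex.ofReal_im]; grind)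
    simp only [Complex.ofReal_re, Complex.ofReal_im] at A B
    have hv : ∀ a : ℝ, a ∈ Set.uIcc z.re w.re → ∀ b d : ℝ, b ∈ Set.uIcc z.im w.im → d ∈ Set.uIcc z.im w.im →
        IntervalIntegrable (fun y : ℝ => P (a + y * Complex.I)) volume b d := fun a ha b d hb hd' => by
      refine ContinuousOn.intervalIntegrable (hc.comp (by fun_prop) fun y hy => hzw' ⟨?_, ?_⟩)
      · simpa using ha
      · simpa using Set.uIcc_subset_uIcc hb hd' hy
    have hl := Set.left_mem_uIcc (a := z.im) (b := w.im)
    have hr' := Set.right_mem_uIcc (a := z.im) (b := w.im)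
    rw [← intervalIntegral.integral_add_adjacent_intervals (hv _ Set.right_mem_uIcc _ _ hl h0)
        (hv _ Set.right_mem_uIcc _ _ h0 hr'),
      ← intervalIntegral.integral_add_adjacent_intervals (hv _ Set.left_mem_uIcc _ _ hl h0)
        (hv _ Set.left_mem_uIcc _ _ h0 hr')]
    simp only [smul_eq_mul] at A B ⊢
    linear_combination A + B
  exact (((Complex.isConservativeOn_and_continuousOn_iff_isDifferentiableOn Metric.isOpen_ball).1
    ⟨hcons, hc.mono hball⟩).differentiableAt (Metric.ball_mem_nhds c hr)).differentiableWithinAt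

section
variable {q : ℝ → ℝ} {k : ℂ}

lemma jf'_conj_jf_im_pos (hc : Continuous q) (hi : Integrable q) (hk : 0 ≤ k.im) (hr : 0 < k.re) (x : ℝ) :
    0 < (jf' q k x * (starRingEnd ℂ) (jf q k x)).im := by
  have h0 : k ≠ 0 := fun h => by simp [h] at hr
  set V : ℝ → ℝ := fun y => (jf' q k y * (starRingEnd ℂ) (jf q k y)).im with hV
  have hd : ∀ y, HasDerivAt V (-(2 * k.re * k.im * ‖jf q k y‖ ^ 2)) y := fun y => by
    have h1 := (hasDerivAt_jf' hc hi hk h0 y).mul (hasDerivAt_conj (hasDerivAt_jf hc hi hk h0 y))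
    have h2 := Complex.imCLM.hasFDerivAt.comp_hasDerivAt y h1
    refine h2.congr_deriv ?_
    simp only [Complex.imCLM_apply, Complex.add_im]
    rw [mul_assoc, Complex.mul_conj, Complex.mul_conj, Complex.ofReal_im, add_zero,
      Complex.normSq_eq_norm_sq]
    simp only [Complex.mul_im, Complex.neg_im, Complex.neg_re, Complex.add_im, Complex.ofReal_im,
      Complex.ofReal_re, pow_two]
    ring
  have hanti : Antitone V := antitone_of_hasDerivAt_nonpos hd fun y =>
    neg_nonpos.2 (by positivity)
  have hG : Tendsto (fun y => ((Complex.I * k * jm q k y + jm' q k y) * (starRingEnd ℂ) (jm q k y)).im)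
      atTop (𝓝 (((Complex.I * k * 1 + 0) * (starRingEnd ℂ) 1).im)) := by
    have hm := tendsto_jm hc hi hk h0
    exact (Complex.continuous_im.tendsto _).comp (((hm.const_mul _).add (tendsto_jm' hc hi hk h0)).mul
      ((Complex.continuous_conj.tendsto _).comp hm))
  have e0 : ((Complex.I * k * 1 + 0) * (starRingEnd ℂ) 1).im = k.re := by simp
  rw [e0] at hG
  obtain ⟨y, hy, hxy⟩ := ((hG.eventually (lt_mem_nhds hr)).and (eventually_ge_atTop x)).exists
  refine lt_of_lt_of_le ?_ (hanti hxy)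
  have e1 : jf' q k y * (starRingEnd ℂ) (jf q k y) =
      ((‖Complex.exp (Complex.I * k * y)‖ ^ 2 : ℝ) : ℂ) *
        ((Complex.I * k * jm q k y + jm' q k y) * (starRingEnd ℂ) (jm q k y)) := by
    rw [← Complex.normSq_eq_norm_sq, ← Complex.mul_conj, jf, jf', map_mul]
    ring
  rw [hV]
  simp only
  rw [e1, Complex.im_ofReal_mul]
  exact mul_pos (pow_pos (norm_pos_iff.2 (Complex.exp_ne_zero _)) 2) hy

lemma jf_ne_zero (hc : Continuous q) (hi : Integrable q) (hk : 0 ≤ k.im) (hr : 0 < k.re) (x : ℝ) :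
    jf q k x ≠ 0 := fun h => by
  have := jf'_conj_jf_im_pos hc hi hk hr x
  simp [h] at this

/-- The Weyl function `-i f'/f` of the Jost solution, as a function of the spectral parameter. -/
noncomputable def jW (q : ℝ → ℝ) (x : ℝ) (k : ℂ) : ℂ := -Complex.I * jf' q k x / jf q k x

lemma jW_re_pos (hc : Continuous q) (hi : Integrable q) (hk : 0 ≤ k.im) (hr : 0 < k.re) (x : ℝ) :
    0 < (jW q x k).re := by
  have hf := jf_ne_zero hc hi hk hr x
  have e : jW q x k = -Complex.I * (jf' q k x * (starRingEnd ℂ) (jf q k x)) *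
      (((Complex.normSq (jf q k x))⁻¹ : ℝ) : ℂ) := by
    rw [jW, div_eq_mul_inv, Complex.inv_def]
    ring
  rw [e, mul_comm, Complex.re_ofReal_mul]
  refine mul_pos (inv_pos.2 (Complex.normSq_pos.2 hf)) ?_
  have := jf'_conj_jf_im_pos hc hi hk hr x
  simpa using this

lemma jW_sub (hf : jf q k x ≠ 0) : jW q x k - k = -Complex.I * (jm' q k x / jm q k x) := by
  have hE := Complex.exp_ne_zero (Complex.I * k * x)
  have hm : jm q k x ≠ 0 := right_ne_zero_of_mul hf
  rw [jW, jf, jf']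
  field_simp
  ring_nf
  simp

lemma norm_jm_sub_one_le (hc : Continuous q) (hi : Integrable q) (hk : 0 ≤ k.im) (h0 : k ≠ 0) (x : ℝ) :
    ‖jm q k x - 1‖ ≤ (∫ y, |q y|) * (2 * jB q k) / ‖k‖ := by
  have hI := integrable_mul_jm hc hi hk h0
  rw [jm_eq hc hi hk h0, add_sub_cancel_left, div_eq_inv_mul]
  refine (norm_jT_le hk h0 hI x).trans (mul_le_mul_of_nonneg_left ?_ (by positivity))
  refine (setIntegral_le_integral hI.norm (Eventually.of_forall fun _ => norm_nonneg _)).trans ?_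
  rw [← integral_mul_const]
  refine integral_mono hI.norm (hi.abs.mul_const _) fun y => ?_
  simp only [norm_mul, Complex.norm_real, Real.norm_eq_abs]
  exact mul_le_mul_of_nonneg_left (norm_jm_le hc hi hk h0 y) (abs_nonneg _)

/-- Frequency beyond which the Jost solutions are uniformly close to plane waves. -/
lemma exists_jW_sub_bound (L : ℝ) : ∃ R B : ℝ, 1 ≤ R ∧ ∀ q : ℝ → ℝ, Continuous q → Integrable q →
    (∫ y, |q y|) ≤ L → ∀ k : ℂ, 0 ≤ k.im → R ≤ ‖k‖ → ∀ x, 1 / 2 ≤ ‖jm q k x‖ ∧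
      ‖jm q k x - 1‖ ≤ B / ‖k‖ ∧ ‖jm' q k x / jm q k x‖ ≤ B := by
  set C := L * (2 * Real.exp (2 * 1⁻¹ * L)) with hC
  refine ⟨max 1 (2 * C), 2 * C, le_max_left _ _, fun q hc hi hL k hk hR x => ?_⟩
  have h1 : 1 ≤ ‖k‖ := (le_max_left _ _).trans hR
  have h2 : 2 * C ≤ ‖k‖ := (le_max_right _ _).trans hR
  have hk0 : 0 < ‖k‖ := one_pos.trans_le h1
  have h0 : k ≠ 0 := norm_pos_iff.1 hk0
  have hL0 : 0 ≤ ∫ y, |q y| := integral_nonneg fun _ => abs_nonneg _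
  have hB0 : 0 ≤ jB q k := (Real.exp_pos _).le
  have hB : (∫ y, |q y|) * (2 * jB q k) ≤ C := by
    have := jB_le_of_integral_le one_pos h1 hL
    rw [hC]
    gcongr
    exact hL0.trans hL
  have hC0 : 0 ≤ C := (by positivity : (0 : ℝ) ≤ (∫ y, |q y|) * (2 * jB q k)).trans hB
  have h3 : ‖jm q k x - 1‖ ≤ C / ‖k‖ := (norm_jm_sub_one_le hc hi hk h0 x).trans (by gcongr)
  have h4 : C / ‖k‖ ≤ 1 / 2 := by rw [div_le_div_iff₀ hk0 two_pos]; linarith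
  have h5 : 1 / 2 ≤ ‖jm q k x‖ := by
    have := norm_sub_norm_le (1 : ℂ) (1 - jm q k x)
    rw [sub_sub_cancel, norm_one, norm_sub_rev] at this
    linarith
  refine ⟨h5, h3.trans (by gcongr; linarith), ?_⟩
  rw [norm_div, div_le_iff₀ (by linarith)]
  have := (norm_jm'_le hc hi hk h0 x).trans hB
  nlinarith

lemma norm_jW_sub_le {R B L : ℝ} (H : ∀ q : ℝ → ℝ, Continuous q → Integrable q →
    (∫ y, |q y|) ≤ L → ∀ k : ℂ, 0 ≤ k.im → R ≤ ‖k‖ → ∀ x, 1 / 2 ≤ ‖jm q k x‖ ∧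
      ‖jm q k x - 1‖ ≤ B / ‖k‖ ∧ ‖jm' q k x / jm q k x‖ ≤ B)
    (hc : Continuous q) (hi : Integrable q) (hL : (∫ y, |q y|) ≤ L) (hk : 0 ≤ k.im) (hr : 0 < k.re)
    (hR : R ≤ ‖k‖) (x : ℝ) : ‖jW q x k - k‖ ≤ B := by
  rw [jW_sub (jf_ne_zero hc hi hk hr x), norm_mul, norm_neg, Complex.norm_I, one_mul]
  exact (H q hc hi hL k hk hR x).2.2

lemma tendsto_jD_freq {h : ℝ → ℂ} (x : ℝ) : Tendsto (fun k : ℝ => jD k h x) atTop (𝓝 0) := by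
  have hlin : Tendsto (fun k : ℝ => -(k / Real.pi)) atTop (cocompact ℝ) := by
    refine tendsto_cocompact_of_tendsto_dist_comp_atTop 0 ?_
    refine (tendsto_abs_atTop_atTop.atTop_mul_const (inv_pos.2 Real.pi_pos)).congr fun τ => ?_
    rw [dist_zero_right, norm_neg, Real.norm_eq_abs, abs_div, abs_of_pos Real.pi_pos, div_eq_mul_inv]
  have h1 := (Real.tendsto_integral_exp_smul_cocompact ((Set.Ioi x).indicator h)).comp hlin
  have h2 := h1.norm
  rw [norm_zero] at h2
  refine squeeze_zero_norm (fun k => le_of_eq ?_) h2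
  have e1 : (fun v => Real.fourierChar (-(v * -(k / Real.pi))) • (Set.Ioi x).indicator h v) =
      (Set.Ioi x).indicator fun v => Complex.exp (2 * Complex.I * k * x) *
        (Complex.exp (2 * Complex.I * k * (v - x)) * h v) := by
    funext v
    by_cases hv : v ∈ Set.Ioi x
    · rw [Set.indicator_of_mem hv, Set.indicator_of_mem hv, Circle.smul_def, Real.fourierChar_apply,
        smul_eq_mul, ← mul_assoc, ← Complex.exp_add]
      congr 2
      have : (Real.pi : ℂ) ≠ 0 := Complex.ofReal_ne_zero.2 Real.pi_ne_zero
      push_cast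
      field_simp
      ring
    · rw [Set.indicator_of_notMem hv, Set.indicator_of_notMem hv, smul_zero]
  rw [Function.comp_apply, e1, integral_indicator measurableSet_Ioi, integral_const_mul, norm_mul, jD_eq]
  have : ‖Complex.exp (2 * Complex.I * k * x)‖ = 1 := by rw [Complex.norm_exp]; simp
  rw [this, one_mul]
  simp only [Complex.ofReal_sub]

lemma jW_eq_conj (hc : Continuous q) (hi : Integrable q) {k : ℝ} (hk : 0 < k) (hw : jw q k = 0) (x : ℝ) :
    jW q x k = (starRingEnd ℂ) (jW (fun y => q (-y)) (-x) k) := by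
  obtain ⟨nc, ni⟩ := comp_neg_data hc hi
  have hf := jf_ne_zero hc hi (k := (k : ℂ)) (by simp) (by simpa using hk) x
  have hf' := jf_ne_zero nc ni (k := (k : ℂ)) (by simp) (by simpa using hk) (-x)
  have h := jw_eq hc hi hk.ne' x
  rw [hw, jg, jg'] at h
  have hg := (map_ne_zero (starRingEnd ℂ)).2 hf'
  rw [jW, jW, map_div₀, div_eq_div_iff hf hg, map_mul, map_neg, Complex.conj_I]
  linear_combination Complex.I * h

/-- The Weyl function of a reflectionless potential, continued to the right half-plane. -/
noncomputable def jP (q : ℝ → ℝ) (x : ℝ) (k : ℂ) : ℂ :=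
  if 0 ≤ k.im then jW q x k
  else (starRingEnd ℂ) (jW (fun y => q (-y)) (-x) ((starRingEnd ℂ) k))

lemma continuousOn_jW (hc : Continuous q) (hi : Integrable q) (x : ℝ) :
    ContinuousOn (jW q x) (rhp ∩ {k | 0 ≤ k.im}) := by
  have hs : rhp ∩ {k : ℂ | 0 ≤ k.im} ⊆ {k | 0 ≤ k.im ∧ k ≠ 0} := fun k hk =>
    ⟨hk.2, fun h => by have : 0 < k.re := hk.1; simp [h] at this⟩
  have h1 := KReg.continuousOn (fun r hr => kReg_jf hr hc hi) x
  have h2 := KReg.continuousOn (fun r hr => kReg_jf' hr hc hi) x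
  exact ((h2.mono hs).const_smul (-Complex.I)).div (h1.mono hs) fun k hk => jf_ne_zero hc hi hk.2 hk.1 x

lemma differentiableAt_jW (hc : Continuous q) (hi : Integrable q) (x : ℝ) (hk : 0 < k.im) (hr : 0 < k.re) :
    DifferentiableAt ℂ (jW q x) k := by
  have h1 := KReg.differentiableAt (fun r hr => kReg_jf hr hc hi) x hk
  have h2 := KReg.differentiableAt (fun r hr => kReg_jf' hr hc hi) x hk
  exact (h2.const_mul (-Complex.I)).div h1 (jf_ne_zero hc hi hk.le hr x)

lemma jP_re_nonneg (hc : Continuous q) (hi : Integrable q) (x : ℝ) : ∀ k ∈ rhp, 0 ≤ (jP q x k).re := by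
  intro k hk
  obtain ⟨nc, ni⟩ := comp_neg_data hc hi
  rw [jP]
  split_ifs with h
  · exact (jW_re_pos hc hi h hk x).le
  · rw [Complex.conj_re]
    exact (jW_re_pos nc ni (by rw [Complex.conj_im]; linarith) (by rw [Complex.conj_re]; exact hk) _).le

lemma differentiableOn_jP (hc : Continuous q) (hi : Integrable q) (hw : ∀ k : ℝ, 0 < k → jw q k = 0) (x : ℝ) :
    DifferentiableOn ℂ (jP q x) rhp := by
  obtain ⟨nc, ni⟩ := comp_neg_data hc hi
  refine differentiableOn_rhp_of_off_real ?_ fun k hk him => ?_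
  · refine ContinuousOn.if ?_ ?_ ?_
    · rintro k ⟨hk, hf⟩
      rw [Complex.frontier_setOfPred_le_im] at hf
      have hf' : k.im = 0 := hf
      have e : k = (k.re : ℂ) := Complex.ext (by simp) (by simpa using hf')
      rw [e, Complex.conj_ofReal]
      exact jW_eq_conj hc hi hk (hw _ hk) x
    · refine (continuousOn_jW hc hi x).mono fun k hk => ⟨hk.1, ?_⟩
      have := hk.2
      rwa [(isClosed_le continuous_const Complex.continuous_im).closure_eq] at this
    · refine Complex.continuous_conj.comp_continuousOn ((continuousOn_jW nc ni (-x)).comp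
        Complex.continuous_conj.continuousOn fun k hk => ⟨?_, ?_⟩)
      · change 0 < ((starRingEnd ℂ) k).re
        rw [Complex.conj_re]; exact hk.1
      · have := hk.2
        simp only [not_le, Complex.closure_setOfPred_im_lt] at this
        change 0 ≤ ((starRingEnd ℂ) k).im
        rw [Complex.conj_im]
        exact neg_nonneg.2 this
  · rcases lt_or_gt_of_ne him with h | h
    · have h1 : DifferentiableAt ℂ (jW (fun y => q (-y)) (-x)) ((starRingEnd ℂ) k) :=
        differentiableAt_jW nc ni _ (by rw [Complex.conj_im]; linarith) (by rw [Complex.conj_re]; exact hk)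
      have h2 := h1.conj_conj
      simp only [Complex.conj_conj] at h2
      refine h2.congr_of_eventuallyEq ?_
      filter_upwards [(isOpen_lt Complex.continuous_im continuous_const).mem_nhds h] with z hz
      rw [jP, if_neg (not_le.2 hz)]
      rfl
    · refine (differentiableAt_jW hc hi x h hk).congr_of_eventuallyEq ?_
      filter_upwards [(isOpen_lt continuous_const Complex.continuous_im).mem_nhds h] with z hz
      rw [jP, if_pos (le_of_lt hz)]

end

/-- Real part of the excess of the Weyl function over the free one. -/
noncomputable def jR (q : ℝ → ℝ) (k x : ℝ) : ℝ := (jW q x k).re - k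

/-- Imaginary part of the Weyl function. -/
noncomputable def jI (q : ℝ → ℝ) (k x : ℝ) : ℝ := (jW q x k).im

section
variable {q : ℝ → ℝ} {k : ℝ}

lemma hasDerivAt_jW (hc : Continuous q) (hi : Integrable q) (hk : 0 < k) (x : ℝ) :
    HasDerivAt (fun y => jW q y k) (Complex.I * (q x + k ^ 2 - jW q x k ^ 2)) x := by
  have him : (0 : ℝ) ≤ (k : ℂ).im := by simp
  have h0 : (k : ℂ) ≠ 0 := Complex.ofReal_ne_zero.2 hk.ne'
  have hf := jf_ne_zero hc hi him (by simpa using hk) x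
  refine (((hasDerivAt_jf' hc hi him h0 x).const_mul (-Complex.I)).div
    (hasDerivAt_jf hc hi him h0 x) hf).congr_deriv ?_
  rw [jW]
  field_simp
  linear_combination (jf' q k x) ^ 2 * Complex.I_sq

lemma hasDerivAt_jR (hc : Continuous q) (hi : Integrable q) (hk : 0 < k) (x : ℝ) :
    HasDerivAt (jR q k) (2 * jI q k x * (k + jR q k x)) x := by
  have h := (Complex.reCLM.hasFDerivAt.comp_hasDerivAt x (hasDerivAt_jW hc hi hk x)).sub_const k
  refine h.congr_deriv ?_
  rw [jI, jR, Complex.reCLM_apply, Complex.I_mul_re, ← Complex.ofReal_pow, ← Complex.ofReal_add,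
    Complex.sub_im, Complex.ofReal_im, pow_two, Complex.mul_im]
  ring

lemma hasDerivAt_jI (hc : Continuous q) (hi : Integrable q) (hk : 0 < k) (x : ℝ) :
    HasDerivAt (jI q k) (q x - 2 * (k * jR q k x) - jR q k x ^ 2 + jI q k x ^ 2) x := by
  have h := Complex.imCLM.hasFDerivAt.comp_hasDerivAt x (hasDerivAt_jW hc hi hk x)
  refine h.congr_deriv ?_
  rw [jI, jR, Complex.imCLM_apply, Complex.I_mul_im, ← Complex.ofReal_pow, ← Complex.ofReal_add,
    Complex.sub_re, Complex.ofReal_re, pow_two (jW q x k), Complex.mul_re]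
  ring

lemma continuous_jR (hc : Continuous q) (hi : Integrable q) (hk : 0 < k) : Continuous (jR q k) :=
  continuous_iff_continuousAt.2 fun x => (hasDerivAt_jR hc hi hk x).continuousAt

lemma continuous_jI (hc : Continuous q) (hi : Integrable q) (hk : 0 < k) : Continuous (jI q k) :=
  continuous_iff_continuousAt.2 fun x => (hasDerivAt_jI hc hi hk x).continuousAt

lemma jP_ofReal (x : ℝ) : jP q x k = jW q x k := by rw [jP, if_pos (by simp)]

lemma exists_norm_jP_sub_le (hc : Continuous q) (hi : Integrable q) :
    ∃ R B : ℝ, ∀ x, ∀ k ∈ rhp, R ≤ ‖k‖ → ‖jP q x k - k‖ ≤ B := by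
  obtain ⟨R, B, -, H⟩ := exists_jW_sub_bound (∫ y, |q y|)
  obtain ⟨nc, ni⟩ := comp_neg_data hc hi
  refine ⟨R, B, fun x k hk hR => ?_⟩
  rw [jP]
  split_ifs with h
  · exact norm_jW_sub_le H hc hi le_rfl h hk hR x
  · have e : (starRingEnd ℂ) (jW (fun y => q (-y)) (-x) ((starRingEnd ℂ) k)) - k =
        (starRingEnd ℂ) (jW (fun y => q (-y)) (-x) ((starRingEnd ℂ) k) - (starRingEnd ℂ) k) := by
      rw [map_sub, Complex.conj_conj]
    rw [e, Complex.norm_conj]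
    exact norm_jW_sub_le H nc ni (integral_neg_eq_self (fun y => |q y|) volume).le
      (by rw [Complex.conj_im]; linarith) (by rw [Complex.conj_re]; exact hk)
      (by rwa [Complex.norm_conj]) _

lemma jR_nonneg (hc : Continuous q) (hi : Integrable q) (hw : ∀ k : ℝ, 0 < k → jw q k = 0)
    (hk : 0 < k) (x : ℝ) : 0 ≤ jR q k x := by
  obtain ⟨R, B, hB⟩ := exists_norm_jP_sub_le hc hi
  have h := re_le_re_of_rhp (differentiableOn_jP hc hi hw x) (jP_re_nonneg hc hi x) (hB x)
    (k := (k : ℂ)) (show 0 < (k : ℂ).re by simpa using hk)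
  rw [jP_ofReal, Complex.ofReal_re] at h
  exact sub_nonneg.2 h

lemma mul_jR_mono (hc : Continuous q) (hi : Integrable q) (hw : ∀ k : ℝ, 0 < k → jw q k = 0)
    (hk : 0 < k) {k' : ℝ} (hkk : k ≤ k') (x : ℝ) : k * jR q k x ≤ k' * jR q k' x := by
  obtain ⟨R, B, hB⟩ := exists_norm_jP_sub_le hc hi
  have h := mul_re_sub_mono_of_rhp (differentiableOn_jP hc hi hw x) (jP_re_nonneg hc hi x) (hB x)
    (Set.mem_Ioi.2 hk) (Set.mem_Ioi.2 (hk.trans_le hkk)) hkk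
  simp only [jP_ofReal] at h
  exact h

lemma tendsto_jW_sub (hc : Continuous q) (hi : Integrable q) (x : ℝ) :
    Tendsto (fun k : ℝ => jW q x k - k) atTop (𝓝 0) := by
  obtain ⟨R, B, hR1, H⟩ := exists_jW_sub_bound (∫ y, |q y|)
  have hlim : Tendsto (fun k : ℝ => 2 * (‖jD k (fun y => (q y : ℂ)) x‖ + (∫ y, |q y|) * (B / k)))
      atTop (𝓝 (2 * (‖(0 : ℂ)‖ + (∫ y, |q y|) * 0))) :=
    ((tendsto_jD_freq x).norm.add ((tendsto_const_nhds.div_atTop tendsto_id).const_mul _)).const_mul 2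
  rw [norm_zero, mul_zero, add_zero, mul_zero] at hlim
  refine squeeze_zero_norm' ?_ hlim
  filter_upwards [eventually_ge_atTop R] with k hk
  have hk0 : 0 < k := by linarith
  have him : (0 : ℝ) ≤ (k : ℂ).im := by simp
  have h0 : (k : ℂ) ≠ 0 := Complex.ofReal_ne_zero.2 hk0.ne'
  have hn : ‖(k : ℂ)‖ = k := by rw [Complex.norm_real, Real.norm_eq_abs, abs_of_pos hk0]
  have H' := H q hc hi le_rfl k him (by rwa [hn])
  have hq : Integrable fun y => (q y : ℂ) := hi.ofReal
  have hm := integrable_mul_jm hc hi him h0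
  have hd : Integrable fun y => (q y : ℂ) * (jm q k y - 1) := by
    refine (hm.sub hq).congr (Eventually.of_forall fun y => ?_)
    simp only [Pi.sub_apply]; ring
  have e : jm' q k x - jD k (fun y => (q y : ℂ)) x = jD k (fun y => (q y : ℂ) * (jm q k y - 1)) x := by
    rw [jm', ← jD_sub him hm hq]
    congr 1
    funext y
    ring
  have h1 : ‖jD k (fun y => (q y : ℂ) * (jm q k y - 1)) x‖ ≤ (∫ y, |q y|) * (B / k) := by
    refine (norm_jD_le him hd x).trans ((setIntegral_le_integral hd.norm
      (Eventually.of_forall fun _ => norm_nonneg _)).trans ?_)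
    rw [← integral_mul_const]
    refine integral_mono hd.norm (hi.abs.mul_const _) fun y => ?_
    simp only [norm_mul, Complex.norm_real, Real.norm_eq_abs]
    refine mul_le_mul_of_nonneg_left ?_ (abs_nonneg _)
    have := (H' y).2.1
    rwa [hn] at this
  have hm2 := (H' x).1
  rw [jW_sub (jf_ne_zero hc hi him (by simpa using hk0) x), norm_mul, norm_neg, Complex.norm_I, one_mul,
    norm_div, div_le_iff₀ (by linarith)]
  have h2 : ‖jm' q k x‖ ≤ ‖jD k (fun y => (q y : ℂ)) x‖ + (∫ y, |q y|) * (B / k) := by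
    rw [← e] at h1
    linarith [norm_sub_norm_le (jm' q k x) (jD k (fun y => (q y : ℂ)) x)]
  nlinarith [norm_nonneg (jm' q k x)]

lemma exists_abs_jI_le (hc : Continuous q) (hi : Integrable q) :
    ∃ R B : ℝ, 1 ≤ R ∧ ∀ k, R ≤ k → ∀ x, |jR q k x| ≤ B ∧ |jI q k x| ≤ B := by
  obtain ⟨R, B, hR1, H⟩ := exists_jW_sub_bound (∫ y, |q y|)
  refine ⟨R, B, hR1, fun k hk x => ?_⟩
  have hk0 : 0 < k := by linarith
  have h := norm_jW_sub_le H hc hi le_rfl (k := (k : ℂ)) (by simp) (by simpa using hk0)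
    (by rwa [Complex.norm_real, Real.norm_eq_abs, abs_of_pos hk0]) x
  have h1 := (Complex.abs_re_le_norm _).trans h
  have h2 := (Complex.abs_im_le_norm _).trans h
  rw [Complex.sub_re, Complex.ofReal_re] at h1
  rw [Complex.sub_im, Complex.ofReal_im, sub_zero] at h2
  exact ⟨h1, h2⟩

lemma integral_mul_jR_le (hc : Continuous q) (hi : Integrable q) (hw : ∀ k : ℝ, 0 < k → jw q k = 0)
    (hk : 0 < k) {a b : ℝ} (hab : a ≤ b) : ∫ x in a..b, 2 * (k * jR q k x) ≤ ∫ x in a..b, q x := by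
  obtain ⟨R, B, hR1, H⟩ := exists_abs_jI_le hc hi
  have hR : ∀ x, Tendsto (fun k => jR q k x) atTop (𝓝 0) := fun x => by
    refine ((Complex.continuous_re.tendsto _).comp (tendsto_jW_sub hc hi x)).congr fun k => ?_
    simp [jR]
  have hI : ∀ x, Tendsto (fun k => jI q k x) atTop (𝓝 0) := fun x => by
    refine ((Complex.continuous_im.tendsto _).comp (tendsto_jW_sub hc hi x)).congr fun k => ?_
    simp [jI]
  have hlim : Tendsto (fun k => ∫ x in a..b, (jI q k x ^ 2 - jR q k x ^ 2)) atTop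
      (𝓝 (∫ _ in a..b, ((0 : ℝ) ^ 2 - 0 ^ 2))) := by
    refine intervalIntegral.tendsto_integral_filter_of_dominated_convergence (fun _ => B ^ 2 + B ^ 2)
      ?_ ?_ intervalIntegrable_const (Eventually.of_forall fun x _ => ((hI x).pow 2).sub ((hR x).pow 2))
    · filter_upwards [eventually_gt_atTop 0] with k hk
      exact (((continuous_jI hc hi hk).pow 2).sub ((continuous_jR hc hi hk).pow 2)).aestronglyMeasurable
    · filter_upwards [eventually_ge_atTop R] with k hk
      refine Eventually.of_forall fun x _ => ?_
      obtain ⟨h1, h2⟩ := H k hk x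
      rw [← sq_abs (jI q k x), ← sq_abs (jR q k x), Real.norm_eq_abs]
      refine (abs_sub _ _).trans ?_
      rw [abs_pow, abs_abs, abs_pow, abs_abs]
      gcongr
  have hlim2 := ((tendsto_const_nhds (x := ∫ x in a..b, q x)).add hlim).sub ((hI b).sub (hI a))
  simp only [ne_eq, OfNat.ofNat_ne_zero, not_false_eq_true, zero_pow, sub_zero,
    intervalIntegral.integral_zero, add_zero] at hlim2
  refine ge_of_tendsto hlim2 ?_
  filter_upwards [eventually_ge_atTop k] with k' hk'
  have hk0 : 0 < k' := hk.trans_le hk'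
  have cR := continuous_jR hc hi hk0
  have cI := continuous_jI hc hi hk0
  have hftc := intervalIntegral.integral_eq_sub_of_hasDerivAt (a := a) (b := b)
    (fun x _ => hasDerivAt_jI hc hi hk0 x) (Continuous.intervalIntegrable (by fun_prop) _ _)
  have e : ∫ x in a..b, 2 * (k' * jR q k' x) = (∫ x in a..b, q x) +
      (∫ x in a..b, (jI q k' x ^ 2 - jR q k' x ^ 2)) - (jI q k' b - jI q k' a) := by
    rw [← hftc, ← intervalIntegral.integral_add (hc.intervalIntegrable _ _)
      (Continuous.intervalIntegrable (by fun_prop) _ _), ← intervalIntegral.integral_sub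
      (Continuous.intervalIntegrable (by fun_prop) _ _) (Continuous.intervalIntegrable (by fun_prop) _ _)]
    congr 1
    funext x
    ring
  rw [← e]
  refine intervalIntegral.integral_mono_on hab (Continuous.intervalIntegrable
    (by have := continuous_jR hc hi hk; fun_prop) _ _) (Continuous.intervalIntegrable (by fun_prop) _ _)
    fun x _ => ?_
  linarith [mul_jR_mono hc hi hw hk hk' x]

lemma two_mul_mul_jR_le (hc : Continuous q) (hi : Integrable q) (hw : ∀ k : ℝ, 0 < k → jw q k = 0)
    (hk : 0 < k) (x : ℝ) : 2 * (k * jR q k x) ≤ q x := by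
  have cR := continuous_jR hc hi hk
  have hg : Continuous fun y => q y - 2 * (k * jR q k y) := by fun_prop
  have hii : ∀ a b, IntervalIntegrable (fun y => q y - 2 * (k * jR q k y)) volume a b := fun a b =>
    hg.intervalIntegrable a b
  have hmono : Monotone fun y => ∫ s in (0 : ℝ)..y, (q s - 2 * (k * jR q k s)) := fun a b hab => by
    have h1 := intervalIntegral.integral_add_adjacent_intervals (hii 0 a) (hii a b)
    have h2 : 0 ≤ ∫ s in a..b, (q s - 2 * (k * jR q k s)) := by
      rw [intervalIntegral.integral_sub (hc.intervalIntegrable _ _)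
        (Continuous.intervalIntegrable (by fun_prop) _ _)]
      exact sub_nonneg.2 (integral_mul_jR_le hc hi hw hk hab)
    simp only
    linarith
  have := (intervalIntegral.integral_hasDerivAt_right (hii 0 x) (hg.stronglyMeasurableAtFilter _ _)
    hg.continuousAt).nonneg_of_monotone hmono
  linarith

end

lemma virial_density_nonneg {w w₂ s t q I C K : ℝ} (hw : 0 ≤ w) (hC : 0 ≤ C) (h₂ : |w₂| ≤ C * w)
    (hs : 0 ≤ s) (ht : 0 < t) (hq : 2 * (t * s) ≤ q) (hK : q ≤ K) :
    0 ≤ (t + C / 4) * (w * (q - 2 * (t * s) - t * s ^ 2 + I ^ 2) - 1 / 2 * w₂ * Real.log (1 + s)) +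
      1 / 4 * (w * q ^ 2 + w₂ * q) + (C * K ^ 2 + C ^ 2 * K) * (w / t) := by
  set l := Real.log (1 + s) with hl
  set G := w * (q - 2 * (t * s) - t * s ^ 2 + I ^ 2) - 1 / 2 * w₂ * l with hG
  obtain ⟨h2l, h2u⟩ := abs_le.1 h₂
  have hts : 0 ≤ t * s := by positivity
  have hl0 : 0 ≤ l := Real.log_nonneg (by linarith)
  have hls : l ≤ s := (Real.log_le_sub_one_of_pos (by linarith)).trans (by linarith)
  have hsl : s - l ≤ s ^ 2 := by
    have h1 := Real.one_sub_inv_le_log_of_pos (show 0 < 1 + s by linarith)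
    have h2 : (1 + s)⁻¹ ≤ 1 - s + s ^ 2 := by
      rw [inv_le_iff_one_le_mul₀ (by linarith)]
      nlinarith [pow_nonneg hs 3]
    linarith
  have hCw : 0 ≤ C * w := by positivity
  have e1 : w₂ * l ≤ w₂ * s + C * w * s ^ 2 := by
    nlinarith [mul_le_mul_of_nonneg_left hsl hCw, mul_nonneg (by linarith : 0 ≤ C * w + w₂) (sub_nonneg.2 hls)]
  have e2 : w₂ * l ≤ C * w * s := (mul_le_mul_of_nonneg_right h2u hl0).trans
    (mul_le_mul_of_nonneg_left hls hCw)
  set h := q - 2 * (t * s) with hh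
  have hh0 : 0 ≤ h := by rw [hh]; linarith
  have hI : 0 ≤ w * I ^ 2 := by positivity
  have A : w * h ≤ G + w * (t * s ^ 2) + 1 / 2 * (w₂ * l) := by rw [hG]; nlinarith
  have A1 : w * h ≤ G + w * (t * s ^ 2) + 1 / 2 * (w₂ * s + C * w * s ^ 2) := by linarith
  have A2 : w * h ≤ G + w * (t * s ^ 2) + 1 / 2 * (C * w * s) := by linarith
  have B1 := mul_le_mul_of_nonneg_left A1 ht.le
  have B2 := mul_le_mul_of_nonneg_left A2 (by positivity : 0 ≤ C / 4)
  have B3 : w₂ * (-h) ≤ C * w * h := by nlinarith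
  have B4 : w * (t * s) ^ 2 ≤ w * (q ^ 2 / 4) := mul_le_mul_of_nonneg_left (by nlinarith) hw
  have B5 : 0 ≤ t * (w * h) := by positivity
  have hsK : s ≤ K / t := by rw [le_div_iff₀ ht]; linarith
  have hK0 : 0 ≤ K := by linarith
  have htsK : t * s ≤ K := by linarith
  have B6 : t * s ^ 2 ≤ K ^ 2 / t := by
    have := mul_le_mul htsK hsK hs hK0
    calc t * s ^ 2 = t * s * s := by ring
      _ ≤ K * (K / t) := this
      _ = K ^ 2 / t := by ring
  have C1 := mul_le_mul_of_nonneg_left B6 hCw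
  have C2 := mul_le_mul_of_nonneg_left hsK (by positivity : 0 ≤ C ^ 2 * w)
  have C1' : 0 ≤ C * w * (t * s ^ 2) := by positivity
  have C2' : 0 ≤ C ^ 2 * w * s := by positivity
  have e3 : (C * K ^ 2 + C ^ 2 * K) * (w / t) = C * w * (K ^ 2 / t) + C ^ 2 * w * (K / t) := by ring
  rw [e3]
  have e4 : w₂ * q = w₂ * h + 2 * (w₂ * (t * s)) := by rw [hh]; ring
  nlinarith

section
variable {q : ℝ → ℝ} {k : ℝ}

lemma reflectionless_integral_nonneg (hc : Continuous q) (hi : Integrable q)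
    (hw : ∀ k : ℝ, 0 < k → jw q k = 0) {K : ℝ} (hK : ∀ x, |q x| ≤ K) {n : ℕ} (hn : 1 ≤ n) :
    0 ≤ ∫ x, (wt n x * q x ^ 2 + deriv (deriv (wt n)) x * q x) := by
  obtain ⟨R, B, hR1, H⟩ := exists_abs_jI_le hc hi
  set C := wtC n
  have hC : 0 ≤ C := (wtC_pos n).le
  have hK0 : 0 ≤ K := (abs_nonneg _).trans (hK 0)
  have hB0 : 0 ≤ B := (abs_nonneg _).trans (H R le_rfl 0).1
  have hwi := integrable_wt hn
  have cw := continuous_wt n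
  have cd : Continuous (deriv (wt n)) := (contDiff_wt n (k := 2)).continuous_deriv (by norm_num)
  have hd2 : ContDiff ℝ 1 (deriv (wt n)) := ((contDiff_wt n (k := 2)).iterate_deriv' 1 1)
  have cd2 : Continuous (deriv (deriv (wt n))) := hd2.continuous_deriv le_rfl
  have hL1 : ∀ f : ℝ → ℝ, Continuous f → ∀ c, (∀ x, |f x| ≤ c * wt n x) → Integrable f :=
    fun f hf c hb => (hwi.const_mul c).mono' hf.aestronglyMeasurable (Eventually.of_forall hb)
  set J := ∫ x, (wt n x * q x ^ 2 + deriv (deriv (wt n)) x * q x) with hJ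
  have hJi : Integrable fun x => wt n x * q x ^ 2 + deriv (deriv (wt n)) x * q x := by
    refine hL1 _ (by fun_prop) (K ^ 2 + C * K) fun x => ?_
    have h1 : q x ^ 2 ≤ K ^ 2 := sq_le_sq' (neg_le_of_abs_le (hK x)) (le_of_abs_le (hK x))
    refine (abs_add_le _ _).trans ?_
    rw [abs_mul, abs_mul, abs_of_pos (wt_pos n x), abs_of_nonneg (sq_nonneg (q x))]
    have h2 := mul_le_mul (abs_deriv2_wt_le n x) (hK x) (abs_nonneg _)
      (mul_nonneg hC (wt_pos n x).le)
    nlinarith [wt_pos n x]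
  have key : ∀ k, R ≤ k → 0 ≤ 1 / 4 * J + (C * K ^ 2 + C ^ 2 * K) * (∫ x, wt n x) / k ^ 2 := by
    intro k hk
    have hk1 : 1 ≤ k := hR1.trans hk
    have hk0 : 0 < k := one_pos.trans_le hk1
    have cR := continuous_jR hc hi hk0
    have cI := continuous_jI hc hi hk0
    have hR0 := jR_nonneg hc hi hw hk0
    have hpos : ∀ x, 0 < 1 + jR q k x / k := fun x => by have := hR0 x; positivity
    have hlog : ∀ x, |Real.log (1 + jR q k x / k)| ≤ B := fun x => by
      have h0 : 0 ≤ jR q k x / k := div_nonneg (hR0 x) hk0.le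
      rw [abs_of_nonneg (Real.log_nonneg (by linarith))]
      have h1 := Real.log_le_sub_one_of_pos (hpos x)
      have h2 : jR q k x / k ≤ jR q k x := div_le_self (hR0 x) hk1
      linarith [le_of_abs_le (H k hk x).1]
    have clog : Continuous fun x => Real.log (1 + jR q k x / k) :=
      (by fun_prop : Continuous fun x => 1 + jR q k x / k).log fun x => (hpos x).ne'
    set G' : ℝ → ℝ := fun x => wt n x * (q x - 2 * (k * jR q k x) - jR q k x ^ 2 + jI q k x ^ 2) -
      1 / 2 * deriv (deriv (wt n)) x * Real.log (1 + jR q k x / k) with hG'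
    have hG : ∀ x, HasDerivAt (fun x => wt n x * jI q k x -
        1 / 2 * (deriv (wt n) x * Real.log (1 + jR q k x / k))) (G' x) x := fun x => by
      have h1 := ((contDiff_wt n (k := 2)).differentiable (by norm_num) x).hasDerivAt
      have h2 := (hd2.differentiable (by norm_num) x).hasDerivAt
      have h3 := (((hasDerivAt_jR hc hi hk0 x).div_const k).const_add 1).log (hpos x).ne'
      refine ((h1.mul (hasDerivAt_jI hc hi hk0 x)).sub ((h2.mul h3).const_mul (1 / 2))).congr_deriv ?_
      rw [hG']
      have hne : k + jR q k x ≠ 0 := by have := hR0 x; positivity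
      field_simp
      ring
    have iG : Integrable fun x => wt n x * jI q k x -
        1 / 2 * (deriv (wt n) x * Real.log (1 + jR q k x / k)) := by
      refine hL1 _ (by fun_prop) (B + C * B) fun x => ?_
      refine (abs_sub _ _).trans ?_
      rw [abs_mul, abs_mul, abs_mul, abs_of_pos (wt_pos n x), abs_of_pos (by norm_num : (0:ℝ) < 1 / 2)]
      have h1 := mul_le_mul_of_nonneg_left (H k hk x).2 (wt_pos n x).le
      have h2 := mul_le_mul (abs_deriv_wt_le n x) (hlog x) (abs_nonneg _)
        (mul_nonneg hC (wt_pos n x).le)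
      nlinarith [mul_nonneg (abs_nonneg (deriv (wt n) x)) (abs_nonneg (Real.log (1 + jR q k x / k)))]
    have iG' : Integrable G' := by
      refine hL1 _ (by fun_prop) (K + B ^ 2 + B ^ 2 + C * B) fun x => ?_
      have h1 := two_mul_mul_jR_le hc hi hw hk0 x
      have h1' : 0 ≤ k * jR q k x := mul_nonneg hk0.le (hR0 x)
      have h2 : jR q k x ^ 2 ≤ B ^ 2 := by rw [← sq_abs]; have := (H k hk x).1; gcongr
      have h3 : jI q k x ^ 2 ≤ B ^ 2 := by rw [← sq_abs]; have := (H k hk x).2; gcongr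
      have h4 : |q x - 2 * (k * jR q k x) - jR q k x ^ 2 + jI q k x ^ 2| ≤ K + B ^ 2 + B ^ 2 := by
        have := le_of_abs_le (hK x)
        rw [abs_le]
        constructor <;> nlinarith [sq_nonneg (jR q k x), sq_nonneg (jI q k x)]
      have h5 := mul_le_mul (abs_deriv2_wt_le n x) (hlog x) (abs_nonneg _)
        (mul_nonneg hC (wt_pos n x).le)
      refine (abs_sub _ _).trans ?_
      rw [abs_mul, abs_mul, abs_mul, abs_of_pos (wt_pos n x), abs_of_pos (by norm_num : (0:ℝ) < 1 / 2)]
      have h6 := mul_le_mul_of_nonneg_left h4 (wt_pos n x).le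
      nlinarith [mul_nonneg (abs_nonneg (deriv (deriv (wt n)) x))
        (abs_nonneg (Real.log (1 + jR q k x / k)))]
    have h0 := integral_eq_zero_of_hasDerivAt_of_integrable hG iG' iG
    have hp : ∀ x, 0 ≤ (k ^ 2 + C / 4) * G' x +
        1 / 4 * (wt n x * q x ^ 2 + deriv (deriv (wt n)) x * q x) +
        (C * K ^ 2 + C ^ 2 * K) / k ^ 2 * wt n x := fun x => by
      have e1 : k ^ 2 * (jR q k x / k) = k * jR q k x := by field_simp
      have e2 : k ^ 2 * (jR q k x / k) ^ 2 = jR q k x ^ 2 := by field_simp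
      have h := virial_density_nonneg (I := jI q k x) (wt_pos n x).le hC (abs_deriv2_wt_le n x)
        (div_nonneg (hR0 x) hk0.le) (pow_pos hk0 2)
        (by rw [e1]; exact two_mul_mul_jR_le hc hi hw hk0 x) (le_of_abs_le (hK x))
      rw [e1, e2] at h
      refine h.trans_eq ?_
      rw [hG']
      ring
    have h : 0 ≤ ∫ x, ((k ^ 2 + C / 4) * G' x +
        1 / 4 * (wt n x * q x ^ 2 + deriv (deriv (wt n)) x * q x) +
        (C * K ^ 2 + C ^ 2 * K) / k ^ 2 * wt n x) := integral_nonneg hp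
    have i₁ : Integrable fun x => (k ^ 2 + C / 4) * G' x +
        1 / 4 * (wt n x * q x ^ 2 + deriv (deriv (wt n)) x * q x) :=
      (iG'.const_mul _).add (hJi.const_mul _)
    rw [integral_add i₁ (hwi.const_mul _),
      integral_add (iG'.const_mul _) (hJi.const_mul _), integral_const_mul, integral_const_mul,
      integral_const_mul, h0, mul_zero, zero_add] at h
    refine h.trans_eq ?_
    ring
  have hlim : Tendsto (fun k : ℝ => 1 / 4 * J + (C * K ^ 2 + C ^ 2 * K) * (∫ x, wt n x) / k ^ 2) atTop
      (𝓝 (1 / 4 * J + 0)) :=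
    (tendsto_const_nhds.div_atTop (tendsto_pow_atTop two_ne_zero)).const_add _
  have := ge_of_tendsto hlim ((eventually_ge_atTop R).mono key)
  linarith

end

lemma Tame.lintegral_lt_top {a : ℝ → ℝ} (h : Tame a) (h0 : ∀ t, 2 < t → 0 ≤ a t) :
    ∫⁻ t in Set.Ioi (2 : ℝ), ENNReal.ofReal (a t) < ⊤ := by
  obtain ⟨F, F', K, hF, hK, ha⟩ := h
  set s : ℕ → ℝ := fun n => 2 + 1 / ((n : ℝ) + 1) with hs
  have hs2 : ∀ n, 2 < s n := fun n => lt_add_of_pos_right _ (by positivity)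
  have hst : Tendsto s atTop (𝓝 2) := by
    have := (tendsto_one_div_add_atTop_nhds_zero_nat (𝕜 := ℝ)).const_add 2
    rwa [add_zero] at this
  have hderiv : ∀ n, ∀ x ∈ Set.Icc (s n) ((n : ℝ) + 3), HasDerivAt F (F' x) x := fun n x hx =>
    hF x ((hs2 n).trans_le hx.1)
  have hcont : ∀ n, ContinuousOn F (Set.Icc (s n) ((n : ℝ) + 3)) := fun n x hx =>
    (hderiv n x hx).continuousAt.continuousWithinAt
  have hn : ∀ n, s n ≤ (n : ℝ) + 3 := fun n => by
    have : 1 / ((n : ℝ) + 1) ≤ 1 := by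
      rw [div_le_one (by positivity)]; linarith [n.cast_nonneg (α := ℝ)]
    rw [hs]; simp only
    linarith [n.cast_nonneg (α := ℝ)]
  have hL1 : ∀ n, IntegrableOn F' (Set.Ioc (s n) ((n : ℝ) + 3)) := fun n =>
    intervalIntegral.integrableOn_deriv_of_nonneg (hcont n)
      (fun x hx => hderiv n x (Set.Ioo_subset_Icc_self hx))
      fun x hx => (h0 x ((hs2 n).trans hx.1)).trans (ha x ((hs2 n).trans hx.1))
  have hsub : ∀ n, Set.Ioc (s n) ((n : ℝ) + 3) ⊆ Set.Ioi 2 := fun n x hx => (hs2 n).trans hx.1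
  have hb : Tendsto (fun n : ℕ => (n : ℝ) + 3) atTop atTop :=
    tendsto_atTop_add_const_right _ _ tendsto_natCast_atTop_atTop
  have hi : IntegrableOn F' (Set.Ioi 2) := by
    refine ((aecover_Ioi_of_Ioi hst).inter (aecover_Iic hb).restrict).integrable_of_integral_bounded_of_nonneg_ae (2 * K)
      (fun n => (hL1 n).mono_measure Measure.restrict_le_self) ?_ ?_
    · exact (ae_restrict_iff' measurableSet_Ioi).2 (Eventually.of_forall fun x hx =>
        (h0 x hx).trans (ha x hx))
    · refine Eventually.of_forall fun n => ?_
      rw [Set.Ioi_inter_Iic, Measure.restrict_restrict_of_subset (hsub n), ← intervalIntegral.integral_of_le (hn n),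
        intervalIntegral.integral_eq_sub_of_hasDerivAt
          (fun x hx => hderiv n x (by rwa [Set.uIcc_of_le (hn n)] at hx))
          ((intervalIntegrable_iff_integrableOn_Ioc_of_le (hn n)).2 (hL1 n))]
      have h1 := abs_le.1 (hK _ (hs2 n))
      have h2 := abs_le.1 (hK _ ((hs2 n).trans_le (hn n)))
      linarith [h1.1, h2.2]
  refine lt_of_le_of_lt (setLIntegral_mono' measurableSet_Ioi fun t ht =>
    ENNReal.ofReal_le_ofReal (ha t ht)) ?_
  exact hi.lintegral_lt_top

lemma exp_neg_le_wt {c : ℝ} (hc : 0 < c) (x : ℝ) :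
    Real.exp (-(c * |x|)) ≤ (8 * (1 + (Nat.factorial 8) / c ^ 8)) * wt 4 x := by
  have h1 : (1 + x ^ 2) ^ 4 ≤ 8 * (1 + x ^ 8) := by
    nlinarith [sq_nonneg (x ^ 2 - 1), sq_nonneg (x ^ 4 - 1), sq_nonneg (x ^ 4 - x ^ 2), sq_nonneg x,
      mul_nonneg (sq_nonneg x) (sq_nonneg (x ^ 2 - 1)), mul_nonneg (sq_nonneg (x ^ 2)) (sq_nonneg (x ^ 2 - 1))]
  have hy : 0 ≤ c * |x| := by positivity
  have h2 := Real.pow_div_factorial_le_exp _ hy 8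
  rw [mul_pow, Even.pow_abs (by decide), div_le_iff₀ (by positivity), mul_comm] at h2
  have h3 : x ^ 8 ≤ Nat.factorial 8 / c ^ 8 * Real.exp (c * |x|) := by
    rw [div_mul_eq_mul_div, le_div_iff₀ (by positivity)]
    linarith
  have h4 : 1 ≤ Real.exp (c * |x|) := Real.one_le_exp hy
  rw [wt, inv_pow, Real.exp_neg, ← div_eq_mul_inv, le_div_iff₀ (by positivity), ← div_eq_inv_mul,
    div_le_iff₀ (Real.exp_pos _)]
  linarith

section
variable {M : ℝ} {u : ℝ → ℝ → ℝ}

lemma Sol.integral_wt_sq_le (h : Sol M u) {t : ℝ} (ht : 2 < t) :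
    2 / 3 * ((1 / 1) * ∫ x, wt 2 (x / 1) * (u t x) ^ 2) ≤ virLin 1 0 (u t) (wtInt 2) := by
  have hs := h.slice t
  have hp := reflectionless_integral_nonneg (q := fun x => u t x / 3) (K := 1) (n := 2)
    (hs.continuous.div_const 3) (hs.int.div_const 3) (fun k hk => h.jw_eq_zero hk ht)
    (fun x => by
      rw [abs_div, abs_of_pos (by norm_num : (0:ℝ) < 3)]
      have := hs.abs_le_one x
      linarith) (by norm_num)
  have i1 := integrable_wt_mul hs.int_sq 2 1
  simp only [div_one] at i1
  have i2 : Integrable fun x => deriv (deriv (wt 2)) x * u t x := by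
    have h2 : ContDiff ℝ 1 (deriv (wt 2)) := (contDiff_wt 2 (k := 2)).iterate_deriv' 1 1
    refine (integrable_mul_bdd hs.int (h2.continuous_deriv le_rfl) (B := wtC 2) fun x =>
      (abs_deriv2_wt_le 2 x).trans (mul_le_of_le_one_right (wtC_pos 2).le (wt_le_one 2 x)))
  have e : ∀ x, wt 2 x * (u t x / 3) ^ 2 + deriv (deriv (wt 2)) x * (u t x / 3) =
      1 / 9 * (wt 2 x * u t x ^ 2) + 1 / 3 * (deriv (deriv (wt 2)) x * u t x) := fun x => by ring
  simp only [e] at hp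
  rw [integral_add (i1.const_mul _) (i2.const_mul _), integral_const_mul, integral_const_mul] at hp
  rw [virLin, deriv_wtInt]
  simp only [div_one, zero_mul, neg_zero, one_pow, one_mul, zero_add]
  linarith

lemma Sol.tame_integral_wt_sq (h : Sol M u) :
    Tame fun t => (1 / 1) * ∫ x, wt 2 (x / 1) * (u t x) ^ 2 := by
  have h1 := (h.flow_fixed.tame_virLin (by norm_num) (loc_wtInt (by norm_num : 1 ≤ 2))
    (abs_wtInt_le (by norm_num))).const_mul (by norm_num : (0:ℝ) ≤ 3 / 2)
  refine h1.mono fun t ht => ?_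
  have := h.integral_wt_sq_le ht
  linarith

lemma Sol.kato (h : Sol M u) {c : ℝ} (hc : 0 < c) : (∫⁻ t in Set.Ioi (2:ℝ), ∫⁻ x : ℝ,
    ENNReal.ofReal (Real.exp (-(c * |x|)) *
      ((u t x) ^ 2 + (deriv (u t) x) ^ 2 + (deriv (deriv (u t)) x) ^ 2))) < ⊤ := by
  have h0 := h.tame_integral_wt_sq
  have h1 := h.flow_fixed.tame_deriv_sq (c := 1) (K := 0) (by norm_num) (loc_wtInt (by norm_num)) one_pos
    (fun _ _ => le_rfl) (fun _ _ => abs_zero.le) h0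
  have h2 := h.flow_fixed.tame_deriv2_sq (c := 1) (K := 0) (by norm_num) (loc_wtInt (by norm_num))
    (loc_wtInt (by norm_num)) one_pos (fun _ _ => le_rfl) (fun _ _ => abs_zero.le) h0
  set C : ℝ := 8 * (1 + (Nat.factorial 8) / c ^ 8) with hC
  have hC0 : 0 ≤ C := by positivity
  simp only [div_one, one_mul] at h0 h1 h2
  have hT := ((h0.add h1).add h2).const_mul hC0
  refine lt_of_le_of_lt (setLIntegral_mono' measurableSet_Ioi fun t _ => ?_)
    (hT.lintegral_lt_top fun t _ => ?_)
  · have hs := h.slice t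
    have i0 := integrable_wt_mul hs.int_sq 2 1
    have i1 := integrable_wt_mul hs.int_deriv_sq 3 1
    have i2 := integrable_wt_mul hs.int_deriv2_sq 4 1
    simp only [div_one] at i0 i1 i2
    have i01 : Integrable fun x => wt 2 x * u t x ^ 2 + wt 3 x * deriv (u t) x ^ 2 := i0.add i1
    have i012 : Integrable fun x => wt 2 x * u t x ^ 2 + wt 3 x * deriv (u t) x ^ 2 +
        wt 4 x * deriv (deriv (u t)) x ^ 2 := i01.add i2
    rw [← integral_add i0 i1, ← integral_add i01 i2, ← integral_const_mul,
      ofReal_integral_eq_lintegral_ofReal (i012.const_mul C) (Eventually.of_forall fun x => ?_)]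
    · refine lintegral_mono fun x => ENNReal.ofReal_le_ofReal ?_
      have w2 := wt_anti (by norm_num : 2 ≤ 4) x
      have w3 := wt_anti (by norm_num : 3 ≤ 4) x
      have a0 := mul_le_mul_of_nonneg_right w2 (sq_nonneg (u t x))
      have a1 := mul_le_mul_of_nonneg_right w3 (sq_nonneg (deriv (u t) x))
      refine (mul_le_mul_of_nonneg_right (exp_neg_le_wt hc x) (by positivity)).trans ?_
      rw [mul_assoc]
      refine mul_le_mul_of_nonneg_left ?_ hC0
      linarith
    · have := wt_pos 2 x
      have := wt_pos 3 x
      have := wt_pos 4 x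
      simp only [Pi.zero_apply]
      positivity
  · refine mul_nonneg hC0 (add_nonneg (add_nonneg ?_ ?_) ?_) <;>
      exact integral_nonneg fun x => mul_nonneg (wt_pos _ x).le (sq_nonneg _)

end

/-- Decay for KdV: for small solutions of `∂ₜu + ∂ₓ(∂ₓ²u + u²) = 0`, bounded in
L¹ uniformly in time, the local H¹ norm on
`I(t) = (−C|t|^{1/2}/log|t|, C|t|^{1/2}/log|t|)` tends to `0` as `t → ±∞`, and
the Kato smoothing estimate
`∫₂^∞ ∫ e^{−c₀|x|}(u² + (∂ₓu)² + (∂ₓ²u)²) dx dt < ∞` holds. -/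
theorem kdv_decay_in_parabolic_region :
    ∃ ε > 0, ∀ u : ℝ → ℝ → ℝ,
      (∀ x, ContDiff ℝ 1 (fun t => u t x)) →
      (∀ t, ContDiff ℝ 4 (fun x => u t x)) →
      (∀ t x, deriv (fun s => u s x) t
          + deriv (fun y => deriv (deriv (u t)) y + (u t y) ^ 2) x = 0) →
      (∀ t, Integrable (fun x => (u t x) ^ 2)) →
      (∀ t, Integrable (fun x => (deriv (u t) x) ^ 2)) →
      (∀ t, Integrable (fun x => (deriv (deriv (u t)) x) ^ 2)) →
      (∀ t, Integrable (u t)) →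
      (∃ M : ℝ, ∀ t, (∫ x, |u t x|) ≤ M) →
      -- the virial identities (valid thanks to the decay in x of the solution)
      (∀ ψ : ℝ → ℝ, ContDiff ℝ 3 ψ → (∃ M : ℝ, ∀ n ≤ 3, ∀ x, |iteratedDeriv n ψ x| ≤ M) →
        ∀ t : ℝ, 2 < |t| → HasDerivAt (fun s => ∫ x, ψ (x / lam s) * u s x)
          (-(deriv lam t / lam t) * (∫ x, (x / lam t) * deriv ψ (x / lam t) * u t x)
            + (1 / (lam t) ^ 3) * (∫ x, deriv (deriv (deriv ψ)) (x / lam t) * u t x)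
            + (1 / lam t) * ∫ x, deriv ψ (x / lam t) * (u t x) ^ 2) t) →
      (∀ φ : ℝ → ℝ, ContDiff ℝ 3 φ → (∃ M : ℝ, ∀ n ≤ 3, ∀ x, |iteratedDeriv n φ x| ≤ M) →
        ∀ t : ℝ, 2 < |t| → HasDerivAt (fun s => (1/2) * ∫ x, φ (x / lam s) * (u s x) ^ 2)
          (-(deriv lam t / (2 * lam t)) *
              (∫ x, (x / lam t) * deriv φ (x / lam t) * (u t x) ^ 2)
            - (3 / (2 * lam t)) * (∫ x, deriv φ (x / lam t) * (deriv (u t) x) ^ 2)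
            + (1 / (2 * (lam t) ^ 3)) *
                (∫ x, deriv (deriv (deriv φ)) (x / lam t) * (u t x) ^ 2)
            + (1 / lam t) * ∫ x, deriv φ (x / lam t) * (2/3) * (u t x) ^ 3) t) →
      (∀ φ : ℝ → ℝ, ContDiff ℝ 3 φ → (∃ M : ℝ, ∀ n ≤ 3, ∀ x, |iteratedDeriv n φ x| ≤ M) →
        ∀ t : ℝ, 2 < |t| → HasDerivAt (fun s => (1/2) * ∫ x, φ (x / lam s) *
            ((deriv (u s) x) ^ 2 - (2/3) * (u s x) ^ 3))
          (-(deriv lam t / (2 * lam t)) * (∫ x, (x / lam t) * deriv φ (x / lam t) *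
                ((deriv (u t) x) ^ 2 - (2/3) * (u t x) ^ 3))
            - (3 / (2 * lam t)) * (∫ x, deriv φ (x / lam t) * (deriv (deriv (u t)) x) ^ 2)
            + (1 / (2 * (lam t) ^ 3)) *
                (∫ x, deriv (deriv (deriv φ)) (x / lam t) * (deriv (u t) x) ^ 2)
            + (1 / (3 * (lam t) ^ 3)) *
                (∫ x, deriv (deriv (deriv φ)) (x / lam t) * (u t x) ^ 3)
            + (2 / lam t) * (∫ x, deriv φ (x / lam t) *
                deriv (fun y => (u t y) ^ 2) x * deriv (u t) x)
            + (2 / (lam t) ^ 2) * (∫ x, deriv (deriv φ) (x / lam t) *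
                (u t x) ^ 2 * deriv (u t) x)
            - (1 / (2 * lam t)) * ∫ x, deriv φ (x / lam t) * (u t x) ^ 4) t) →
      -- smallness in H¹, uniformly in time
      (∀ t, Real.sqrt (∫ x, ((u t x) ^ 2 + (deriv (u t) x) ^ 2)) < ε) →
      (∀ C > 0,
        Tendsto (fun t => ∫ x in Set.Ioo (-(C * lam t)) (C * lam t),
            ((u t x) ^ 2 + (deriv (u t) x) ^ 2)) atTop (𝓝 0)
        ∧ Tendsto (fun t => ∫ x in Set.Ioo (-(C * lam t)) (C * lam t),
            ((u t x) ^ 2 + (deriv (u t) x) ^ 2)) atBot (𝓝 0))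
      ∧ ∀ c₀ > 0, (∫⁻ t in Set.Ioi (2:ℝ), ∫⁻ x : ℝ,
          ENNReal.ofReal (Real.exp (-(c₀ * |x|)) *
            ((u t x) ^ 2 + (deriv (u t) x) ^ 2 + (deriv (deriv (u t)) x) ^ 2))) < ⊤ := by
  refine ⟨1, one_pos, fun u _ hsm _ hsq hdsq hd2sq hL1 ⟨M, hM⟩ hlin hmass hen hH => ?_⟩
  have h1 (t : ℝ) : (∫ x, ((u t x) ^ 2 + (deriv (u t) x) ^ 2)) ≤ 1 := by
    simpa using ((Real.sqrt_lt' one_pos).1 (hH t)).le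
  have h : Sol M u :=
    { slice := fun t => ⟨hsm t, hL1 t, hsq t, hdsq t, hd2sq t, hM t, h1 t⟩
      lin := fun ψ hψ t ht => hlin ψ hψ.1 hψ.2 t ht
      mass := fun φ hφ t ht => hmass φ hφ.1 hφ.2 t ht
      energy := fun φ hφ t ht => hen φ hφ.1 hφ.2 t ht }
  exact ⟨fun C _ => h.decay C, fun c hc => h.kato hc⟩
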